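/- With a₁ = ∏_{p prime} (1 − 1/(p(p−1))) and a₂ = ∏_{p prime} (1 − (2p−1)/(p²(p−1))), one has Σ_{x ≤ p ≤ 2x, p prime} (φ(p−1)/(p−1)) · (1 + φ(φ(p²))/p²) = (a₁ + a₂) · (x/log x) · (1 + O(1/log x)) as x → ∞. -/

import Mathlib

/-- Artin's constant `a₁ = ∏_p (1 − 1/(p(p−1)))`, product over all primes. -/
noncomputable def artinA1 : ℝ :=
  ∏' p : Nat.Primes, (1 - 1 / (((p : ℕ) : ℝ) * (((p : ℕ) : ℝ) - 1)))

/-- The constant `a₂ = ∏_p (1 − (2p−1)/(p²(p−1)))`, product over all primes. -/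
noncomputable def artinA2 : ℝ :=
  ∏' p : Nat.Primes,
    (1 - (2 * ((p : ℕ) : ℝ) - 1) / (((p : ℕ) : ℝ) ^ 2 * (((p : ℕ) : ℝ) - 1)))

namespace ArtinMean

open Complex Set Filter Topology MeasureTheory Asymptotics

section Periodic

theorem sum_range_periodic {E : Type*} [NormedAddCommGroup E] {g : ℕ → E} {N : ℕ}
    (hp : ∀ n, g (n + N) = g n) (hz : ∑ n ∈ Finset.range N, g n = 0) (q r : ℕ) :
    ∑ n ∈ Finset.range (N * q + r), g n = ∑ n ∈ Finset.range r, g n := by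
  have hp' : ∀ q n, g (N * q + n) = g n := by
    intro q
    induction q with
    | zero => simp
    | succ q ih => intro n; rw [← ih n, ← hp (N * q + n)]; congr 1; ring
  induction q with
  | zero => simp
  | succ q ih =>
    have : N * (q + 1) + r = N + (N * q + r) := by ring
    rw [this, Finset.sum_range_add, hz, zero_add, ← ih]
    refine Finset.sum_congr rfl fun n _ => ?_
    rw [add_comm, hp]

theorem norm_sum_range_periodic_le {E : Type*} [NormedAddCommGroup E] {g : ℕ → E} {N : ℕ}
    (hN : 0 < N) (hp : ∀ n, g (n + N) = g n) (hz : ∑ n ∈ Finset.range N, g n = 0)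
    {b : ℝ} (hb : ∀ n, ‖g n‖ ≤ b) (M : ℕ) :
    ‖∑ n ∈ Finset.range M, g n‖ ≤ b * N := by
  have hb0 : 0 ≤ b := (norm_nonneg _).trans (hb 0)
  rw [← Nat.div_add_mod M N, sum_range_periodic hp hz]
  refine (norm_sum_le_of_le _ fun n _ => hb n).trans ?_
  rw [Finset.sum_const, Finset.card_range, nsmul_eq_mul, mul_comm]
  gcongr
  exact (Nat.mod_lt _ hN).le

end Periodic

section Character

variable {N : ℕ} (χ : DirichletCharacter ℂ N)

/-- The mean value of a Dirichlet character over a period. -/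
noncomputable def charMean : ℂ := (∑ n ∈ Finset.range N, χ n) / N

/-- The deviation of the summatory function of a Dirichlet character from its mean. -/
noncomputable def charErr (u : ℝ) : ℂ := ∑ n ∈ Finset.Icc 1 ⌊u⌋₊, χ n - charMean χ * u

theorem norm_charMean_le : ‖charMean χ‖ ≤ 1 := by
  unfold charMean
  rw [norm_div, Complex.norm_natCast]
  refine div_le_one_of_le₀ ?_ (by positivity)
  refine (norm_sum_le_of_le _ fun n _ => χ.norm_le_one _).trans ?_
  simp

theorem sum_range_char [NeZero N] : ∑ n ∈ Finset.range N, χ n = ∑ a : ZMod N, χ a := by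
  obtain ⟨M, rfl⟩ := Nat.exists_eq_succ_of_ne_zero (NeZero.ne N)
  rw [Finset.sum_range]
  refine Finset.sum_congr rfl fun a _ => ?_
  congr 1
  exact Fin.cast_val_eq_self a

theorem charMean_eq_zero [NeZero N] {χ : DirichletCharacter ℂ N} (h : χ ≠ 1) :
    charMean χ = 0 := by
  rw [charMean, sum_range_char, MulChar.sum_eq_zero_of_ne_one h, zero_div]

theorem charMean_modOne (χ : DirichletCharacter ℂ 1) : charMean χ = 1 := by
  have : χ = 1 := DirichletCharacter.level_one χ
  simp [charMean, this, MulChar.one_apply (isUnit_of_subsingleton _)]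

theorem norm_charErr_le [NeZero N] {u : ℝ} (hu : 0 ≤ u) : ‖charErr χ u‖ ≤ 4 * N := by
  have hN : 0 < N := Nat.pos_of_ne_zero (NeZero.ne N)
  have h1 : ‖∑ n ∈ Finset.range (⌊u⌋₊ + 1), (χ n - charMean χ)‖ ≤ 2 * N := by
    refine norm_sum_range_periodic_le hN (fun n => by simp) ?_ (fun n => ?_) _
    · rw [Finset.sum_sub_distrib, Finset.sum_const, Finset.card_range, charMean, nsmul_eq_mul]
      have : (N : ℂ) ≠ 0 := by exact_mod_cast hN.ne'
      field_simp; ring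
    · refine (norm_sub_le _ _).trans ?_
      linarith [χ.norm_le_one n, norm_charMean_le χ]
  have h2 : charErr χ u = ∑ n ∈ Finset.range (⌊u⌋₊ + 1), (χ n - charMean χ) - χ 0
      + charMean χ * ((⌊u⌋₊ + 1 - u : ℝ) : ℂ) := by
    rw [charErr, Finset.sum_sub_distrib, Finset.sum_const, Finset.card_range, nsmul_eq_mul,
      Finset.range_eq_Ico, Finset.sum_eq_sum_Ico_succ_bot (by omega)]
    have : Finset.Ico (0 + 1) (⌊u⌋₊ + 1) = Finset.Icc 1 ⌊u⌋₊ := by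
      ext; simp
    rw [this]
    push_cast
    ring
  rw [h2]
  refine (norm_add_le _ _).trans ?_
  have h3 : ‖charMean χ * ((⌊u⌋₊ + 1 - u : ℝ) : ℂ)‖ ≤ 1 * 1 := by
    rw [norm_mul]
    refine mul_le_mul (norm_charMean_le χ) ?_ (norm_nonneg _) zero_le_one
    rw [Complex.norm_real, Real.norm_eq_abs, abs_le]
    constructor <;> linarith [Nat.floor_le hu, Nat.lt_floor_add_one u]
  have h4 := (norm_sub_le (∑ n ∈ Finset.range (⌊u⌋₊ + 1), (χ n - charMean χ)) (χ 0))
  have h5 := χ.norm_le_one 0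
  have : (1 : ℝ) ≤ N := by exact_mod_cast hN
  linarith

end Character

section Continuation

variable {N : ℕ} (χ : DirichletCharacter ℂ N)

/-- The regular part of the continuation of a Dirichlet `L`-series to `0 < re s`. -/
noncomputable def regPart (s : ℂ) : ℂ :=
  s * mellin (indicator (Ioi 1) (charErr χ)) (-s)

/-- The continuation of a Dirichlet `L`-series to `0 < re s`, with its pole at `1`. -/
noncomputable def contL (s : ℂ) : ℂ := charMean χ * s / (s - 1) + regPart χ s

theorem measurable_charErr : Measurable (charErr χ) := by
  unfold charErr
  have h : Measurable fun k : ℕ => ∑ n ∈ Finset.Icc 1 k, χ n := measurable_from_top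
  exact (h.comp Nat.measurable_floor).sub
    (measurable_const.mul Complex.measurable_ofReal)

theorem mellin_indicator_charErr (s : ℂ) :
    mellin (indicator (Ioi 1) (charErr χ)) (-s) =
      ∫ u in Ioi (1 : ℝ), charErr χ u * (u : ℂ) ^ (-s - 1) := by
  rw [mellin]
  have : ∀ u : ℝ, (u : ℂ) ^ (-s - 1) • indicator (Ioi 1) (charErr χ) u =
      indicator (Ioi 1) (fun u : ℝ => charErr χ u * (u : ℂ) ^ (-s - 1)) u := by
    intro u
    by_cases h : u ∈ Ioi (1 : ℝ) <;> simp [h, mul_comm]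
  simp_rw [this]
  rw [setIntegral_indicator measurableSet_Ioi]
  congr 2
  ext u; simp only [mem_inter_iff, mem_Ioi]; constructor
  · exact fun h => h.2
  · exact fun h => ⟨by linarith, h⟩

variable [NeZero N]

theorem integrableOn_charErr {s : ℂ} (hs : 0 < s.re) {X : ℝ} (hX : 1 ≤ X) :
    IntegrableOn (fun u : ℝ => charErr χ u * (u : ℂ) ^ (-s - 1)) (Ioi X) := by
  have hX0 : 0 < X := by linarith
  have h := (integrableOn_Ioi_cpow_of_lt (a := -s - 1) (by simp; linarith) hX0)
  refine Integrable.bdd_mul (c := 4 * N) h ((measurable_charErr χ).aestronglyMeasurable) ?_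
  refine (ae_restrict_iff' measurableSet_Ioi).2 (Eventually.of_forall fun u hu => ?_)
  exact norm_charErr_le χ (hX0.trans hu).le

theorem differentiableAt_regPart {s : ℂ} (hs : 0 < s.re) :
    DifferentiableAt ℂ (regPart χ) s := by
  have h1 : DifferentiableAt ℂ (mellin (indicator (Ioi 1) (charErr χ))) (-s) := by
    refine mellin_differentiableAt_of_isBigO_rpow (a := 0) (b := (-s).re - 1) ?_ ?_ (by simpa) ?_
      (by simp)
    · have hm : Measurable (indicator (Ioi 1) (charErr χ)) :=
        (measurable_charErr χ).indicator measurableSet_Ioi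
      refine LocallyIntegrable.locallyIntegrableOn ?_ _
      have hc : LocallyIntegrable (fun _ : ℝ => (4 * N : ℝ)) := locallyIntegrable_const _
      refine hc.mono hm.aestronglyMeasurable (Eventually.of_forall fun u => ?_)
      by_cases h : u ∈ Ioi (1 : ℝ)
      · rw [indicator_of_mem h]
        refine (norm_charErr_le χ (zero_le_one.trans (le_of_lt h))).trans (le_abs_self _)
      · rw [indicator_of_notMem h, norm_zero]; positivity
    · refine IsBigO.of_bound (4 * N) ?_
      filter_upwards [eventually_gt_atTop (1 : ℝ)] with u hu
      rw [indicator_of_mem (mem_Ioi.2 hu)]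
      simpa using norm_charErr_le χ (zero_le_one.trans hu.le)
    · refine (isBigO_zero _ _).congr' ?_ EventuallyEq.rfl
      have : Iio (1 : ℝ) ∈ 𝓝[>] (0 : ℝ) := mem_nhdsWithin_of_mem_nhds (Iio_mem_nhds one_pos)
      filter_upwards [this] with u hu
      rw [indicator_of_notMem]; simpa using le_of_lt hu
  unfold regPart
  exact differentiableAt_id.mul (h1.comp s differentiableAt_id.neg)

theorem LSeries_eq_contL {s : ℂ} (hs : 1 < s.re) : LSeries (fun n => χ n) s = contL χ s := by
  have hs0 : s ≠ 0 := by rintro rfl; simp at hs; linarith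
  have hs1 : s - 1 ≠ 0 := by
    intro h; rw [sub_eq_zero] at h; simp [h] at hs
  have hO : (fun n : ℕ ↦ ∑ k ∈ Finset.Icc 1 n, χ k) =O[atTop] fun n ↦ (n : ℝ) ^ (1 : ℝ) := by
    refine IsBigO.of_bound 1 (Eventually.of_forall fun n => ?_)
    refine (norm_sum_le_of_le _ fun n _ => χ.norm_le_one _).trans ?_
    simp
  rw [LSeries_eq_mul_integral _ zero_le_one hs (χ.LSeriesSummable_of_one_lt_re hs) hO, contL,
    regPart, mellin_indicator_charErr]
  have h1 : ∀ u ∈ Ioi (1 : ℝ), (∑ k ∈ Finset.Icc 1 ⌊u⌋₊, χ k) * (u : ℂ) ^ (-(s + 1)) =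
      charErr χ u * (u : ℂ) ^ (-s - 1) + charMean χ * (u : ℂ) ^ (-s) := by
    intro u hu
    have hu0 : (u : ℂ) ≠ 0 := by
      have : (0 : ℝ) < u := zero_lt_one.trans hu
      exact_mod_cast this.ne'
    have : (u : ℂ) ^ (-s) = u * (u : ℂ) ^ (-s - 1) := by
      rw [cpow_sub _ _ hu0, cpow_one]; field_simp
    rw [this, charErr, neg_add']; ring
  have h2 : IntegrableOn (fun u : ℝ => (u : ℂ) ^ (-s)) (Ioi 1) :=
    integrableOn_Ioi_cpow_of_lt (by simpa using hs) one_pos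
  rw [setIntegral_congr_fun measurableSet_Ioi h1, integral_add
    (integrableOn_charErr χ (by linarith) le_rfl) (h2.const_mul _), integral_const_mul,
    integral_Ioi_cpow_of_lt (by simpa using hs) one_pos]
  have hs2 : -s + 1 ≠ 0 := by
    intro h; apply hs1; linear_combination -h
  simp
  field_simp
  ring

theorem sum_char_mul_cpow {X : ℝ} (_hX : 1 ≤ X) {s : ℂ} (hs : 0 < s.re) :
    ∑ n ∈ Finset.Icc 1 ⌊X⌋₊, χ n * (n : ℂ) ^ (-s) =
      (charErr χ X + charMean χ * X) * (X : ℂ) ^ (-s) +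
      s * (∫ u in Ioc 1 X, charErr χ u * (u : ℂ) ^ (-s - 1)) +
      charMean χ * (s * ∫ u in Ioc 1 X, (u : ℂ) ^ (-s)) := by
  have hs0 : -s ≠ 0 := by rintro h; rw [neg_eq_zero] at h; simp [h] at hs
  have hd : ∀ t ∈ Icc (1 : ℝ) X, HasDerivAt (fun u : ℝ => (u : ℂ) ^ (-s))
      (-s * (t : ℂ) ^ (-s - 1)) t := fun t ht =>
    hasDerivAt_ofReal_cpow_const (by linarith [ht.1]) hs0
  have hcont : ContinuousOn (fun t : ℝ => -s * (t : ℂ) ^ (-s - 1)) (Icc 1 X) := by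
    refine continuousOn_const.mul fun t ht => ContinuousAt.continuousWithinAt ?_
    exact continuousAt_ofReal_cpow_const _ _ (Or.inr (by linarith [ht.1]))
  have hI : ∀ k, ∑ n ∈ Finset.Icc 0 k, (if n = 0 then 0 else χ (n : ℕ)) =
      ∑ n ∈ Finset.Icc 1 k, χ n := by
    intro k
    rw [← Finset.insert_Icc_add_one_left_eq_Icc (Nat.zero_le _), Finset.sum_insert (by simp)]
    simp only [if_true, zero_add]
    refine Finset.sum_congr rfl fun n hn => ?_
    rw [if_neg (by have := (Finset.mem_Icc.1 hn).1; omega)]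
  have key := sum_mul_eq_sub_integral_mul₀ (fun n : ℕ => if n = 0 then 0 else χ n) (by simp)
    (f := fun u : ℝ => (u : ℂ) ^ (-s)) X (fun t ht => (hd t ht).differentiableAt)
    ((hcont.integrableOn_Icc).congr_fun (fun t ht => (hd t ht).deriv.symm) measurableSet_Icc)
  have hL : ∑ k ∈ Finset.Icc 0 ⌊X⌋₊, ((k : ℝ) : ℂ) ^ (-s) * (if k = 0 then 0 else χ (k : ℕ)) =
      ∑ n ∈ Finset.Icc 1 ⌊X⌋₊, χ n * (n : ℂ) ^ (-s) := by
    rw [← Finset.insert_Icc_add_one_left_eq_Icc (Nat.zero_le _), Finset.sum_insert (by simp)]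
    simp only [if_true, mul_zero, zero_add]
    refine Finset.sum_congr rfl fun n hn => ?_
    rw [if_neg (by have := (Finset.mem_Icc.1 hn).1; omega), mul_comm]
    simp
  rw [hL] at key
  rw [key, hI]
  have h1 : ∀ u ∈ Ioc (1 : ℝ) X, deriv (fun u : ℝ => (u : ℂ) ^ (-s)) u *
      ∑ n ∈ Finset.Icc 0 ⌊u⌋₊, (if n = 0 then 0 else χ (n : ℕ)) =
      -s * (charErr χ u * (u : ℂ) ^ (-s - 1)) + -s * (charMean χ * (u : ℂ) ^ (-s)) := by
    intro u hu
    have hu0 : (u : ℂ) ≠ 0 := by exact_mod_cast (by linarith [hu.1] : u ≠ 0)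
    have : (u : ℂ) ^ (-s) = u * (u : ℂ) ^ (-s - 1) := by
      rw [cpow_sub _ _ hu0, cpow_one]; field_simp
    rw [(hd u ⟨hu.1.le, hu.2⟩).deriv, hI, this, charErr]; ring
  have h2 : IntegrableOn (fun u : ℝ => (u : ℂ) ^ (-s)) (Ioc 1 X) := by
    refine (ContinuousOn.integrableOn_Icc fun t ht => ?_).mono_set Ioc_subset_Icc_self
    exact (hd t ht).continuousAt.continuousWithinAt
  rw [setIntegral_congr_fun measurableSet_Ioc h1, integral_add
    (((integrableOn_charErr χ hs le_rfl).mono_set Ioc_subset_Ioi_self).const_mul _)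
    ((h2.const_mul _).const_mul _), integral_const_mul, integral_const_mul, integral_const_mul,
    charErr]
  ring

theorem regPart_eq {X : ℝ} (hX : 1 ≤ X) {s : ℂ} (hs : 0 < s.re) :
    regPart χ s = ∑ n ∈ Finset.Icc 1 ⌊X⌋₊, χ n * (n : ℂ) ^ (-s) - charErr χ X * (X : ℂ) ^ (-s)
      + s * (∫ u in Ioi X, charErr χ u * (u : ℂ) ^ (-s - 1))
      - charMean χ * (X * (X : ℂ) ^ (-s) + s * ∫ u in Ioc 1 X, (u : ℂ) ^ (-s)) := by
  rw [sum_char_mul_cpow χ hX hs, regPart, mellin_indicator_charErr]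
  have h := integrableOn_charErr χ hs le_rfl
  rw [← Ioc_union_Ioi_eq_Ioi hX, setIntegral_union Ioc_disjoint_Ioi_same
    measurableSet_Ioi (h.mono_set Ioc_subset_Ioi_self) (h.mono_set (Ioi_subset_Ioi hX))]
  ring

theorem contL_eq {X : ℝ} (hX : 1 ≤ X) {s : ℂ} (hs : 0 < s.re) (hs1 : s ≠ 1) :
    contL χ s = ∑ n ∈ Finset.Icc 1 ⌊X⌋₊, χ n * (n : ℂ) ^ (-s) - charErr χ X * (X : ℂ) ^ (-s)
      + s * (∫ u in Ioi X, charErr χ u * (u : ℂ) ^ (-s - 1))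
      + charMean χ * ((X : ℂ) ^ (1 - s) / (s - 1)) := by
  rw [contL, regPart_eq χ hX hs, ← intervalIntegral.integral_of_le hX]
  have hX0 : (X : ℂ) ≠ 0 := by exact_mod_cast (by linarith : X ≠ 0)
  have h1 : (∫ u in (1:ℝ)..X, (u : ℂ) ^ (-s)) = ((X : ℂ) ^ (1 - s) - 1) / (1 - s) := by
    rw [integral_cpow]
    · simp [neg_add_eq_sub]
    · right
      refine ⟨fun h => hs1 (by linear_combination -h), ?_⟩
      rw [uIcc_of_le hX]; simp
  have h2 : (X : ℂ) ^ (1 - s) = X * (X : ℂ) ^ (-s) := by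
    rw [sub_eq_add_neg, cpow_add _ _ hX0, cpow_one]
  have h3 : s - 1 ≠ 0 := sub_ne_zero.2 hs1
  have h4 : 1 - s ≠ 0 := sub_ne_zero.2 hs1.symm
  rw [h1, h2]
  have h5 : s * (((X : ℂ) * (X : ℂ) ^ (-s) - 1) / (1 - s)) =
    - (s * (((X : ℂ) * (X : ℂ) ^ (-s) - 1) / (s - 1))) := by
    rw [← neg_sub s 1, div_neg]; ring
  rw [h5]
  field_simp
  ring

end Continuation

section UpperBound

variable {N : ℕ} [NeZero N] (χ : DirichletCharacter ℂ N)

omit [NeZero N] in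
theorem norm_sum_char_mul_cpow_le {ε : ℝ} (hε : 0 < ε) {X : ℝ} (hX : 0 ≤ X) {s : ℂ}
    (hs : 1 - ε ≤ s.re) :
    ‖∑ n ∈ Finset.Icc 1 ⌊X⌋₊, χ n * (n : ℂ) ^ (-s)‖ ≤
      X ^ (2 * ε) * ∑' n : ℕ, (n : ℝ) ^ (-(1 + ε)) := by
  have hsum : Summable fun n : ℕ => (n : ℝ) ^ (-(1 + ε)) :=
    Real.summable_nat_rpow.2 (by linarith)
  calc ‖∑ n ∈ Finset.Icc 1 ⌊X⌋₊, χ n * (n : ℂ) ^ (-s)‖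
      ≤ ∑ n ∈ Finset.Icc 1 ⌊X⌋₊, X ^ (2 * ε) * (n : ℝ) ^ (-(1 + ε)) := by
        refine norm_sum_le_of_le _ fun n hn => ?_
        obtain ⟨h1, h2⟩ := Finset.mem_Icc.1 hn
        have hn0 : (0 : ℝ) < n := by exact_mod_cast h1
        have hn1 : (1 : ℝ) ≤ n := by exact_mod_cast h1
        have hnX : (n : ℝ) ≤ X := (Nat.le_floor_iff hX).1 h2
        rw [norm_mul]
        have : ‖(n : ℂ) ^ (-s)‖ = (n : ℝ) ^ (-s.re) := by
          rw [← Complex.ofReal_natCast, Complex.norm_cpow_eq_rpow_re_of_pos hn0, neg_re]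
        rw [this]
        calc ‖χ n‖ * (n : ℝ) ^ (-s.re) ≤ 1 * (n : ℝ) ^ (2 * ε + -(1 + ε)) := by
              gcongr
              · exact χ.norm_le_one _
              linarith
          _ = (n : ℝ) ^ (2 * ε) * (n : ℝ) ^ (-(1 + ε)) := by rw [one_mul, Real.rpow_add hn0]
          _ ≤ _ := by gcongr
    _ = X ^ (2 * ε) * ∑ n ∈ Finset.Icc 1 ⌊X⌋₊, (n : ℝ) ^ (-(1 + ε)) := by rw [Finset.mul_sum]
    _ ≤ _ := by
        gcongr
        exact hsum.sum_le_tsum _ fun n _ => by positivity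

theorem norm_integral_charErr_le {X : ℝ} (hX : 1 ≤ X) {s : ℂ} (hs : 0 < s.re) :
    ‖∫ u in Ioi X, charErr χ u * (u : ℂ) ^ (-s - 1)‖ ≤ 4 * N * (X ^ (-s.re) / s.re) := by
  have hX0 : 0 < X := by linarith
  have h1 : ∫ u in Ioi X, 4 * N * u ^ (-s.re - 1) = 4 * N * (X ^ (-s.re) / s.re) := by
    rw [integral_const_mul, integral_Ioi_rpow_of_lt (by linarith) hX0]
    rw [sub_add_cancel, div_neg, neg_div, neg_neg]
  rw [← h1]
  refine norm_integral_le_of_norm_le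
    ((integrableOn_Ioi_rpow_of_lt (by linarith) hX0).const_mul _) ?_
  refine (ae_restrict_iff' measurableSet_Ioi).2 (Eventually.of_forall fun u hu => ?_)
  have hu0 : 0 < u := hX0.trans hu
  rw [norm_mul, Complex.norm_cpow_eq_rpow_re_of_pos hu0]
  simp only [sub_re, neg_re, one_re]
  gcongr
  exact norm_charErr_le χ hu0.le

theorem norm_truncation_le {ε : ℝ} (hε : 0 < ε) (hε' : ε ≤ 1 / 2) {X : ℝ} (hX : 1 ≤ X) {s : ℂ}
    (hs : 1 - ε ≤ s.re) (hs3 : s.re ≤ 3) (hXs : X = N * (1 + |s.im|)) :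
    ‖∑ n ∈ Finset.Icc 1 ⌊X⌋₊, χ n * (n : ℂ) ^ (-s) - charErr χ X * (X : ℂ) ^ (-s)
      + s * (∫ u in Ioi X, charErr χ u * (u : ℂ) ^ (-s - 1))‖ ≤
      (∑' n : ℕ, (n : ℝ) ^ (-(1 + ε)) + 28) * X ^ (2 * ε) := by
  have hX0 : 0 < X := by linarith
  have hs0 : 0 < s.re := by linarith
  have hN : (N : ℝ) ≤ X := by
    rw [hXs]; nlinarith [abs_nonneg s.im, (Nat.cast_nonneg N : (0:ℝ) ≤ N)]
  have hpow : X * X ^ (-s.re) ≤ X ^ (2 * ε) := by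
    rw [mul_comm, ← Real.rpow_add_one hX0.ne']
    exact Real.rpow_le_rpow_of_exponent_le hX (by linarith)
  have h1 := norm_sum_char_mul_cpow_le χ hε hX0.le hs
  have h2 : ‖charErr χ X * (X : ℂ) ^ (-s)‖ ≤ 4 * X ^ (2 * ε) := by
    rw [norm_mul, Complex.norm_cpow_eq_rpow_re_of_pos hX0, neg_re]
    calc _ ≤ 4 * X * X ^ (-s.re) := by
          gcongr
          exact (norm_charErr_le χ hX0.le).trans (by linarith)
      _ ≤ _ := by linarith
  have h3 : ‖s * (∫ u in Ioi X, charErr χ u * (u : ℂ) ^ (-s - 1))‖ ≤ 24 * X ^ (2 * ε) := by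
    rw [norm_mul]
    have hns : ‖s‖ ≤ 3 * (1 + |s.im|) := by
      refine (Complex.norm_le_abs_re_add_abs_im s).trans ?_
      rw [abs_of_pos hs0]; nlinarith [abs_nonneg s.im]
    calc _ ≤ (3 * (1 + |s.im|)) * (4 * N * (X ^ (-s.re) / s.re)) := by
          gcongr
          exact norm_integral_charErr_le χ hX hs0
      _ = 12 * (X * X ^ (-s.re)) / s.re := by rw [hXs]; ring
      _ ≤ 12 * (X * X ^ (-s.re)) / (1 / 2) := by
          gcongr; linarith
      _ ≤ _ := by linarith
  calc _ ≤ _ := norm_add_le _ _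
    _ ≤ _ := add_le_add (norm_sub_le _ _) le_rfl
    _ ≤ _ := by linarith

/-- Polynomial growth of Dirichlet `L`-functions near the line `re s = 1`. -/
theorem exists_norm_contL_le {ε : ℝ} (hε : 0 < ε) (hε' : ε ≤ 1 / 2) :
    ∃ C : ℝ, 1 ≤ C ∧ ∀ (N : ℕ) [NeZero N] (χ : DirichletCharacter ℂ N) (s : ℂ),
      1 - ε ≤ s.re → s.re ≤ 3 → (s ≠ 1 ∨ χ ≠ 1) →
      ‖contL χ s‖ ≤ C * (N * (1 + |s.im|)) ^ (2 * ε) * (1 + ‖charMean χ‖ / ‖s - 1‖) := by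
  refine ⟨∑' n : ℕ, (n : ℝ) ^ (-(1 + ε)) + 28, ?_, fun N _ χ s hs hs3 h => ?_⟩
  · have : 0 ≤ ∑' n : ℕ, (n : ℝ) ^ (-(1 + ε)) := tsum_nonneg fun n => by positivity
    linarith
  have hC : 0 ≤ ∑' n : ℕ, (n : ℝ) ^ (-(1 + ε)) := tsum_nonneg fun n => by positivity
  have hs0 : 0 < s.re := by linarith
  obtain ⟨X, hXs⟩ : ∃ X : ℝ, X = N * (1 + |s.im|) := ⟨_, rfl⟩
  have hN1 : (1 : ℝ) ≤ N := by exact_mod_cast NeZero.one_le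
  have hX : 1 ≤ X := by rw [hXs]; nlinarith [abs_nonneg s.im]
  have key := norm_truncation_le χ hε hε' hX hs hs3 hXs
  rw [← hXs]
  by_cases hχ : χ = 1
  · have hs1 : s ≠ 1 := by tauto
    rw [contL_eq χ hX hs0 hs1, mul_add, mul_one]
    refine (norm_add_le _ _).trans (add_le_add key ?_)
    rw [norm_mul, norm_div, Complex.norm_cpow_eq_rpow_re_of_pos (by linarith)]
    have : X ^ (1 - s).re ≤ X ^ (2 * ε) :=
      Real.rpow_le_rpow_of_exponent_le hX (by simp; linarith)
    calc ‖charMean χ‖ * (X ^ (1 - s).re / ‖s - 1‖)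
        ≤ ‖charMean χ‖ * (X ^ (2 * ε) / ‖s - 1‖) := by gcongr
      _ = 1 * X ^ (2 * ε) * (‖charMean χ‖ / ‖s - 1‖) := by ring
      _ ≤ _ := by gcongr; linarith
  · have h0 := charMean_eq_zero hχ
    rw [contL, regPart_eq χ hX hs0, h0]
    simpa using key

end UpperBound

section Abstract

/-- `F` is holomorphic on `0 < re s` and bounded by `M` on a box slightly larger than
`1 ≤ re s ≤ 2`, `|im s| ≤ T`. -/
def BoxBounded (F : ℂ → ℂ) (ε M T : ℝ) : Prop :=
  (∀ s : ℂ, 0 < s.re → DifferentiableAt ℂ F s) ∧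
    ∀ s : ℂ, 1 - ε ≤ s.re → s.re ≤ 3 → |s.im| ≤ T + 1 → ‖F s‖ ≤ M

variable {F : ℂ → ℂ} {ε M T : ℝ}

theorem BoxBounded.mem_of_dist_le (hε' : ε ≤ 1 / 2) {z w : ℂ}
    (hz : 1 - ε / 2 ≤ z.re) (hz' : z.re ≤ 5 / 2) (hzT : |z.im| ≤ T + 1 / 2)
    (hw : dist w z ≤ ε / 2) : 1 - ε ≤ w.re ∧ w.re ≤ 3 ∧ |w.im| ≤ T + 1 := by
  rw [dist_eq_norm] at hw
  have h1 := abs_le.1 ((Complex.abs_re_le_norm (w - z)).trans hw)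
  have h2 := ((Complex.abs_im_le_norm (w - z)).trans hw)
  rw [sub_re] at h1
  rw [sub_im] at h2
  refine ⟨by linarith [h1.1], by linarith [h1.2], ?_⟩
  have := abs_add_le (w.im - z.im) z.im
  rw [sub_add_cancel] at this
  linarith

theorem BoxBounded.norm_deriv_le (h : BoxBounded F ε M T) (hε : 0 < ε) (hε' : ε ≤ 1 / 2) {z : ℂ}
    (hz : 1 - ε / 2 ≤ z.re) (hz' : z.re ≤ 5 / 2) (hzT : |z.im| ≤ T + 1 / 2) :
    ‖deriv F z‖ ≤ 2 * M / ε := by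
  have := Complex.norm_deriv_le_of_forall_mem_sphere_norm_le (f := F) (c := z) (R := ε / 2)
    (C := M) (by linarith) ?_ ?_
  · calc _ ≤ _ := this
      _ = _ := by field_simp
  · refine DifferentiableOn.diffContOnCl fun w hw => ?_
    rw [closure_ball _ (by linarith)] at hw
    have := BoxBounded.mem_of_dist_le hε' hz hz' hzT hw
    exact (h.1 w (by linarith [this.1])).differentiableWithinAt
  · intro w hw
    have := BoxBounded.mem_of_dist_le hε' hz hz' hzT (le_of_eq hw)
    exact h.2 w this.1 this.2.1 this.2.2

theorem BoxBounded.norm_sub_le (h : BoxBounded F ε M T) (hε : 0 < ε) (hε' : ε ≤ 1 / 2) {z w : ℂ}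
    (hz : 1 - ε / 2 ≤ z.re) (hz' : z.re ≤ 5 / 2) (hzT : |z.im| ≤ T + 1 / 2)
    (hw : 1 - ε / 2 ≤ w.re) (hw' : w.re ≤ 5 / 2) (hwT : |w.im| ≤ T + 1 / 2) :
    ‖F w - F z‖ ≤ 2 * M / ε * ‖w - z‖ := by
  have hconv : Convex ℝ (Icc (1 - ε / 2) (5 / 2) ×ℂ Icc (-(T + 1 / 2)) (T + 1 / 2)) :=
    ((convex_Icc _ _).linear_preimage Complex.reLm).inter
      ((convex_Icc _ _).linear_preimage Complex.imLm)
  refine hconv.norm_image_sub_le_of_norm_deriv_le (fun x hx => ?_) (fun x hx => ?_)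
    ⟨⟨hz, hz'⟩, abs_le.1 hzT⟩ ⟨⟨hw, hw'⟩, abs_le.1 hwT⟩
  · exact h.1 x (by linarith [hx.1.1])
  · exact h.norm_deriv_le hε hε' hx.1.1 hx.1.2 (abs_le.2 hx.2)

theorem BoxBounded.le_norm_of_quartic (h : BoxBounded F ε M T) (hε : 0 < ε) (hε' : ε ≤ 1 / 2)
    (hM : 1 ≤ M) {τ : ℝ} (hτ : 0 < τ) (hτ' : τ ≤ 1) {t : ℝ} (ht : |t| ≤ T)
    (hq : ∀ σ : ℝ, 1 < σ → σ ≤ 2 → (σ - 1) ^ 3 * τ ≤ 16 * M ^ 4 * ‖F (σ + t * I)‖ ^ 4)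
    {σ : ℝ} (hσ : 1 < σ) (hσ' : σ ≤ 2) : ε ^ 3 * τ / (2048 * M ^ 7) ≤ ‖F (σ + t * I)‖ := by
  have hM0 : 0 < M := by linarith
  obtain ⟨v, hv⟩ : ∃ v, v = ε / (8 * M ^ 2) := ⟨_, rfl⟩
  have hv0 : 0 < v := by rw [hv]; positivity
  have hv1 : v ≤ 1 := by
    rw [hv, div_le_one (by positivity)]; nlinarith
  have hu0 : 0 < τ * v ^ 4 := by positivity
  have hu1 : τ * v ^ 4 ≤ 1 := mul_le_one₀ hτ' (by positivity) (pow_le_one₀ hv0.le hv1)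
  have hlow : ∀ σ : ℝ, 1 + τ * v ^ 4 ≤ σ → σ ≤ 2 → τ * v ^ 3 / (2 * M) ≤ ‖F (σ + t * I)‖ := by
    intro σ h1 h2
    refine le_of_pow_le_pow_left₀ (n := 4) (by norm_num) (norm_nonneg _) ?_
    rw [div_pow, div_le_iff₀ (by positivity)]
    calc (τ * v ^ 3) ^ 4 = (τ * v ^ 4) ^ 3 * τ := by ring
      _ ≤ (σ - 1) ^ 3 * τ := by gcongr; linarith
      _ ≤ _ := hq σ (by linarith) h2
      _ = _ := by ring
  have hc : ε ^ 3 * τ / (2048 * M ^ 7) = τ * v ^ 3 / (4 * M) := by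
    rw [hv]; field_simp; norm_num
  rw [hc]
  rcases le_or_gt (1 + τ * v ^ 4) σ with h1 | h1
  · refine le_trans ?_ (hlow σ h1 hσ')
    gcongr; norm_num
  · obtain ⟨u, hu⟩ : ∃ u, u = 1 + τ * v ^ 4 := ⟨_, rfl⟩
    have h2 := hlow u hu.ge (by linarith)
    have h3 := h.norm_sub_le hε hε' (z := σ + t * I) (w := (u : ℂ) + t * I)
      (by simp; linarith) (by simp; linarith) (by simp; linarith)
      (by simp; linarith) (by simp; linarith) (by simp; linarith)
    have h4 : ‖(u : ℂ) + t * I - (σ + t * I)‖ ≤ τ * v ^ 4 := by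
      rw [add_sub_add_right_eq_sub, ← ofReal_sub, Complex.norm_real, Real.norm_eq_abs, abs_le]
      constructor <;> linarith
    have h5 : 2 * M / ε * ‖(u : ℂ) + t * I - (σ + t * I)‖ ≤
        τ * v ^ 3 / (4 * M) := by
      calc _ ≤ 2 * M / ε * (τ * v ^ 4) := by gcongr
        _ = 2 * M / ε * (τ * v ^ 3) * v := by ring
        _ = 2 * M / ε * (τ * v ^ 3) * (ε / (8 * M ^ 2)) := by rw [hv]
        _ = _ := by field_simp; norm_num
    have h6 := norm_sub_norm_le (F ((u : ℂ) + t * I)) (F (σ + t * I))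
    have h7 : τ * v ^ 3 / (2 * M) = 2 * (τ * v ^ 3 / (4 * M)) := by field_simp; norm_num
    linarith

theorem BoxBounded.le_norm_of_one (h : BoxBounded F ε M T) (hε : 0 < ε) (hε' : ε ≤ 1 / 2)
    (hM : 1 ≤ M) {ℓ : ℝ} (hℓ : 0 < ℓ) (hℓ' : ℓ ≤ 1) (hℓF : ℓ ≤ ‖F 1‖) {t : ℝ} (ht : |t| ≤ T)
    (hq : ∀ σ : ℝ, 1 < σ → σ ≤ 2 → ∀ τ : ℝ, 0 < τ → τ ≤ 1 → (τ ≤ |t| ∨ τ ≤ σ - 1) →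
      (σ - 1) ^ 3 * τ ≤ 16 * M ^ 4 * ‖F (σ + t * I)‖ ^ 4)
    {σ : ℝ} (hσ : 1 < σ) (hσ' : σ ≤ 2) : ε ^ 4 * ℓ / (2 ^ 14 * M ^ 8) ≤ ‖F (σ + t * I)‖ := by
  have hM0 : 0 < M := by linarith
  obtain ⟨τ, hτ⟩ : ∃ τ, τ = ε * ℓ / (8 * M) := ⟨_, rfl⟩
  have hτ0 : 0 < τ := by rw [hτ]; positivity
  have hτε : τ ≤ ε := by
    rw [hτ, div_le_iff₀ (by positivity)]; nlinarith
  have hτ1 : τ ≤ 1 := by linarith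
  have hc : ε ^ 4 * ℓ / (2 ^ 14 * M ^ 8) = ε ^ 3 * τ / (2048 * M ^ 7) := by
    rw [hτ]; field_simp; norm_num
  rw [hc]
  rcases le_or_gt τ |t| with h1 | h1
  · exact h.le_norm_of_quartic hε hε' hM hτ0 hτ1 ht
      (fun σ h2 h3 => hq σ h2 h3 τ hτ0 hτ1 (Or.inl h1)) hσ hσ'
  · have hM1 : M ≤ M ^ 7 := le_self_pow₀ hM (by norm_num)
    have hε3 : ε ^ 3 ≤ 1 := pow_le_one₀ hε.le (by linarith)
    rcases le_or_gt τ (σ - 1) with h2 | h2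
    · refine le_of_pow_le_pow_left₀ (n := 4) (by norm_num) (norm_nonneg _) ?_
      have h3 := hq σ hσ hσ' τ hτ0 hτ1 (Or.inr h2)
      have h4 : ε ^ 3 * τ / (2048 * M ^ 7) ≤ τ / (2 * M) := by
        gcongr
        · nlinarith
        · norm_num
      calc _ ≤ (τ / (2 * M)) ^ 4 := by gcongr
        _ = τ ^ 3 * τ / (16 * M ^ 4) := by rw [div_pow]; ring
        _ ≤ _ := by
          rw [div_le_iff₀ (by positivity)]
          calc τ ^ 3 * τ ≤ (σ - 1) ^ 3 * τ := by gcongr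
            _ ≤ _ := h3
            _ = _ := by ring
    · have h3 := h.norm_sub_le hε hε' (z := 1) (w := (σ : ℂ) + t * I)
        (by simp; linarith) (by simp; norm_num) (by simp; linarith [abs_nonneg t])
        (by simp; linarith) (by simp; linarith) (by simp; linarith)
      have h4 : ‖(σ : ℂ) + t * I - 1‖ ≤ 2 * τ := by
        refine (Complex.norm_le_abs_re_add_abs_im _).trans ?_
        simp only [sub_re, add_re, ofReal_re, mul_re, I_re, mul_zero, ofReal_im, I_im, mul_one,
          sub_self, add_zero, one_re, sub_im, add_im, mul_im, zero_add, one_im, sub_zero]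
        rw [abs_of_pos (by linarith : 0 < σ - 1)]
        linarith
      have h5 : 2 * M / ε * ‖(σ : ℂ) + t * I - 1‖ ≤ ℓ / 2 := by
        calc _ ≤ 2 * M / ε * (2 * τ) := by gcongr
          _ = _ := by rw [hτ]; field_simp; norm_num
      have h6 := norm_sub_norm_le (F 1) (F ((σ : ℂ) + t * I))
      rw [norm_sub_rev] at h6
      have h7 : ε ^ 3 * τ / (2048 * M ^ 7) ≤ ℓ / 2 := by
        rw [← hc, div_le_div_iff₀ (by positivity) (by norm_num)]
        have : 1 ≤ M ^ 8 := one_le_pow₀ hM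
        have : ε ^ 4 ≤ 1 := pow_le_one₀ hε.le (by linarith)
        nlinarith
      linarith

theorem BoxBounded.norm_iteratedDeriv_logDeriv_le (h : BoxBounded F ε M T) (hε : 0 < ε)
    (hε' : ε ≤ 1 / 2) {ℓ : ℝ} (hℓ : 0 < ℓ) {s : ℂ} (hs : 1 ≤ s.re) (hs' : s.re ≤ 2)
    (hsT : |s.im| ≤ T) (hℓs : ℓ ≤ ‖F s‖) (k : ℕ) :
    ‖iteratedDeriv k (logDeriv F) s‖ ≤ k.factorial * (4 * M / (ε * ℓ)) ^ (k + 1) := by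
  have hMℓ : ℓ ≤ M := hℓs.trans (h.2 s (by linarith) (by linarith) (by linarith))
  have hM0 : 0 < M := hℓ.trans_le hMℓ
  obtain ⟨r, hr⟩ : ∃ r, r = ε * ℓ / (4 * M) := ⟨_, rfl⟩
  have hr0 : 0 < r := by rw [hr]; positivity
  have hrε : r ≤ ε / 2 := by
    rw [hr, div_le_iff₀ (by positivity)]; nlinarith
  have hmem : ∀ z ∈ Metric.closedBall s r, 1 - ε / 2 ≤ z.re ∧ z.re ≤ 5 / 2 ∧
      |z.im| ≤ T + 1 / 2 := by
    intro z hz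
    have hz : ‖z - s‖ ≤ ε / 2 := by rw [← dist_eq_norm]; exact le_trans hz hrε
    have h1 := abs_le.1 ((Complex.abs_re_le_norm (z - s)).trans hz)
    have h2 := ((Complex.abs_im_le_norm (z - s)).trans hz)
    rw [sub_re] at h1
    rw [sub_im] at h2
    have := abs_add_le (z.im - s.im) s.im
    rw [sub_add_cancel] at this
    exact ⟨by linarith [h1.1], by linarith [h1.2], by linarith⟩
  have hlow : ∀ z ∈ Metric.closedBall s r, ℓ / 2 ≤ ‖F z‖ := by
    intro z hz
    obtain ⟨h1, h2, h3⟩ := hmem z hz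
    have h4 := h.norm_sub_le hε hε' (z := s) (w := z) (by linarith) (by linarith)
      (by linarith) h1 h2 h3
    have h5 : 2 * M / ε * ‖z - s‖ ≤ ℓ / 2 := by
      calc _ ≤ 2 * M / ε * r := by
            gcongr; rw [← dist_eq_norm]; exact hz
        _ = _ := by rw [hr]; field_simp; norm_num
    have h6 := norm_sub_norm_le (F s) (F z)
    rw [norm_sub_rev] at h6
    linarith
  have hbd : ∀ z ∈ Metric.closedBall s r, ‖logDeriv F z‖ ≤ r⁻¹ := by
    intro z hz
    obtain ⟨h1, h2, h3⟩ := hmem z hz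
    rw [logDeriv_apply, norm_div]
    calc _ ≤ (2 * M / ε) / (ℓ / 2) := by
          gcongr
          · exact h.norm_deriv_le hε hε' h1 h2 h3
          · exact hlow z hz
      _ = _ := by rw [hr]; field_simp; norm_num
  have hd : DiffContOnCl ℂ (logDeriv F) (Metric.ball s r) := by
    have hopen : IsOpen {z : ℂ | 0 < z.re} := isOpen_lt continuous_const continuous_re
    have hFd : DifferentiableOn ℂ F {z : ℂ | 0 < z.re} :=
      fun z hz => (h.1 z hz).differentiableWithinAt
    refine DifferentiableOn.diffContOnCl fun z hz => ?_
    rw [closure_ball _ hr0.ne'] at hz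
    have hz0 : 0 < z.re := by linarith [(hmem z hz).1]
    have h1 : DifferentiableAt ℂ (deriv F) z :=
      (hFd.deriv hopen).differentiableAt (hopen.mem_nhds hz0)
    have h2 : F z ≠ 0 := by
      intro h0
      have := hlow z hz
      rw [h0, norm_zero] at this
      linarith
    exact (h1.div (h.1 z hz0) h2).differentiableWithinAt
  refine (Complex.norm_iteratedDeriv_le_of_forall_mem_sphere_norm_le k hr0 hd
    (fun z hz => hbd z (Metric.sphere_subset_closedBall hz))).trans (le_of_eq ?_)
  have : 4 * M / (ε * ℓ) = r⁻¹ := by rw [hr, inv_div]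
  rw [this, pow_succ, inv_pow]
  field_simp

end Abstract

section Nonprincipal

theorem one_le_conductor_mul {N : ℕ} [NeZero N] (t : ℝ) : 1 ≤ (N : ℝ) * (1 + |t|) := by
  have hN1 : (1 : ℝ) ≤ N := by exact_mod_cast NeZero.one_le
  nlinarith [abs_nonneg t]

theorem norm_LSeries_one_le {ε C : ℝ}
    (hC : ∀ (N : ℕ) [NeZero N] (χ : DirichletCharacter ℂ N) (s : ℂ),
      1 - ε ≤ s.re → s.re ≤ 3 → (s ≠ 1 ∨ χ ≠ 1) →
      ‖contL χ s‖ ≤ C * (N * (1 + |s.im|)) ^ (2 * ε) * (1 + ‖charMean χ‖ / ‖s - 1‖))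
    (hε : 0 < ε) (hC1 : 1 ≤ C) {N : ℕ} [NeZero N] (χ : DirichletCharacter ℂ N) {s : ℂ}
    (hs : 1 < s.re) (hs' : s.re ≤ 2) {Q τ : ℝ} (hQ : N * (1 + |s.im|) ≤ Q) (hτ : 0 < τ)
    (hτ' : τ ≤ 1) (hsτ : τ ≤ ‖s - 1‖) :
    ‖LSeries (fun n => χ n) s‖ ≤ 2 * C * Q ^ (2 * ε) / τ := by
  rw [LSeries_eq_contL χ hs]
  have h0 := one_le_conductor_mul (N := N) s.im
  refine (hC N χ s (by linarith) (by linarith) (Or.inl ?_)).trans ?_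
  · rintro rfl; simp at hs
  have h1 : ‖charMean χ‖ / ‖s - 1‖ ≤ 1 / τ := by
    gcongr; exact norm_charMean_le χ
  have h2 : 1 ≤ 1 / τ := by rwa [le_div_iff₀ hτ, one_mul]
  have hQ0 : 0 < Q := by linarith
  calc C * (N * (1 + |s.im|)) ^ (2 * ε) * (1 + ‖charMean χ‖ / ‖s - 1‖)
      ≤ C * Q ^ (2 * ε) * (1 / τ + 1 / τ) := by gcongr
    _ = _ := by ring

theorem norm_LSeries_quartic {ε C : ℝ}
    (hC : ∀ (N : ℕ) [NeZero N] (χ : DirichletCharacter ℂ N) (s : ℂ),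
      1 - ε ≤ s.re → s.re ≤ 3 → (s ≠ 1 ∨ χ ≠ 1) →
      ‖contL χ s‖ ≤ C * (N * (1 + |s.im|)) ^ (2 * ε) * (1 + ‖charMean χ‖ / ‖s - 1‖))
    (hε : 0 < ε) (hC1 : 1 ≤ C) {N : ℕ} [NeZero N] (χ : DirichletCharacter ℂ N) {t σ : ℝ}
    (hσ : 1 < σ) (hσ' : σ ≤ 2) {M τ : ℝ} (hM : M = 2 * C * (2 * (N * (1 + |t|))) ^ (2 * ε))
    (hτ : 0 < τ) (hτ' : τ ≤ 1) (h : χ ^ 2 ≠ 1 ∨ τ ≤ |t| ∨ τ ≤ σ - 1) :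
    (σ - 1) ^ 3 * τ ≤ M ^ 4 * ‖LSeries (fun n => χ n) (σ + t * I)‖ ^ 4 := by
  have h0 := one_le_conductor_mul (N := N) t
  have hσ0 : 0 < σ - 1 := by linarith
  have hM0 : 0 < M := by rw [hM]; positivity
  have hprod := DirichletCharacter.norm_LSeries_product_ge_one χ hσ0 t
  have e1 : (1 : ℂ) + ((σ - 1 : ℝ) : ℂ) = σ := by push_cast; ring
  have e2 : (σ : ℂ) + I * t = σ + t * I := by ring
  have e3 : (σ : ℂ) + 2 * I * t = (σ : ℂ) + (2 * t : ℝ) * I := by push_cast; ring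
  rw [e1, e2, e3, norm_mul, norm_mul, norm_pow, norm_pow] at hprod
  have hN1 : (1 : ℝ) ≤ N := by exact_mod_cast NeZero.one_le
  have b1 : ‖LSeries (fun n => (1 : DirichletCharacter ℂ N) n) (σ : ℂ)‖ ≤ M / (σ - 1) := by
    rw [hM]
    refine norm_LSeries_one_le hC hε hC1 _ (by simpa) (by simpa) ?_ hσ0 (by linarith) ?_
    · simp; nlinarith [abs_nonneg t]
    · rw [← ofReal_one, ← ofReal_sub, Complex.norm_real]; exact le_abs_self _
  have b3 : ‖LSeries (fun n => (χ ^ 2) n) ((σ : ℂ) + (2 * t : ℝ) * I)‖ ≤ M / τ := by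
    have hQ : (N : ℝ) * (1 + |((σ : ℂ) + (2 * t : ℝ) * I).im|) ≤ 2 * (N * (1 + |t|)) := by
      simp [abs_mul]; nlinarith [abs_nonneg t]
    by_cases hχ : χ ^ 2 = 1
    · rw [hM]
      refine norm_LSeries_one_le hC hε hC1 _ (by simpa) (by simpa) hQ hτ hτ' ?_
      rcases h with h | h | h
      · exact absurd hχ h
      · refine le_trans ?_ (Complex.abs_im_le_norm _)
        simp [abs_mul]; linarith [abs_nonneg t]
      · refine le_trans ?_ (Complex.abs_re_le_norm _)
        simpa using h.trans (le_abs_self _)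
    · rw [LSeries_eq_contL _ (by simpa)]
      refine (hC N _ _ (by simp; linarith) (by simp; linarith) (Or.inr hχ)).trans ?_
      rw [charMean_eq_zero hχ, norm_zero, zero_div, add_zero, mul_one]
      have : M ≤ M / τ := by rw [le_div_iff₀ hτ]; nlinarith
      refine le_trans ?_ this
      rw [hM]
      calc _ ≤ C * (2 * (N * (1 + |t|))) ^ (2 * ε) := by gcongr
        _ ≤ _ := by
          rw [mul_assoc]
          have : 0 ≤ C * (2 * (N * (1 + |t|))) ^ (2 * ε) := by positivity
          linarith
  have b : 1 ≤ (M / (σ - 1)) ^ 3 * ‖LSeries (fun n => χ n) (σ + t * I)‖ ^ 4 * (M / τ) := by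
    refine hprod.le.trans ?_
    gcongr
  calc (σ - 1) ^ 3 * τ = (σ - 1) ^ 3 * τ * 1 := by ring
    _ ≤ (σ - 1) ^ 3 * τ *
      ((M / (σ - 1)) ^ 3 * ‖LSeries (fun n => χ n) (σ + t * I)‖ ^ 4 * (M / τ)) := by gcongr
    _ = _ := by field_simp

/-- Final numerical form of the bounds for logarithmic derivatives. -/
theorem logDeriv_bound_aux {ε η C Q ℓ : ℝ} {k : ℕ} (hη : ε * (18 * (k + 1)) ≤ η)
    (hε : 0 < ε) (hC : 1 ≤ C) (hQ : 1 ≤ Q) (hℓ : 0 < ℓ) :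
    (k.factorial : ℝ) * (4 * (2 * C * (2 * Q) ^ (2 * ε)) /
        (ε * (ε ^ 4 * ℓ / (2 ^ 14 * (2 * C * (2 * Q) ^ (2 * ε)) ^ 8)))) ^ (k + 1) ≤
      k.factorial * (2 ^ 16 * (2 * C * 2 ^ (2 * ε)) ^ 9 / ε ^ 5) ^ (k + 1) * Q ^ η /
        ℓ ^ (k + 1) := by
  have hQ0 : 0 < Q := by linarith
  have e : 4 * (2 * C * (2 * Q) ^ (2 * ε)) /
        (ε * (ε ^ 4 * ℓ / (2 ^ 14 * (2 * C * (2 * Q) ^ (2 * ε)) ^ 8))) =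
      (2 ^ 16 * (2 * C * 2 ^ (2 * ε)) ^ 9 / ε ^ 5) * Q ^ (ε * 18) / ℓ := by
    have : Q ^ (ε * 18) = (Q ^ (2 * ε)) ^ 9 := by
      rw [← Real.rpow_mul_natCast hQ0.le]; congr 1; push_cast; ring
    rw [Real.mul_rpow zero_le_two hQ0.le, this]
    field_simp
    norm_num
  rw [e, div_pow, mul_pow, ← Real.rpow_mul_natCast hQ0.le, ← mul_div_assoc, ← mul_assoc]
  have : Q ^ (ε * 18 * ((k + 1 : ℕ) : ℝ)) ≤ Q ^ η :=
    Real.rpow_le_rpow_of_exponent_le hQ (by push_cast; linarith)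
  gcongr

theorem exists_iteratedDeriv_logDeriv_contL_le {η : ℝ} (hη : 0 < η) (k : ℕ) :
    ∃ C : ℝ, 0 < C ∧ ∀ (N : ℕ) [NeZero N] (χ : DirichletCharacter ℂ N) (ℓ : ℝ), χ ≠ 1 →
      0 < ℓ → ℓ ≤ 1 → (χ ^ 2 = 1 → ℓ ≤ ‖contL χ 1‖) → ∀ s : ℂ, 1 < s.re → s.re ≤ 2 →
      ‖iteratedDeriv k (logDeriv (contL χ)) s‖ ≤
        C * (N * (1 + |s.im|)) ^ η / ℓ ^ (k + 1) := by
  obtain ⟨ε, hε, hε', hεη⟩ : ∃ ε : ℝ, 0 < ε ∧ ε ≤ 1 / 2 ∧ ε * (18 * (k + 1)) ≤ η := by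
    refine ⟨min (1 / 2) (η / (18 * (k + 1))), by positivity, min_le_left _ _, ?_⟩
    calc _ ≤ η / (18 * (k + 1)) * (18 * (k + 1)) := by
          gcongr; exact min_le_right _ _
      _ = _ := by field_simp
  obtain ⟨C, hC1, hC⟩ := exists_norm_contL_le hε hε'
  refine ⟨k.factorial * (2 ^ 16 * (2 * C * 2 ^ (2 * ε)) ^ 9 / ε ^ 5) ^ (k + 1), by positivity, ?_⟩
  intro N _ χ ℓ hχ hℓ hℓ' hℓχ s hs hs'
  refine le_trans ?_ (logDeriv_bound_aux hεη hε hC1 (one_le_conductor_mul s.im) hℓ)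
  obtain ⟨M, hM⟩ : ∃ M, M = 2 * C * (2 * (N * (1 + |s.im|))) ^ (2 * ε) := ⟨_, rfl⟩
  have h0 := one_le_conductor_mul (N := N) s.im
  have hrp : 1 ≤ (2 * (N * (1 + |s.im|))) ^ (2 * ε) :=
    Real.one_le_rpow (by linarith) (by positivity)
  have hM1 : 1 ≤ M := by
    rw [hM]; nlinarith
  have hMC : C * (2 * (N * (1 + |s.im|))) ^ (2 * ε) ≤ M := by
    rw [hM, mul_assoc]
    have : 0 ≤ C * (2 * (N * (1 + |s.im|))) ^ (2 * ε) := by positivity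
    linarith
  have hN1 : (1 : ℝ) ≤ N := by exact_mod_cast NeZero.one_le
  have hB : BoxBounded (contL χ) ε M |s.im| := by
    refine ⟨fun z hz => ?_, fun z hz hz' hzT => ?_⟩
    · have : contL χ = regPart χ := by
        funext z; simp [contL, charMean_eq_zero hχ]
      rw [this]; exact differentiableAt_regPart χ hz
    · refine (hC N χ z hz hz' (Or.inr hχ)).trans (le_trans ?_ hMC)
      rw [charMean_eq_zero hχ, norm_zero, zero_div, add_zero, mul_one]
      have : (N : ℝ) * (1 + |z.im|) ≤ 2 * (N * (1 + |s.im|)) := by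
        calc (N : ℝ) * (1 + |z.im|) ≤ N * (2 * (1 + |s.im|)) := by
              gcongr; linarith [abs_nonneg s.im]
          _ = _ := by ring
      gcongr
  have hsσ : ((s.re : ℝ) : ℂ) + (s.im : ℝ) * I = s := Complex.re_add_im s
  have hquart : ∀ σ : ℝ, 1 < σ → σ ≤ 2 → ∀ τ : ℝ, 0 < τ → τ ≤ 1 →
      (χ ^ 2 ≠ 1 ∨ τ ≤ |s.im| ∨ τ ≤ σ - 1) →
      (σ - 1) ^ 3 * τ ≤ 16 * M ^ 4 * ‖contL χ (σ + s.im * I)‖ ^ 4 := by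
    intro σ h1 h2 τ h3 h4 h5
    have := norm_LSeries_quartic hC hε hC1 χ h1 h2 hM h3 h4 h5
    rw [LSeries_eq_contL χ (by simpa)] at this
    refine this.trans ?_
    gcongr
    have : 0 ≤ M ^ 4 := by positivity
    linarith
  have hlow : ε ^ 4 * ℓ / (2 ^ 14 * M ^ 8) ≤ ‖contL χ s‖ := by
    rw [← hsσ]
    by_cases hχ2 : χ ^ 2 = 1
    · exact hB.le_norm_of_one hε hε' hM1 hℓ hℓ' (hℓχ hχ2) le_rfl
        (fun σ h1 h2 τ h3 h4 h5 => hquart σ h1 h2 τ h3 h4 (Or.inr h5)) hs hs'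
    · refine le_trans ?_ (hB.le_norm_of_quartic hε hε' hM1 one_pos le_rfl le_rfl
        (fun σ h1 h2 => hquart σ h1 h2 1 one_pos le_rfl (Or.inl hχ2)) hs hs')
      have h7 : M ^ 7 ≤ M ^ 8 := pow_le_pow_right₀ hM1 (by norm_num)
      have h3 : ε ^ 4 * ℓ ≤ ε ^ 3 * 1 := by
        calc ε ^ 4 * ℓ = ε ^ 3 * (ε * ℓ) := by ring
          _ ≤ _ := by gcongr; nlinarith
      have h5 : 2048 * M ^ 7 ≤ 2 ^ 14 * M ^ 8 := by
        have : 0 ≤ M ^ 8 := by positivity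
        linarith
      gcongr
  have := hB.norm_iteratedDeriv_logDeriv_le hε hε' (by positivity) hs.le hs' le_rfl hlow k
  rwa [hM] at this

theorem exists_iteratedDeriv_LSeries_twist_le {η : ℝ} (hη : 0 < η) (k : ℕ) :
    ∃ C : ℝ, 0 < C ∧ ∀ (N : ℕ) [NeZero N] (χ : DirichletCharacter ℂ N) (ℓ : ℝ), χ ≠ 1 →
      0 < ℓ → ℓ ≤ 1 → (χ ^ 2 = 1 → ℓ ≤ ‖contL χ 1‖) → ∀ s : ℂ, 1 < s.re → s.re ≤ 2 →
      ‖iteratedDeriv k (LSeries fun n => χ n * (ArithmeticFunction.vonMangoldt n : ℂ)) s‖ ≤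
        C * (N * (1 + |s.im|)) ^ η / ℓ ^ (k + 1) := by
  obtain ⟨C, hC0, hC⟩ := exists_iteratedDeriv_logDeriv_contL_le hη k
  refine ⟨C, hC0, fun N _ χ ℓ hχ hℓ hℓ' hℓχ s hs hs' => ?_⟩
  refine le_trans (le_of_eq ?_) (hC N χ ℓ hχ hℓ hℓ' hℓχ s hs hs')
  have hopen : IsOpen {z : ℂ | 1 < z.re} := isOpen_lt continuous_const continuous_re
  have h1 : (LSeries fun n => χ n * (ArithmeticFunction.vonMangoldt n : ℂ)) =ᶠ[𝓝 s]
      fun z => -logDeriv (contL χ) z := by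
    filter_upwards [hopen.mem_nhds hs] with z hz
    have h2 := DirichletCharacter.LSeries_twist_vonMangoldt_eq χ hz
    have h3 : LSeries (fun n => χ n) =ᶠ[𝓝 z] contL χ := by
      filter_upwards [hopen.mem_nhds hz] with w hw using LSeries_eq_contL χ hw
    rw [h3.deriv_eq, h3.eq_of_nhds] at h2
    rw [logDeriv_apply, ← neg_div, ← h2]
    rfl
  rw [h1.iteratedDeriv_eq, iteratedDeriv_fun_neg, norm_neg]

end Nonprincipal

section Zeta

/-- The function `(s - 1) ζ(s) / s`, continued to `0 < re s`. -/
noncomputable def zetaReg (s : ℂ) : ℂ :=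
  1 + (s - 1) / s * regPart (1 : DirichletCharacter ℂ 1) s

theorem zetaReg_one : zetaReg 1 = 1 := by simp [zetaReg]

theorem contL_one_eq {s : ℂ} (hs : s ≠ 0) (hs1 : s ≠ 1) :
    contL (1 : DirichletCharacter ℂ 1) s = zetaReg s * s / (s - 1) := by
  have : s - 1 ≠ 0 := sub_ne_zero.2 hs1
  rw [contL, charMean_modOne, zetaReg]
  field_simp

theorem ne_zero_of_re_pos {s : ℂ} (hs : 0 < s.re) : s ≠ 0 := by rintro rfl; simp at hs

theorem exists_norm_zetaReg_le {ε : ℝ} (hε : 0 < ε) (hε' : ε ≤ 1 / 2) {C : ℝ} (hC1 : 1 ≤ C)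
    (hC : ∀ (N : ℕ) [NeZero N] (χ : DirichletCharacter ℂ N) (s : ℂ),
      1 - ε ≤ s.re → s.re ≤ 3 → (s ≠ 1 ∨ χ ≠ 1) →
      ‖contL χ s‖ ≤ C * (N * (1 + |s.im|)) ^ (2 * ε) * (1 + ‖charMean χ‖ / ‖s - 1‖))
    {s : ℂ} (hs : 1 - ε ≤ s.re) (hs3 : s.re ≤ 3) :
    ‖regPart (1 : DirichletCharacter ℂ 1) s‖ ≤ 40 * C * (1 + |s.im|) ^ (2 * ε) ∧
      ‖zetaReg s‖ ≤ 121 * C * (1 + |s.im|) ^ (2 * ε) := by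
  have hs0 : 0 < s.re := by linarith
  have hsn : 1 / 2 ≤ ‖s‖ := (by linarith : 1 / 2 ≤ s.re).trans
    ((le_abs_self _).trans (Complex.abs_re_le_norm s))
  have hq : 1 ≤ (1 + |s.im|) ^ (2 * ε) :=
    Real.one_le_rpow (by linarith [abs_nonneg s.im]) (by positivity)
  have hCq : 1 ≤ C * (1 + |s.im|) ^ (2 * ε) := one_le_mul_of_one_le_of_one_le hC1 hq
  have hR : ‖regPart (1 : DirichletCharacter ℂ 1) s‖ ≤ 40 * C * (1 + |s.im|) ^ (2 * ε) := by
    rcases lt_or_ge |s.im| 1 with ht | ht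
    · rw [regPart, mellin_indicator_charErr, norm_mul]
      have h1 : ‖s‖ ≤ 4 := by
        refine (Complex.norm_le_abs_re_add_abs_im s).trans ?_
        rw [abs_of_pos hs0]; linarith
      have h2 := norm_integral_charErr_le (1 : DirichletCharacter ℂ 1) le_rfl hs0
      rw [Real.one_rpow] at h2
      have h3 : 1 / s.re ≤ 2 := by rw [div_le_iff₀ hs0]; linarith
      calc _ ≤ 4 * (4 * ((1 : ℕ) : ℝ) * (1 / s.re)) := by gcongr
        _ ≤ 4 * (4 * ((1 : ℕ) : ℝ) * 2) := by gcongr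
        _ ≤ _ := by push_cast; linarith
    · have hs1 : 1 ≤ ‖s - 1‖ := by
        refine ht.trans ?_
        have := Complex.abs_im_le_norm (s - 1)
        simpa using this
      have hne : s ≠ 1 := by rintro rfl; simp at hs1; linarith
      have h1 := hC 1 1 s hs hs3 (Or.inl hne)
      rw [charMean_modOne, norm_one, Nat.cast_one, one_mul] at h1
      have h2 : regPart (1 : DirichletCharacter ℂ 1) s =
          contL (1 : DirichletCharacter ℂ 1) s - (1 + 1 / (s - 1)) := by
        have : s - 1 ≠ 0 := sub_ne_zero.2 hne
        rw [contL, charMean_modOne]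
        field_simp
        ring
      have h3 : 1 / ‖s - 1‖ ≤ 1 := by rw [div_le_one (by linarith)]; exact hs1
      have h4 : ‖1 + 1 / (s - 1)‖ ≤ 2 := by
        refine (norm_add_le _ _).trans ?_
        rw [norm_div, norm_one]; linarith
      rw [h2]
      calc _ ≤ _ := norm_sub_le _ _
        _ ≤ C * (1 + |s.im|) ^ (2 * ε) * (1 + 1) + 2 := by
          refine add_le_add (h1.trans ?_) h4
          gcongr
        _ ≤ _ := by linarith
  refine ⟨hR, ?_⟩
  have h5 : ‖(s - 1) / s‖ ≤ 3 := by
    rw [norm_div, div_le_iff₀ (by linarith)]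
    have := norm_sub_le s 1
    rw [norm_one] at this
    linarith
  calc ‖zetaReg s‖ ≤ ‖(1 : ℂ)‖ + ‖(s - 1) / s * regPart (1 : DirichletCharacter ℂ 1) s‖ :=
        norm_add_le _ _
    _ ≤ 1 + 3 * (40 * C * (1 + |s.im|) ^ (2 * ε)) := by
      rw [norm_one, norm_mul]; gcongr
    _ ≤ _ := by linarith

theorem differentiableAt_zetaReg {s : ℂ} (hs : 0 < s.re) : DifferentiableAt ℂ zetaReg s := by
  have h := differentiableAt_regPart (1 : DirichletCharacter ℂ 1) hs
  have hs0 := ne_zero_of_re_pos hs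
  unfold zetaReg
  exact (((differentiableAt_id.sub_const 1).div differentiableAt_id hs0).mul h).const_add 1

theorem LSeries_modOne_eq_zetaReg {s : ℂ} (hs : 1 < s.re) :
    LSeries (fun n => (1 : DirichletCharacter ℂ 1) n) s = zetaReg s * s / (s - 1) := by
  rw [LSeries_eq_contL _ hs, contL_one_eq (ne_zero_of_re_pos (by linarith))]
  rintro rfl; simp at hs

theorem LSeries_vonMangoldt_sub_one {s : ℂ} (hs : 1 < s.re) :
    LSeries (fun n => (ArithmeticFunction.vonMangoldt n : ℂ) - 1) s =
      -(logDeriv zetaReg s + (1 / s + 1 + regPart (1 : DirichletCharacter ℂ 1) s)) := by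
  have hopen : IsOpen {z : ℂ | 1 < z.re} := isOpen_lt continuous_const continuous_re
  have hs0 : s ≠ 0 := ne_zero_of_re_pos (by linarith)
  have hs1 : s - 1 ≠ 0 := by intro h; rw [sub_eq_zero] at h; simp [h] at hs
  have hone : LSeries (1 : ℕ → ℂ) = LSeries (fun n => (1 : DirichletCharacter ℂ 1) n) := by
    congr 1
    funext n
    simp [MulChar.one_apply (isUnit_of_subsingleton _)]
  have hev : LSeries (1 : ℕ → ℂ) =ᶠ[𝓝 s] fun z => zetaReg z * (z / (z - 1)) := by
    filter_upwards [hopen.mem_nhds hs] with z hz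
    rw [hone, LSeries_modOne_eq_zetaReg hz, mul_div_assoc]
  have h1 := ArithmeticFunction.LSeries_vonMangoldt_eq hs
  have hne : zetaReg s ≠ 0 := by
    intro h
    have := DirichletCharacter.LSeries_ne_zero_of_one_lt_re (1 : DirichletCharacter ℂ 1) hs
    rw [LSeries_modOne_eq_zetaReg hs, h] at this
    simp at this
  have hd : HasDerivAt (fun z : ℂ => z / (z - 1)) ((1 * (s - 1) - s * 1) / (s - 1) ^ 2) s :=
    (hasDerivAt_id s).div ((hasDerivAt_id s).sub_const 1) hs1
  have hz := (differentiableAt_zetaReg (s := s) (by linarith)).hasDerivAt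
  rw [hev.deriv_eq, hev.eq_of_nhds, (hz.fun_mul hd).deriv] at h1
  have h2 : LSeries (fun n => (ArithmeticFunction.vonMangoldt n : ℂ) - 1) s =
      LSeries (fun n => (ArithmeticFunction.vonMangoldt n : ℂ)) s - LSeries (1 : ℕ → ℂ) s :=
    LSeries_sub (ArithmeticFunction.LSeriesSummable_vonMangoldt hs)
      (LSeriesSummable_one_iff.2 hs)
  rw [h2, h1, hone, LSeries_eq_contL _ hs, contL, charMean_modOne, logDeriv_apply]
  field_simp
  ring

theorem BoxBounded.norm_iteratedDeriv_le {F : ℂ → ℂ} {ε M T : ℝ} (h : BoxBounded F ε M T)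
    (hε : 0 < ε) (hε' : ε ≤ 1 / 2) {s : ℂ} (hs : 1 ≤ s.re) (hs' : s.re ≤ 2)
    (hsT : |s.im| ≤ T) (k : ℕ) :
    ‖iteratedDeriv k F s‖ ≤ k.factorial * M / (ε / 2) ^ k := by
  have hz : 1 - ε / 2 ≤ s.re := by linarith
  refine Complex.norm_iteratedDeriv_le_of_forall_mem_sphere_norm_le k (by linarith) ?_ ?_
  · refine DifferentiableOn.diffContOnCl fun w hw => ?_
    rw [closure_ball _ (by linarith)] at hw
    have := BoxBounded.mem_of_dist_le hε' hz (by linarith) (by linarith : |s.im| ≤ T + 1 / 2) hw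
    exact (h.1 w (by linarith [this.1])).differentiableWithinAt
  · intro w hw
    have := BoxBounded.mem_of_dist_le hε' hz (by linarith) (by linarith : |s.im| ≤ T + 1 / 2)
      (le_of_eq hw)
    exact h.2 w this.1 this.2.1 this.2.2

theorem zetaReg_lower_bound {ε : ℝ} (hε : 0 < ε) (hε' : ε ≤ 1 / 2) {C : ℝ} (hC1 : 1 ≤ C)
    (hC : ∀ (N : ℕ) [NeZero N] (χ : DirichletCharacter ℂ N) (s : ℂ),
      1 - ε ≤ s.re → s.re ≤ 3 → (s ≠ 1 ∨ χ ≠ 1) →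
      ‖contL χ s‖ ≤ C * (N * (1 + |s.im|)) ^ (2 * ε) * (1 + ‖charMean χ‖ / ‖s - 1‖))
    {τ : ℝ} (hτ : τ = ε / (8 * (363 * C))) {s : ℂ} (hs : 1 < s.re) (hs' : s.re ≤ 2) {M : ℝ}
    (hM : M = 2 * (121 * C * (2 / τ)) * (2 * (1 + |s.im|)) ^ (2 * ε)) :
    BoxBounded zetaReg ε M |s.im| ∧ ε ^ 4 * τ / (2 ^ 14 * M ^ 8) ≤ ‖zetaReg s‖ := by
  have hτ0 : 0 < τ := by rw [hτ]; positivity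
  have hτ1 : τ ≤ 1 := by
    rw [hτ, div_le_one (by positivity)]; linarith
  have hK : 2 ≤ 2 / τ := by rw [le_div_iff₀ hτ0]; linarith
  have hq0 : 1 ≤ (2 * (1 + |s.im|)) ^ (2 * ε) :=
    Real.one_le_rpow (by linarith [abs_nonneg s.im]) (by positivity)
  have hCK : 1 ≤ 2 / τ * (121 * C) := by nlinarith
  have hM1 : 1 ≤ M := by rw [hM]; nlinarith
  have hB : BoxBounded zetaReg ε M |s.im| := by
    refine ⟨fun z hz => differentiableAt_zetaReg hz, fun z hz hz' hzT => ?_⟩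
    refine (exists_norm_zetaReg_le hε hε' hC1 hC hz hz').2.trans ?_
    rw [hM]
    have h1 : (1 + |z.im|) ^ (2 * ε) ≤ (2 * (1 + |s.im|)) ^ (2 * ε) := by
      gcongr; linarith [abs_nonneg s.im]
    calc 121 * C * (1 + |z.im|) ^ (2 * ε) ≤ 121 * C * (2 * (1 + |s.im|)) ^ (2 * ε) := by gcongr
      _ ≤ _ := by
        have : 121 * C ≤ 2 * (121 * C * (2 / τ)) := by nlinarith
        gcongr
  refine ⟨hB, ?_⟩
  have hB1 : BoxBounded zetaReg ε (363 * C) 1 := by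
    refine ⟨fun z hz => differentiableAt_zetaReg hz, fun z hz hz' hzT => ?_⟩
    refine (exists_norm_zetaReg_le hε hε' hC1 hC hz hz').2.trans ?_
    have h1 : (1 + |z.im|) ^ (2 * ε) ≤ 3 := by
      calc (1 + |z.im|) ^ (2 * ε) ≤ 3 ^ (2 * ε) := by
            gcongr; linarith
        _ ≤ 3 ^ (1 : ℝ) := Real.rpow_le_rpow_of_exponent_le (by norm_num) (by linarith)
        _ = 3 := Real.rpow_one 3
    calc 121 * C * (1 + |z.im|) ^ (2 * ε) ≤ 121 * C * 3 := by gcongr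
      _ = _ := by ring
  have hM78 : M ≤ M ^ 7 := le_self_pow₀ hM1 (by norm_num)
  have h7 : M ^ 7 ≤ M ^ 8 := pow_le_pow_right₀ hM1 (by norm_num)
  have hmain : ε ^ 4 * τ / (2 ^ 14 * M ^ 8) ≤ ε ^ 3 * τ / (2048 * M ^ 7) := by
    have h3 : ε ^ 4 * τ ≤ ε ^ 3 * τ := by
      calc ε ^ 4 * τ = ε ^ 3 * (ε * τ) := by ring
        _ ≤ _ := by gcongr; nlinarith
    have h5 : 2048 * M ^ 7 ≤ 2 ^ 14 * M ^ 8 := by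
      have : 0 ≤ M ^ 8 := by positivity
      linarith
    gcongr
  have hsσ : ((s.re : ℝ) : ℂ) + (s.im : ℝ) * I = s := Complex.re_add_im s
  have hquart : ∀ σ : ℝ, 1 < σ → σ ≤ 2 → (τ ≤ |s.im| ∨ τ ≤ σ - 1) →
      (σ - 1) ^ 3 * τ ≤ 16 * M ^ 4 * ‖zetaReg (σ + s.im * I)‖ ^ 4 := by
    intro σ h1 h2 h5
    have hre : 1 < ((σ : ℂ) + s.im * I).re := by simpa
    have hd : τ ≤ ‖(σ : ℂ) + s.im * I - 1‖ := by
      rcases h5 with h | h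
      · refine h.trans (le_trans (le_of_eq ?_) (Complex.abs_im_le_norm _)); simp
      · refine h.trans (le_trans (le_abs_self _) (le_trans (le_of_eq ?_)
          (Complex.abs_re_le_norm _))); simp
    have hd0 : 0 < ‖(σ : ℂ) + s.im * I - 1‖ := hτ0.trans_le hd
    have := norm_LSeries_quartic hC hε hC1 (1 : DirichletCharacter ℂ 1) h1 h2 rfl hτ0 hτ1
      (Or.inr h5)
    rw [LSeries_modOne_eq_zetaReg hre, Nat.cast_one, one_mul] at this
    have hr : ‖((σ : ℂ) + s.im * I) / ((σ : ℂ) + s.im * I - 1)‖ ≤ 2 / τ := by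
      rw [norm_div, div_le_iff₀ hd0]
      have h6 := norm_add_le ((σ : ℂ) + s.im * I - 1) 1
      rw [sub_add_cancel, norm_one] at h6
      have h8 : 2 ≤ 2 / τ * ‖(σ : ℂ) + s.im * I - 1‖ := by
        calc (2 : ℝ) = 2 / τ * τ := by field_simp
          _ ≤ _ := by gcongr
      nlinarith
    refine this.trans ?_
    rw [mul_div_assoc, norm_mul]
    calc (2 * C * (2 * (1 + |s.im|)) ^ (2 * ε)) ^ 4 * (‖zetaReg (σ + s.im * I)‖ *
          ‖((σ : ℂ) + s.im * I) / ((σ : ℂ) + s.im * I - 1)‖) ^ 4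
        ≤ (2 * C * (2 * (1 + |s.im|)) ^ (2 * ε)) ^ 4 * (‖zetaReg (σ + s.im * I)‖ *
          (2 / τ)) ^ 4 := by gcongr
      _ = (2 * (C * (2 / τ)) * (2 * (1 + |s.im|)) ^ (2 * ε)) ^ 4 *
          ‖zetaReg (σ + s.im * I)‖ ^ 4 := by ring
      _ ≤ M ^ 4 * ‖zetaReg (σ + s.im * I)‖ ^ 4 := by
        rw [hM]; gcongr; linarith
      _ ≤ _ := by
        gcongr
        have : 0 ≤ M ^ 4 := by positivity
        linarith
  refine hmain.trans ?_
  rcases le_or_gt τ |s.im| with h1 | h1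
  · have := hB.le_norm_of_quartic hε hε' hM1 hτ0 hτ1 (t := s.im) le_rfl
      (fun σ h2 h3 => hquart σ h2 h3 (Or.inl h1)) hs hs'
    rwa [hsσ] at this
  · have hε3 : ε ^ 3 ≤ 1 := pow_le_one₀ hε.le (by linarith)
    rcases le_or_gt τ (s.re - 1) with h2 | h2
    · refine le_of_pow_le_pow_left₀ (n := 4) (by norm_num) (norm_nonneg _) ?_
      have h3 := hquart s.re hs hs' (Or.inr h2)
      rw [hsσ] at h3
      have h4 : ε ^ 3 * τ / (2048 * M ^ 7) ≤ τ / (2 * M) := by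
        gcongr
        · nlinarith
        · norm_num
      calc _ ≤ (τ / (2 * M)) ^ 4 := by gcongr
        _ = τ ^ 3 * τ / (16 * M ^ 4) := by rw [div_pow]; ring
        _ ≤ _ := by
          rw [div_le_iff₀ (by positivity)]
          calc τ ^ 3 * τ ≤ (s.re - 1) ^ 3 * τ := by gcongr
            _ ≤ _ := h3
            _ = _ := by ring
    · have h3 := hB1.norm_sub_le hε hε' (z := 1) (w := s)
        (by simp; linarith) (by simp; norm_num) (by simp; norm_num)
        (by linarith) (by linarith) (by linarith)
      have h4 : ‖s - 1‖ ≤ 2 * τ := by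
        refine (Complex.norm_le_abs_re_add_abs_im _).trans ?_
        simp only [sub_re, one_re, sub_im, one_im, sub_zero]
        rw [abs_of_pos (by linarith : 0 < s.re - 1)]
        linarith
      have h5 : 2 * (363 * C) / ε * ‖s - 1‖ ≤ 1 / 2 := by
        calc _ ≤ 2 * (363 * C) / ε * (2 * τ) := by gcongr
          _ = _ := by rw [hτ]; field_simp; norm_num
      have h6 := norm_sub_norm_le (zetaReg 1) (zetaReg s)
      rw [norm_sub_rev, zetaReg_one, norm_one] at h6
      rw [zetaReg_one] at h3
      have h8 : ε ^ 3 * τ / (2048 * M ^ 7) ≤ 1 / 2 := by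
        rw [div_le_div_iff₀ (by positivity) (by norm_num)]
        have : 1 ≤ M ^ 7 := one_le_pow₀ hM1
        have : ε ^ 3 * τ ≤ 1 := mul_le_one₀ hε3 hτ0.le hτ1
        linarith
      linarith

theorem exists_iteratedDeriv_LSeries_vonMangoldt_le {η : ℝ} (hη : 0 < η) (k : ℕ) :
    ∃ C : ℝ, 0 < C ∧ ∀ s : ℂ, 1 < s.re → s.re ≤ 2 →
      ‖iteratedDeriv k (LSeries fun n => (ArithmeticFunction.vonMangoldt n : ℂ) - 1) s‖ ≤
        C * (1 + |s.im|) ^ η := by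
  obtain ⟨ε, hε, hε', hεη⟩ : ∃ ε : ℝ, 0 < ε ∧ ε ≤ 1 / 2 ∧ ε * (18 * (k + 1)) ≤ η := by
    refine ⟨min (1 / 2) (η / (18 * (k + 1))), by positivity, min_le_left _ _, ?_⟩
    calc _ ≤ η / (18 * (k + 1)) * (18 * (k + 1)) := by
          gcongr; exact min_le_right _ _
      _ = _ := by field_simp
  have hεη' : 2 * ε ≤ η := by
    have : (0 : ℝ) ≤ k := Nat.cast_nonneg k
    nlinarith
  obtain ⟨C, hC1, hC⟩ := exists_norm_contL_le hε hε'
  obtain ⟨τ, hτ⟩ : ∃ τ, τ = ε / (8 * (363 * C)) := ⟨_, rfl⟩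
  have hτ0 : 0 < τ := by rw [hτ]; positivity
  have hτ1 : τ ≤ 1 := by
    rw [hτ, div_le_one (by positivity)]; linarith
  have hK : 2 ≤ 2 / τ := by rw [le_div_iff₀ hτ0]; linarith
  obtain ⟨C2, hC2⟩ : ∃ C2, C2 = 121 * C * (2 / τ) := ⟨_, rfl⟩
  have hC2' : 1 ≤ C2 := by rw [hC2]; nlinarith
  refine ⟨k.factorial * (2 ^ 16 * (2 * C2 * 2 ^ (2 * ε)) ^ 9 / ε ^ 5) ^ (k + 1) / τ ^ (k + 1) +
    k.factorial * (43 * C * 2 ^ (2 * ε)) / (ε / 2) ^ k, by positivity, fun s hs hs' => ?_⟩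
  obtain ⟨M, hM⟩ : ∃ M, M = 2 * C2 * (2 * (1 + |s.im|)) ^ (2 * ε) := ⟨_, rfl⟩
  obtain ⟨hB, hlow⟩ := zetaReg_lower_bound hε hε' hC1 hC hτ hs hs' (hM.trans (by rw [hC2]))
  have hQ1 : 1 ≤ 1 + |s.im| := by linarith [abs_nonneg s.im]
  have hM0 : 0 < M := by rw [hM]; positivity
  have h1 := hB.norm_iteratedDeriv_logDeriv_le hε hε' (by positivity) hs.le hs' le_rfl hlow k
  rw [hM] at h1
  have h1' := h1.trans (logDeriv_bound_aux hεη hε hC2' hQ1 hτ0)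
  have hB2 : BoxBounded (fun z => 1 / z + 1 + regPart (1 : DirichletCharacter ℂ 1) z) ε
      (43 * C * (2 * (1 + |s.im|)) ^ (2 * ε)) |s.im| := by
    refine ⟨fun z hz => ?_, fun z hz hz' hzT => ?_⟩
    · exact (((differentiableAt_const _).div differentiableAt_id
        (ne_zero_of_re_pos hz)).add_const 1).add (differentiableAt_regPart _ hz)
    · have h2 := (exists_norm_zetaReg_le hε hε' hC1 hC hz hz').1
      have h3 : (1 + |z.im|) ^ (2 * ε) ≤ (2 * (1 + |s.im|)) ^ (2 * ε) := by
        gcongr; linarith [abs_nonneg s.im]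
      have h4 : 1 ≤ (2 * (1 + |s.im|)) ^ (2 * ε) :=
        Real.one_le_rpow (by linarith) (by positivity)
      have h5 : ‖(1 : ℂ) / z‖ ≤ 2 := by
        have : 1 / 2 ≤ ‖z‖ := (by linarith : 1 / 2 ≤ z.re).trans
          ((le_abs_self _).trans (Complex.abs_re_le_norm z))
        rw [norm_div, norm_one, div_le_iff₀ (by linarith)]; linarith
      calc _ ≤ ‖(1 : ℂ) / z‖ + ‖(1 : ℂ)‖ + ‖regPart (1 : DirichletCharacter ℂ 1) z‖ :=
            norm_add₃_le
        _ ≤ 2 + 1 + 40 * C * (2 * (1 + |s.im|)) ^ (2 * ε) := by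
          rw [norm_one]
          gcongr
          exact h2.trans (by gcongr)
        _ ≤ _ := by nlinarith
  have h2 := hB2.norm_iteratedDeriv_le hε hε' hs.le hs' le_rfl k
  have hopen : IsOpen {z : ℂ | 1 < z.re} := isOpen_lt continuous_const continuous_re
  have hopen0 : IsOpen {z : ℂ | 0 < z.re} := isOpen_lt continuous_const continuous_re
  have hev : (LSeries fun n => (ArithmeticFunction.vonMangoldt n : ℂ) - 1) =ᶠ[𝓝 s]
      -(logDeriv zetaReg + fun z => 1 / z + 1 + regPart (1 : DirichletCharacter ℂ 1) z) := by
    filter_upwards [hopen.mem_nhds hs] with z hz using LSeries_vonMangoldt_sub_one hz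
  have han1 : AnalyticAt ℂ zetaReg s :=
    DifferentiableOn.analyticAt (fun z hz => (differentiableAt_zetaReg hz).differentiableWithinAt)
      (hopen0.mem_nhds (by simp; linarith : s ∈ {z : ℂ | 0 < z.re}))
  have hne : zetaReg s ≠ 0 := by
    intro h0
    rw [h0, norm_zero] at hlow
    have : 0 < ε ^ 4 * τ / (2 ^ 14 * M ^ 8) := by positivity
    linarith
  have han2 : AnalyticAt ℂ (logDeriv zetaReg) s := han1.deriv.div han1 hne
  have han3 : AnalyticAt ℂ (fun z => 1 / z + 1 + regPart (1 : DirichletCharacter ℂ 1) z) s :=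
    DifferentiableOn.analyticAt (fun z hz => (hB2.1 z hz).differentiableWithinAt)
      (hopen0.mem_nhds (by simp; linarith : s ∈ {z : ℂ | 0 < z.re}))
  rw [hev.iteratedDeriv_eq, iteratedDeriv_neg, norm_neg,
    iteratedDeriv_add han2.contDiffAt han3.contDiffAt]
  refine (norm_add_le _ _).trans ((add_le_add h1' h2).trans ?_)
  have hpow : (1 + |s.im|) ^ (2 * ε) ≤ (1 + |s.im|) ^ η :=
    Real.rpow_le_rpow_of_exponent_le hQ1 hεη'
  rw [Real.mul_rpow zero_le_two (by linarith), add_mul]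
  refine add_le_add (le_of_eq (by ring)) ?_
  calc _ ≤ k.factorial * (43 * C * (2 ^ (2 * ε) * (1 + |s.im|) ^ η)) / (ε / 2) ^ k := by gcongr
    _ = _ := by ring

end Zeta

section Perron

/-- The Perron kernel whose Mellin transform is `1 / s ^ 2`. -/
noncomputable def perronKernel (u : ℝ) : ℂ := (max (-Real.log u) 0 : ℝ)

theorem mellin_perronKernel {s : ℂ} (hs : 0 < s.re) :
    MellinConvergent perronKernel s ∧ mellin perronKernel s = 1 / s ^ 2 := by
  have hs0 : s ≠ 0 := by rintro rfl; simp at hs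
  have hd := mellin_hasDerivAt_of_isBigO_rpow (E := ℂ) (a := s.re + 1) (b := 0)
    (f := indicator (Ioc 0 1) (fun _ => 1 : ℝ → ℂ)) (s := s) ?_ ?_ (by linarith) ?_ hs
  · have heq : ∀ t ∈ Ioi (0 : ℝ), perronKernel t =
        -(Real.log t • indicator (Ioc 0 1) (fun _ => 1 : ℝ → ℂ) t) := by
      intro t ht
      have ht : 0 < t := ht
      rcases le_or_gt t 1 with h | h
      · rw [indicator_of_mem (show t ∈ Ioc (0:ℝ) 1 from ⟨ht, h⟩), perronKernel, max_eq_left]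
        · simp
        · linarith [Real.log_nonpos ht.le h]
      · rw [indicator_of_notMem (by simp [h]), perronKernel, max_eq_right]
        · simp
        · linarith [Real.log_pos h]
    have hev : mellin (indicator (Ioc 0 1) (fun _ => 1 : ℝ → ℂ)) =ᶠ[𝓝 s] fun z => z⁻¹ := by
      have hopen : IsOpen {z : ℂ | 0 < z.re} := isOpen_lt continuous_const continuous_re
      filter_upwards [hopen.mem_nhds hs] with z hz
      rw [(hasMellin_one_Ioc hz).2, one_div]
    have h2 := hd.2.unique ((hasDerivAt_inv hs0).congr_of_eventuallyEq hev)
    constructor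
    · have := hd.1.neg
      refine IntegrableOn.congr_fun this (fun t ht => ?_) measurableSet_Ioi
      rw [heq t ht]; simp
    · rw [mellin]
      have h3 : ∀ t ∈ Ioi (0 : ℝ), (t : ℂ) ^ (s - 1) • perronKernel t =
          -((t : ℂ) ^ (s - 1) • (Real.log t • indicator (Ioc 0 1) (fun _ => 1 : ℝ → ℂ) t)) := by
        intro t ht
        rw [heq t ht, smul_neg]
      rw [setIntegral_congr_fun measurableSet_Ioi h3, integral_neg, ← mellin, h2]
      simp
  · refine LocallyIntegrable.locallyIntegrableOn ?_ _
    have hc : LocallyIntegrable (fun _ : ℝ => (1 : ℂ)) := locallyIntegrable_const _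
    exact hc.indicator measurableSet_Ioc
  · refine (isBigO_zero _ _).congr' ?_ EventuallyEq.rfl
    filter_upwards [eventually_gt_atTop (1 : ℝ)] with u hu
    rw [indicator_of_notMem]; simp [hu]
  · refine IsBigO.of_bound 1 (Eventually.of_forall fun u => ?_)
    by_cases h : u ∈ Ioc (0 : ℝ) 1 <;> simp [h]

theorem integrable_one_div_sq {σ : ℝ} (hσ : 0 < σ) :
    Integrable fun t : ℝ => 1 / ((σ : ℂ) + t * I) ^ 2 := by
  have hne : ∀ t : ℝ, (σ : ℂ) + t * I ≠ 0 := by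
    intro t h
    have := congrArg Complex.re h
    simp at this; linarith
  refine Integrable.mono' (integrable_inv_one_add_sq.const_mul (max 1 (1 / σ ^ 2))) ?_ ?_
  · refine Continuous.aestronglyMeasurable ?_
    exact continuous_const.div (by fun_prop) fun t => pow_ne_zero 2 (hne t)
  · refine Eventually.of_forall fun t => ?_
    have hsq : ‖(σ : ℂ) + t * I‖ ^ 2 = σ ^ 2 + t ^ 2 := by
      rw [Complex.sq_norm, Complex.normSq_add_mul_I]
    rw [norm_div, norm_one, norm_pow, hsq, ← div_eq_mul_inv, div_le_div_iff₀ (by positivity)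
      (by positivity), one_mul]
    have h1 : 1 ≤ max 1 (1 / σ ^ 2) := le_max_left _ _
    have h2 : 1 / σ ^ 2 ≤ max 1 (1 / σ ^ 2) := le_max_right _ _
    rw [div_le_iff₀ (by positivity)] at h2
    nlinarith [sq_nonneg t]

theorem perronKernel_eq_integral {σ : ℝ} (hσ : 0 < σ) {u : ℝ} (hu : 0 < u) :
    ∫ t : ℝ, (u : ℂ) ^ (-((σ : ℂ) + t * I)) * (1 / ((σ : ℂ) + t * I) ^ 2) =
      2 * Real.pi * perronKernel u := by
  have hre : ∀ t : ℝ, 0 < ((σ : ℂ) + t * I).re := by intro t; simpa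
  have hc : ContinuousAt perronKernel u := by
    unfold perronKernel
    exact Complex.continuous_ofReal.continuousAt.comp
      ((Real.continuousAt_log hu.ne').neg.max continuousAt_const)
  have hV : VerticalIntegrable (mellin perronKernel) σ := by
    unfold VerticalIntegrable
    refine (integrable_one_div_sq hσ).congr (Eventually.of_forall fun t => ?_)
    exact (mellin_perronKernel (hre t)).2.symm
  have h := mellinInv_mellin_eq σ perronKernel hu (mellin_perronKernel (by simpa)).1 hV hc
  have h2 : ∀ t : ℝ, (u : ℂ) ^ (-((σ : ℂ) + t * I)) * (1 / ((σ : ℂ) + t * I) ^ 2) =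
      (u : ℂ) ^ (-((σ : ℂ) + t * I)) • mellin perronKernel ((σ : ℂ) + t * I) := by
    intro t
    rw [(mellin_perronKernel (hre t)).2, smul_eq_mul]
  simp_rw [h2]
  rw [← h, mellinInv, Complex.real_smul]
  have : (Real.pi : ℂ) ≠ 0 := by exact_mod_cast Real.pi_ne_zero
  generalize (∫ y : ℝ, (u : ℂ) ^ (-((σ : ℂ) + y * I)) • mellin perronKernel (σ + y * I)) = J
  push_cast
  field_simp

theorem perron_formula {b : ℕ → ℂ} {σ x : ℝ} (hσ : 0 < σ) (hb : LSeriesSummable b σ)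
    (hx : 0 < x) {M : ℕ} (hM : x ≤ M + 1) :
    ∫ t : ℝ, LSeries b (σ + t * I) * ((x : ℂ) ^ ((σ : ℂ) + t * I) *
      (1 / ((σ : ℂ) + t * I) ^ 2)) =
      2 * Real.pi * ∑ n ∈ Finset.Icc 1 M, b n * perronKernel (n / x) := by
  have hker := integrable_one_div_sq hσ
  have hxm : Continuous fun t : ℝ => (x : ℂ) ^ ((σ : ℂ) + t * I) := by
    refine Continuous.const_cpow (by fun_prop) (Or.inl ?_)
    exact_mod_cast hx.ne'
  have hnx : ∀ t : ℝ, ‖(x : ℂ) ^ ((σ : ℂ) + t * I)‖ = x ^ σ := by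
    intro t; rw [Complex.norm_cpow_eq_rpow_re_of_pos hx]; simp
  have hker : Integrable fun t : ℝ => (x : ℂ) ^ ((σ : ℂ) + t * I) *
      (1 / ((σ : ℂ) + t * I) ^ 2) :=
    hker.bdd_mul (c := x ^ σ) hxm.aestronglyMeasurable
      (Eventually.of_forall fun t => (hnx t).le)
  have hterm : ∀ n : ℕ, ∀ t : ℝ, ‖LSeries.term b ((σ : ℂ) + t * I) n‖ =
      ‖LSeries.term b (σ : ℂ) n‖ := by
    intro n t
    rw [LSeries.norm_term_eq, LSeries.norm_term_eq]; simp
  have htc : ∀ n : ℕ, Continuous fun t : ℝ => LSeries.term b ((σ : ℂ) + t * I) n := by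
    intro n
    rcases eq_or_ne n 0 with rfl | hn
    · simp only [LSeries.term_zero]; exact continuous_const
    · simp only [LSeries.term_of_ne_zero hn]
      have hn' : (n : ℂ) ≠ 0 := by exact_mod_cast hn
      refine continuous_const.div (Continuous.const_cpow (by fun_prop) (Or.inl hn')) fun t => ?_
      rw [Ne, Complex.cpow_eq_zero_iff]
      tauto
  have hF : ∀ n : ℕ, Integrable fun t : ℝ => LSeries.term b ((σ : ℂ) + t * I) n *
      ((x : ℂ) ^ ((σ : ℂ) + t * I) * (1 / ((σ : ℂ) + t * I) ^ 2)) := by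
    intro n
    exact hker.bdd_mul (c := ‖LSeries.term b (σ : ℂ) n‖) (htc n).aestronglyMeasurable
      (Eventually.of_forall fun t => (hterm n t).le)
  have hsum := hasSum_integral_of_summable_integral_norm hF (by
    simp_rw [norm_mul, hterm]
    simp_rw [integral_const_mul]
    exact hb.norm.mul_right _)
  have h1 : ∀ t : ℝ, ∑' n, LSeries.term b ((σ : ℂ) + t * I) n *
      ((x : ℂ) ^ ((σ : ℂ) + t * I) * (1 / ((σ : ℂ) + t * I) ^ 2)) =
      LSeries b (σ + t * I) * ((x : ℂ) ^ ((σ : ℂ) + t * I) *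
      (1 / ((σ : ℂ) + t * I) ^ 2)) := by
    intro t; rw [tsum_mul_right]; rfl
  simp_rw [h1] at hsum
  rw [← hsum.tsum_eq, tsum_eq_sum (s := Finset.Icc 1 M), Finset.mul_sum]
  · refine Finset.sum_congr rfl fun n hn => ?_
    have hn1 := (Finset.mem_Icc.1 hn).1
    have hn0 : (0 : ℝ) < n := by exact_mod_cast hn1
    have h2 : ∀ t : ℝ, LSeries.term b ((σ : ℂ) + t * I) n *
        ((x : ℂ) ^ ((σ : ℂ) + t * I) * (1 / ((σ : ℂ) + t * I) ^ 2)) =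
        b n * (((n / x : ℝ) : ℂ) ^ (-((σ : ℂ) + t * I)) * (1 / ((σ : ℂ) + t * I) ^ 2)) := by
      intro t
      rw [LSeries.term_of_ne_zero (by omega), Complex.ofReal_div,
        Complex.div_cpow_ofReal_nonneg hn0.le hx.le, Complex.cpow_neg, Complex.cpow_neg]
      simp only [Complex.ofReal_natCast]
      field_simp
    simp_rw [h2]
    rw [integral_const_mul, perronKernel_eq_integral hσ (by positivity)]
    ring
  · intro n hn
    rcases eq_or_ne n 0 with rfl | hn0
    · simp
    · have hnM : M + 1 ≤ n := by
        simp only [Finset.mem_Icc, not_and, not_le] at hn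
        exact hn (by omega)
      have hn1 : (0 : ℝ) < n := by positivity
      have hxn : x ≤ n := hM.trans (by exact_mod_cast hnM)
      have h2 : ∀ t : ℝ, LSeries.term b ((σ : ℂ) + t * I) n *
          ((x : ℂ) ^ ((σ : ℂ) + t * I) * (1 / ((σ : ℂ) + t * I) ^ 2)) =
          b n * (((n / x : ℝ) : ℂ) ^ (-((σ : ℂ) + t * I)) * (1 / ((σ : ℂ) + t * I) ^ 2)) := by
        intro t
        rw [LSeries.term_of_ne_zero (by omega), Complex.ofReal_div,
          Complex.div_cpow_ofReal_nonneg hn1.le hx.le, Complex.cpow_neg, Complex.cpow_neg]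
        simp only [Complex.ofReal_natCast]
        field_simp
      simp_rw [h2]
      rw [integral_const_mul, perronKernel_eq_integral hσ (by positivity), perronKernel,
        max_eq_right]
      · simp
      · have : 0 ≤ Real.log (n / x) := Real.log_nonneg (by rwa [le_div_iff₀ hx, one_mul])
        linarith

end Perron

section Transfer

theorem integrable_perron {b : ℕ → ℂ} {σ x : ℝ} (hσ : 0 < σ) (hb : LSeriesSummable b σ)
    (hx : 0 < x) :
    Integrable fun t : ℝ => LSeries b (σ + t * I) * ((x : ℂ) ^ ((σ : ℂ) + t * I) *
      (1 / ((σ : ℂ) + t * I) ^ 2)) := by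
  have hker := integrable_one_div_sq hσ
  have hxm : Continuous fun t : ℝ => (x : ℂ) ^ ((σ : ℂ) + t * I) := by
    refine Continuous.const_cpow (by fun_prop) (Or.inl ?_)
    exact_mod_cast hx.ne'
  have hnx : ∀ t : ℝ, ‖(x : ℂ) ^ ((σ : ℂ) + t * I)‖ = x ^ σ := by
    intro t; rw [Complex.norm_cpow_eq_rpow_re_of_pos hx]; simp
  have hker : Integrable fun t : ℝ => (x : ℂ) ^ ((σ : ℂ) + t * I) *
      (1 / ((σ : ℂ) + t * I) ^ 2) :=
    hker.bdd_mul (c := x ^ σ) hxm.aestronglyMeasurable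
      (Eventually.of_forall fun t => (hnx t).le)
  have hterm : ∀ n : ℕ, ∀ t : ℝ, ‖LSeries.term b ((σ : ℂ) + t * I) n‖ ≤
      ‖LSeries.term b (σ : ℂ) n‖ := by
    intro n t
    rw [LSeries.norm_term_eq, LSeries.norm_term_eq]; simp
  have htc : ∀ n : ℕ, Continuous fun t : ℝ => LSeries.term b ((σ : ℂ) + t * I) n := by
    intro n
    rcases eq_or_ne n 0 with rfl | hn
    · simp only [LSeries.term_zero]; exact continuous_const
    · simp only [LSeries.term_of_ne_zero hn]
      have hn' : (n : ℂ) ≠ 0 := by exact_mod_cast hn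
      refine continuous_const.div (Continuous.const_cpow (by fun_prop) (Or.inl hn')) fun t => ?_
      rw [Ne, Complex.cpow_eq_zero_iff]
      tauto
  have hcont : Continuous fun t : ℝ => LSeries b (σ + t * I) :=
    continuous_tsum htc hb.norm hterm
  refine hker.bdd_mul (c := ∑' n, ‖LSeries.term b (σ : ℂ) n‖) hcont.aestronglyMeasurable
    (Eventually.of_forall fun t => ?_)
  have h1 : Summable fun n => ‖LSeries.term b ((σ : ℂ) + t * I) n‖ :=
    hb.norm.of_nonneg_of_le (fun _ => norm_nonneg _) fun n => hterm n t
  exact (norm_tsum_le_tsum_norm h1).trans (h1.tsum_le_tsum (fun n => hterm n t) hb.norm)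

theorem norm_exp_sub_one_le_rpow {z : ℂ} (hz : z.re ≤ 2) : ‖exp z - 1‖ ≤ 9 * ‖z‖ ^ (1 / 2 : ℝ) := by
  rcases le_or_gt ‖z‖ 1 with h | h
  · have h1 := Complex.norm_exp_sub_one_le h
    have h2 : ‖z‖ ≤ ‖z‖ ^ (1 / 2 : ℝ) := by
      conv_lhs => rw [← Real.rpow_one ‖z‖]
      exact Real.rpow_le_rpow_of_exponent_ge' (norm_nonneg _) h (by norm_num) (by norm_num)
    linarith [norm_nonneg z]
  · have h1 : ‖exp z - 1‖ ≤ Real.exp 2 + 1 := by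
      refine (norm_sub_le _ _).trans ?_
      rw [Complex.norm_exp, norm_one]
      gcongr
    have h2 : Real.exp 2 ≤ 8 := by
      have := Real.exp_one_lt_d9
      have h3 : Real.exp 2 = Real.exp 1 * Real.exp 1 := by rw [← Real.exp_add]; norm_num
      rw [h3]; nlinarith [Real.exp_pos 1]
    have h3 : 1 ≤ ‖z‖ ^ (1 / 2 : ℝ) := Real.one_le_rpow h.le (by norm_num)
    linarith

theorem abscissaOfAbsConv_le_one_of_log {a : ℕ → ℂ} (ha : ∀ n : ℕ, 1 ≤ n → ‖a n‖ ≤ 1 + Real.log n) :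
    LSeries.abscissaOfAbsConv a ≤ 1 := by
  refine LSeries.abscissaOfAbsConv_le_of_forall_lt_LSeriesSummable' (x := 1) fun y hy => ?_
  have hy : (1 : ℝ) < y := by exact_mod_cast hy
  have hε : 0 < (y - 1) / 2 := by linarith
  refine LSeriesSummable_of_isBigO_rpow (x := 1 + (y - 1) / 2) (by simp; linarith) ?_
  refine IsBigO.of_bound (1 + 1 / ((y - 1) / 2)) ?_
  filter_upwards [eventually_ge_atTop 1] with n hn
  refine (ha n hn).trans ?_
  have hn' : (1 : ℝ) ≤ n := by exact_mod_cast hn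
  have h1 := Real.log_le_rpow_div (x := (n : ℝ)) (by positivity) hε
  have h2 : (1 : ℝ) ≤ (n : ℝ) ^ ((y - 1) / 2) := Real.one_le_rpow hn' hε.le
  rw [Real.norm_of_nonneg (by positivity), show 1 + (y - 1) / 2 - 1 = (y - 1) / 2 by ring]
  rw [add_mul, one_mul, one_div_mul_eq_div]
  linarith

theorem logMul_iterate_apply (a : ℕ → ℂ) (k n : ℕ) :
    (LSeries.logMul^[k] a) n = a n * ((Real.log n : ℝ) : ℂ) ^ k := by
  induction k with
  | zero => simp
  | succ k ih =>
    rw [Function.iterate_succ_apply', LSeries.logMul, ih, Complex.natCast_log]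
    ring

theorem norm_perron_diff_le {b : ℕ → ℂ} {σ x δ B : ℝ} (hσ : 1 < σ) (hσ2 : σ ≤ 2) (hB : 0 ≤ B)
    (hb : LSeriesSummable b σ) (hx : 0 < x) (hδ : 0 < δ) (hδ1 : δ ≤ 1)
    (hbd : ∀ t : ℝ, ‖LSeries b (σ + t * I)‖ ≤ B * (1 + |t|) ^ (1 / 4 : ℝ)) :
    ‖(∫ t : ℝ, LSeries b (σ + t * I) * (((x * Real.exp δ : ℝ) : ℂ) ^ ((σ : ℂ) + t * I) *
      (1 / ((σ : ℂ) + t * I) ^ 2))) -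
      ∫ t : ℝ, LSeries b (σ + t * I) * ((x : ℂ) ^ ((σ : ℂ) + t * I) *
      (1 / ((σ : ℂ) + t * I) ^ 2))‖ ≤
      36 * B * x ^ σ * δ ^ (1 / 2 : ℝ) * ∫ t : ℝ, (1 + ‖t‖) ^ (-(5 / 4) : ℝ) := by
  have hx' : 0 < x * Real.exp δ := by positivity
  rw [← integral_sub (integrable_perron (by linarith) hb hx') (integrable_perron (by linarith) hb hx),
    ← integral_const_mul]
  have hi : Integrable fun t : ℝ => (1 + ‖t‖) ^ (-(5 / 4) : ℝ) :=
    integrable_one_add_norm (by simp; norm_num)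
  refine norm_integral_le_of_norm_le (hi.const_mul _) (Eventually.of_forall fun t => ?_)
  set s : ℂ := (σ : ℂ) + t * I with hs
  have hsre : s.re = σ := by simp [hs]
  have hsim : s.im = t := by simp [hs]
  have hcp : ((x * Real.exp δ : ℝ) : ℂ) ^ s = (x : ℂ) ^ s * exp (δ * s) := by
    rw [Complex.ofReal_mul, Complex.mul_cpow_ofReal_nonneg hx.le (Real.exp_pos _).le]
    congr 1
    rw [Complex.cpow_def_of_ne_zero (by exact_mod_cast (Real.exp_pos δ).ne'),
      ← Complex.ofReal_log (Real.exp_pos _).le, Real.log_exp]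
  have h1 : LSeries b s * (((x * Real.exp δ : ℝ) : ℂ) ^ s * (1 / s ^ 2)) -
      LSeries b s * ((x : ℂ) ^ s * (1 / s ^ 2)) =
      LSeries b s * (x : ℂ) ^ s * (exp (δ * s) - 1) * (1 / s ^ 2) := by
    rw [hcp]; ring
  have hsn : 0 < ‖s‖ := by
    have : |s.re| ≤ ‖s‖ := Complex.abs_re_le_norm s
    rw [hsre, abs_of_pos (by linarith)] at this; linarith
  have hs2 : (1 + |t|) / 2 ≤ ‖s‖ := by
    have h2 : |s.re| ≤ ‖s‖ := Complex.abs_re_le_norm s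
    have h3 : |s.im| ≤ ‖s‖ := Complex.abs_im_le_norm s
    rw [hsre, abs_of_pos (by linarith)] at h2
    rw [hsim] at h3
    linarith
  have hexp : ‖exp (δ * s) - 1‖ ≤ 9 * (δ ^ (1 / 2 : ℝ) * ‖s‖ ^ (1 / 2 : ℝ)) := by
    have h4 := norm_exp_sub_one_le_rpow (z := δ * s) (by
      rw [Complex.re_ofReal_mul, hsre]; nlinarith)
    rwa [norm_mul, Complex.norm_real, Real.norm_of_nonneg hδ.le,
      Real.mul_rpow hδ.le hsn.le] at h4
  have hxs : ‖(x : ℂ) ^ s‖ = x ^ σ := by rw [Complex.norm_cpow_eq_rpow_re_of_pos hx, hsre]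
  rw [h1, norm_mul, norm_mul, norm_mul, hxs, norm_div, norm_one, norm_pow]
  have hpow : ‖s‖ ^ (1 / 2 : ℝ) * (1 / ‖s‖ ^ 2) ≤ 4 * (1 + |t|) ^ (-(3 / 2) : ℝ) := by
    have h5 : ‖s‖ ^ (1 / 2 : ℝ) * (1 / ‖s‖ ^ 2) = ‖s‖ ^ (-(3 / 2) : ℝ) := by
      rw [one_div (‖s‖ ^ 2), ← Real.rpow_natCast, ← Real.rpow_neg hsn.le, ← Real.rpow_add hsn]
      norm_num
    rw [h5]
    have h6 : ‖s‖ ^ (-(3 / 2) : ℝ) ≤ ((1 + |t|) / 2) ^ (-(3 / 2) : ℝ) :=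
      Real.rpow_le_rpow_of_nonpos (by positivity) hs2 (by norm_num)
    refine h6.trans ?_
    rw [div_eq_mul_inv, Real.mul_rpow (by positivity) (by positivity), mul_comm]
    gcongr
    rw [Real.inv_rpow (by norm_num), ← Real.rpow_neg (by norm_num), neg_neg]
    calc (2 : ℝ) ^ (3 / 2 : ℝ) ≤ 2 ^ (2 : ℝ) :=
          Real.rpow_le_rpow_of_exponent_le (by norm_num) (by norm_num)
      _ = 4 := by norm_num
  have ht : (1 + |t|) ^ (1 / 4 : ℝ) * (1 + |t|) ^ (-(3 / 2) : ℝ) = (1 + ‖t‖) ^ (-(5 / 4) : ℝ) := by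
    rw [← Real.rpow_add (by positivity), Real.norm_eq_abs]; norm_num
  have hxσ : 0 < x ^ σ := Real.rpow_pos_of_pos hx _
  calc ‖LSeries b s‖ * x ^ σ * ‖exp (δ * s) - 1‖ * (1 / ‖s‖ ^ 2)
      ≤ (B * (1 + |t|) ^ (1 / 4 : ℝ)) * x ^ σ * (9 * (δ ^ (1 / 2 : ℝ) * ‖s‖ ^ (1 / 2 : ℝ))) *
        (1 / ‖s‖ ^ 2) := by
        gcongr
        exact hbd t
    _ = 9 * B * x ^ σ * δ ^ (1 / 2 : ℝ) * (1 + |t|) ^ (1 / 4 : ℝ) *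
        (‖s‖ ^ (1 / 2 : ℝ) * (1 / ‖s‖ ^ 2)) := by ring
    _ ≤ 9 * B * x ^ σ * δ ^ (1 / 2 : ℝ) * (1 + |t|) ^ (1 / 4 : ℝ) *
        (4 * (1 + |t|) ^ (-(3 / 2) : ℝ)) := by gcongr
    _ = 36 * B * x ^ σ * δ ^ (1 / 2 : ℝ) * (1 + ‖t‖) ^ (-(5 / 4) : ℝ) := by rw [← ht]; ring

end Transfer

section Transfer

theorem perronKernel_eq_log {n x : ℝ} (hn : 0 < n) (hnx : n ≤ x) :
    perronKernel (n / x) = ((Real.log x - Real.log n : ℝ) : ℂ) := by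
  have hx : 0 < x := hn.trans_le hnx
  rw [perronKernel, Real.log_div hn.ne' hx.ne', max_eq_left]
  · rw [neg_sub]
  · linarith [Real.log_le_log hn hnx]

theorem perronKernel_eq_zero {n x : ℝ} (hx : 0 < x) (hnx : x ≤ n) :
    perronKernel (n / x) = 0 := by
  have hn : 0 < n := hx.trans_le hnx
  rw [perronKernel, Real.log_div hn.ne' hx.ne', max_eq_right]
  · simp
  · linarith [Real.log_le_log hx hnx]

theorem norm_sum_mul_log_pow_le (k : ℕ) : ∃ C > 0, ∀ (a : ℕ → ℂ) (B : ℝ), 0 ≤ B →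
    (∀ n : ℕ, 1 ≤ n → ‖a n‖ ≤ 1 + Real.log n) →
    (∀ s : ℂ, 1 < s.re → s.re ≤ 2 →
      ‖iteratedDeriv k (LSeries a) s‖ ≤ B * (1 + |s.im|) ^ (1 / 4 : ℝ)) →
    ∀ x : ℝ, Real.exp 1 ≤ x → ‖∑ n ∈ Finset.Icc 1 ⌊x⌋₊, a n * ((Real.log n : ℝ) : ℂ) ^ k‖ ≤
      C * x * (B * Real.log x ^ 2 + Real.log x ^ (k + 1) / Real.log x ^ 4) := by
  set J := ∫ t : ℝ, (1 + ‖t‖) ^ (-(5 / 4) : ℝ) with hJ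
  have hJ0 : 0 ≤ J := integral_nonneg fun t => by positivity
  refine ⟨36 * Real.exp 1 * J + 78 * 2 ^ k, by positivity, fun a B hB ha hbd x hx => ?_⟩
  set L := Real.log x with hL
  have hx0 : 0 < x := (Real.exp_pos 1).trans_le hx
  have hL1 : 1 ≤ L := by rw [hL, Real.le_log_iff_exp_le hx0]; exact hx
  set δ : ℝ := 1 / L ^ 4 with hδ
  have hδ0 : 0 < δ := by positivity
  have hδ1 : δ ≤ 1 := by
    rw [hδ, div_le_one (by positivity)]; exact one_le_pow₀ hL1
  set x' := x * Real.exp δ with hx'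
  have hx'0 : 0 < x' := by positivity
  have hxx' : x ≤ x' := by
    rw [hx']; nlinarith [Real.one_le_exp hδ0.le]
  have hlogx' : Real.log x' = L + δ := by
    rw [hx', Real.log_mul hx0.ne' (Real.exp_pos _).ne', Real.log_exp]
  set M := ⌊x'⌋₊ with hM
  have hNM : ⌊x⌋₊ ≤ M := Nat.floor_mono hxx'
  set σ : ℝ := 1 + 1 / L with hσ
  have hσ1 : 1 < σ := by rw [hσ]; have : 0 < 1 / L := by positivity
                         linarith
  have hσ2 : σ ≤ 2 := by
    rw [hσ]; have : 1 / L ≤ 1 := by rw [div_le_one (by positivity)]; exact hL1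
    linarith
  have hxσ : x ^ σ = Real.exp 1 * x := by
    rw [hσ, Real.rpow_add hx0, Real.rpow_one, Real.rpow_def_of_pos hx0 (1 / L), ← hL,
      mul_one_div_cancel (by positivity)]; ring
  set b : ℕ → ℂ := LSeries.logMul^[k] a with hb
  have habs := abscissaOfAbsConv_le_one_of_log ha
  have hlt : ∀ s : ℂ, 1 < s.re → LSeries.abscissaOfAbsConv a < s.re := fun s hs =>
    habs.trans_lt (by exact_mod_cast hs)
  have hsummable : LSeriesSummable b (σ : ℂ) := by
    refine LSeriesSummable_of_abscissaOfAbsConv_lt_re ?_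
    rw [hb, LSeries.absicssaOfAbsConv_logPowMul]
    exact hlt _ (by simpa)
  have hbound : ∀ t : ℝ, ‖LSeries b (σ + t * I)‖ ≤ B * (1 + |t|) ^ (1 / 4 : ℝ) := by
    intro t
    have h1 := LSeries_iteratedDeriv k (hlt ((σ : ℂ) + t * I) (by simpa))
    have h2 := hbd ((σ : ℂ) + t * I) (by simpa) (by simpa)
    rw [h1, norm_mul, norm_pow, norm_neg, norm_one, one_pow, one_mul] at h2
    simpa using h2
  have hP := norm_perron_diff_le hσ1 hσ2 hB hsummable hx0 hδ0 hδ1 hbound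
  have hMx' : x' ≤ (M : ℝ) + 1 := (Nat.lt_floor_add_one _).le
  rw [perron_formula (by linarith) hsummable hx'0 hMx',
    perron_formula (by linarith) hsummable hx0 (hxx'.trans hMx'), ← mul_sub,
    ← Finset.sum_sub_distrib] at hP
  have hsplit : ∑ n ∈ Finset.Icc 1 M, (b n * perronKernel (n / x') - b n * perronKernel (n / x)) =
      δ * ∑ n ∈ Finset.Icc 1 ⌊x⌋₊, b n + ∑ n ∈ Finset.Ioc ⌊x⌋₊ M, b n * perronKernel (n / x') := by
    have hdis : Disjoint (Finset.Icc 1 ⌊x⌋₊) (Finset.Ioc ⌊x⌋₊ M) := by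
      rw [Finset.disjoint_left]; intro n h1 h2
      simp only [Finset.mem_Icc, Finset.mem_Ioc] at h1 h2; omega
    have hun : Finset.Icc 1 M = Finset.Icc 1 ⌊x⌋₊ ∪ Finset.Ioc ⌊x⌋₊ M := by
      ext n; simp only [Finset.mem_union, Finset.mem_Icc, Finset.mem_Ioc]; omega
    rw [hun, Finset.sum_union hdis, Finset.mul_sum]
    congr 1
    · refine Finset.sum_congr rfl fun n hn => ?_
      obtain ⟨hn1, hn2⟩ := Finset.mem_Icc.1 hn
      have hn0 : (0 : ℝ) < n := by exact_mod_cast hn1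
      have hnx : (n : ℝ) ≤ x := (Nat.le_floor_iff hx0.le).1 hn2
      rw [perronKernel_eq_log hn0 hnx, perronKernel_eq_log hn0 (hnx.trans hxx'), hlogx']
      push_cast; ring
    · refine Finset.sum_congr rfl fun n hn => ?_
      obtain ⟨hn1, hn2⟩ := Finset.mem_Ioc.1 hn
      have hnx : x ≤ n := ((Nat.floor_lt hx0.le).1 hn1).le
      rw [perronKernel_eq_zero hx0 hnx, mul_zero, sub_zero]
  rw [hsplit] at hP
  have hedge : ‖∑ n ∈ Finset.Ioc ⌊x⌋₊ M, b n * perronKernel (n / x')‖ ≤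
      26 * δ * x * (3 * L * (2 * L) ^ k * δ) := by
    have hterm : ∀ n ∈ Finset.Ioc ⌊x⌋₊ M, ‖b n * perronKernel (n / x')‖ ≤
        3 * L * (2 * L) ^ k * δ := by
      intro n hn
      obtain ⟨hn1, hn2⟩ := Finset.mem_Ioc.1 hn
      have hnx : x ≤ n := ((Nat.floor_lt hx0.le).1 hn1).le
      have hnx' : (n : ℝ) ≤ x' := (Nat.le_floor_iff hx'0.le).1 hn2
      have hn0 : (0 : ℝ) < n := hx0.trans_le hnx
      have hn1' : 1 ≤ n := by exact_mod_cast hn0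
      have hlogn : Real.log n ≤ L + δ := by
        rw [← hlogx']; exact Real.log_le_log hn0 hnx'
      have hlogn' : L ≤ Real.log n := Real.log_le_log hx0 hnx
      rw [norm_mul, hb, logMul_iterate_apply, norm_mul, norm_pow, Complex.norm_real,
        perronKernel_eq_log hn0 hnx', Complex.norm_real, hlogx',
        Real.norm_of_nonneg (by linarith : 0 ≤ Real.log n), Real.norm_of_nonneg (by linarith)]
      have h3 : ‖a n‖ ≤ 3 * L := (ha n hn1').trans (by linarith)
      have h4 : Real.log n ≤ 2 * L := by linarith
      gcongr
      linarith
    have hcard : ((Finset.Ioc ⌊x⌋₊ M).card : ℝ) ≤ 26 * δ * x := by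
      rw [Nat.card_Ioc, Nat.cast_sub hNM]
      have h1 : (M : ℝ) ≤ x' := Nat.floor_le hx'0.le
      have h2 : x < (⌊x⌋₊ : ℝ) + 1 := Nat.lt_floor_add_one x
      have h3 := Real.abs_exp_sub_one_sub_id_le (x := δ) (by rw [abs_of_pos hδ0]; exact hδ1)
      have h4 : Real.exp δ ≤ 1 + 2 * δ := by
        have := (abs_le.1 h3).2
        nlinarith
      have h5 : L ^ 4 ≤ 24 * x := by
        have h6 := Real.pow_div_factorial_le_exp L (by linarith) 4
        rw [hL, Real.exp_log hx0, ← hL] at h6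
        have : ((Nat.factorial 4 : ℕ) : ℝ) = 24 := by norm_num [Nat.factorial]
        rw [this] at h6
        linarith
      have h7 : 1 ≤ 24 * δ * x := by
        rw [hδ, mul_one_div, div_mul_eq_mul_div, le_div_iff₀ (by positivity)]; linarith
      have h8 : x' ≤ x * (1 + 2 * δ) := by rw [hx']; gcongr
      linarith
    calc _ ≤ ∑ n ∈ Finset.Ioc ⌊x⌋₊ M, 3 * L * (2 * L) ^ k * δ :=
          (norm_sum_le _ _).trans (Finset.sum_le_sum hterm)
      _ = (Finset.Ioc ⌊x⌋₊ M).card * (3 * L * (2 * L) ^ k * δ) := by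
          rw [Finset.sum_const, nsmul_eq_mul]
      _ ≤ _ := by gcongr
  have hbsum : ∑ n ∈ Finset.Icc 1 ⌊x⌋₊, a n * ((Real.log n : ℝ) : ℂ) ^ k =
      ∑ n ∈ Finset.Icc 1 ⌊x⌋₊, b n :=
    Finset.sum_congr rfl fun n _ => by rw [hb, logMul_iterate_apply]
  rw [hbsum]
  set S := ∑ n ∈ Finset.Icc 1 ⌊x⌋₊, b n
  set E := ∑ n ∈ Finset.Ioc ⌊x⌋₊ M, b n * perronKernel (n / x')
  have hP2 : ‖(δ : ℂ) * S + E‖ ≤ 36 * B * x ^ σ * δ ^ (1 / 2 : ℝ) * J := by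
    refine le_trans ?_ hP
    rw [norm_mul]
    have : (1 : ℝ) ≤ ‖(2 * Real.pi : ℂ)‖ := by
      rw [norm_mul, Complex.norm_real, Real.norm_of_nonneg Real.pi_pos.le]
      have := Real.pi_gt_three
      simp only [Complex.norm_ofNat]; linarith
    nlinarith [norm_nonneg ((δ : ℂ) * S + E)]
  have hP3 : δ * ‖S‖ ≤ 36 * B * x ^ σ * δ ^ (1 / 2 : ℝ) * J +
      26 * δ * x * (3 * L * (2 * L) ^ k * δ) := by
    have h1 : ‖(δ : ℂ) * S‖ = δ * ‖S‖ := by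
      rw [norm_mul, Complex.norm_real, Real.norm_of_nonneg hδ0.le]
    have h2 : ‖(δ : ℂ) * S‖ ≤ ‖(δ : ℂ) * S + E‖ + ‖E‖ := by
      have := norm_sub_le ((δ : ℂ) * S + E) E
      simpa using this
    rw [← h1]; linarith
  have hδh : δ ^ (1 / 2 : ℝ) = δ * L ^ 2 := by
    have : δ = (1 / L ^ 2) ^ 2 := by rw [hδ]; ring
    rw [this, ← Real.sqrt_eq_rpow, Real.sqrt_sq (by positivity)]
    field_simp
  rw [hxσ, hδh] at hP3
  have hP4 : ‖S‖ ≤ 36 * B * (Real.exp 1 * x) * L ^ 2 * J + 26 * x * (3 * L * (2 * L) ^ k * δ) := by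
    refine le_of_mul_le_mul_left (hP3.trans (le_of_eq ?_)) hδ0
    ring
  refine hP4.trans ?_
  have e1 : 26 * x * (3 * L * (2 * L) ^ k * δ) = 78 * 2 ^ k * x * (L ^ (k + 1) / L ^ 4) := by
    rw [hδ, mul_pow]; ring
  rw [e1]
  have p1 : 0 ≤ 36 * Real.exp 1 * J * x * (L ^ (k + 1) / L ^ 4) := by positivity
  have p2 : 0 ≤ 78 * 2 ^ k * x * (B * L ^ 2) := by positivity
  nlinarith

end Transfer

section Abel

theorem sum_range_mul_by_parts (c w : ℕ → ℂ) (m : ℕ) :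
    ∑ i ∈ Finset.range m, c i * w i = w m * ∑ i ∈ Finset.range m, c i +
      ∑ i ∈ Finset.range m, (w i - w (i + 1)) * ∑ j ∈ Finset.range (i + 1), c j := by
  induction m with
  | zero => simp
  | succ m ih =>
    rw [Finset.sum_range_succ, ih, Finset.sum_range_succ (fun i => (w i - w (i + 1)) * _) m,
      Finset.sum_range_succ c m]
    ring

theorem norm_sum_mul_antitone_le {c : ℕ → ℂ} {w : ℕ → ℝ} {G : ℝ} (hw : Antitone w)
    (hw0 : ∀ n, 0 ≤ w n) (n : ℕ) (hG : ∀ m ≤ n, ‖∑ i ∈ Finset.range m, c i‖ ≤ G) :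
    ‖∑ i ∈ Finset.range n, c i * (w i : ℂ)‖ ≤ G * w 0 := by
  rw [sum_range_mul_by_parts c fun i => (w i : ℂ)]
  simp_rw [← Complex.ofReal_sub]
  calc _ ≤ w n * G + ∑ i ∈ Finset.range n, (w i - w (i + 1)) * G := by
        refine (norm_add_le _ _).trans (add_le_add ?_ ((norm_sum_le _ _).trans
          (Finset.sum_le_sum fun i hi => ?_)))
        · rw [norm_mul, Complex.norm_real, Real.norm_of_nonneg (hw0 n)]
          exact mul_le_mul_of_nonneg_left (hG n le_rfl) (hw0 n)
        · have h1 : 0 ≤ w i - w (i + 1) := sub_nonneg.2 (hw (Nat.le_succ i))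
          rw [norm_mul, Complex.norm_real, Real.norm_of_nonneg h1]
          exact mul_le_mul_of_nonneg_left (hG _ (by have := Finset.mem_range.1 hi; omega)) h1
    _ = G * w 0 := by
        rw [← Finset.sum_mul, Finset.sum_range_sub']; ring

theorem norm_sum_div_log_le (k : ℕ) : ∃ C > 0, ∀ (a : ℕ → ℂ) (B : ℝ), 0 ≤ B →
    (∀ n : ℕ, 1 ≤ n → ‖a n‖ ≤ 1 + Real.log n) →
    (∀ s : ℂ, 1 < s.re → s.re ≤ 2 →
      ‖iteratedDeriv k (LSeries a) s‖ ≤ B * (1 + |s.im|) ^ (1 / 4 : ℝ)) →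
    ∀ x : ℝ, 4 ≤ x → ‖∑ n ∈ Finset.Icc ⌈x⌉₊ ⌊2 * x⌋₊, a n * (((Real.log n)⁻¹ : ℝ) : ℂ)‖ ≤
      C * x * (B * Real.log x ^ 2 / Real.log x ^ (k + 1) + 1 / Real.log x ^ 4) := by
  obtain ⟨C, hC, h⟩ := norm_sum_mul_log_pow_le k
  refine ⟨4 * C * 2 ^ (k + 5), by positivity, fun a B hB ha hbd x hx => ?_⟩
  have he := Real.exp_one_lt_d9
  set L := Real.log x with hL
  have hx0 : 0 < x := by linarith
  have hL1 : 1 ≤ L := by rw [hL, Real.le_log_iff_exp_le hx0]; linarith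
  set A := ⌈x⌉₊ with hA
  set Z := ⌊2 * x⌋₊ with hZ
  have hxA : x ≤ A := Nat.le_ceil x
  have hA1 : (A : ℝ) < x + 1 := Nat.ceil_lt_add_one hx0.le
  have hZ2 : (Z : ℝ) ≤ 2 * x := Nat.floor_le (by positivity)
  have hA4 : 4 ≤ A := by exact_mod_cast hx.trans hxA
  set c : ℕ → ℂ := fun n => a n * ((Real.log n : ℝ) : ℂ) ^ k with hc
  set H : ℝ := 2 * C * x * (2 ^ (k + 5) * (B * L ^ 2 + L ^ (k + 1) / L ^ 4)) with hH
  have hpart : ∀ m : ℕ, A - 1 ≤ m → m ≤ Z → ‖∑ n ∈ Finset.Icc 1 m, c n‖ ≤ H := by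
    intro m hm1 hm2
    have hmx : (m : ℝ) ≤ 2 * x := le_trans (by exact_mod_cast hm2) hZ2
    have hmx' : x - 1 ≤ m := by
      have : (A : ℝ) ≤ m + 1 := by exact_mod_cast (by omega : A ≤ m + 1)
      linarith
    have hm0 : (0 : ℝ) < m := by linarith
    have h1 := h a B hB ha hbd m (by linarith)
    rw [Nat.floor_natCast] at h1
    refine h1.trans ?_
    have hl1 : Real.log m ≤ 2 * L := by
      have : Real.log (x ^ 2) = 2 * L := by rw [Real.log_pow, hL]; norm_num
      rw [← this]
      exact Real.log_le_log hm0 (by nlinarith)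
    have hl2 : L / 2 ≤ Real.log m := by
      have h2 : L ≤ 2 * Real.log m := by
        have : Real.log ((m : ℝ) ^ 2) = 2 * Real.log m := by rw [Real.log_pow]; norm_num
        rw [← this]
        exact Real.log_le_log hx0 (by nlinarith)
      linarith
    have hlm : 0 ≤ Real.log m := by linarith
    have e1 : Real.log m ^ 2 ≤ 2 ^ (k + 5) * L ^ 2 := by
      calc Real.log m ^ 2 ≤ (2 * L) ^ 2 := by gcongr
        _ = 2 ^ 2 * L ^ 2 := by ring
        _ ≤ _ := by gcongr <;> norm_num
    have e2 : Real.log m ^ (k + 1) / Real.log m ^ 4 ≤ 2 ^ (k + 5) * (L ^ (k + 1) / L ^ 4) := by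
      calc Real.log m ^ (k + 1) / Real.log m ^ 4 ≤ (2 * L) ^ (k + 1) / (L / 2) ^ 4 := by gcongr
        _ = _ := by rw [mul_pow, div_pow, show k + 5 = k + 1 + 4 by ring, pow_add 2 (k + 1) 4]
                    field_simp
    rw [hH]
    calc C * m * (B * Real.log m ^ 2 + Real.log m ^ (k + 1) / Real.log m ^ 4)
        ≤ C * (2 * x) * (B * (2 ^ (k + 5) * L ^ 2) + 2 ^ (k + 5) * (L ^ (k + 1) / L ^ 4)) := by
          gcongr
      _ = _ := by ring
  rcases lt_or_ge Z A with hZA | hZA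
  · rw [Finset.Icc_eq_empty (by omega), Finset.sum_empty, norm_zero]
    positivity
  have hIco : Finset.Icc A Z = Finset.Ico A (Z + 1) := by
    ext n; simp only [Finset.mem_Icc, Finset.mem_Ico]; omega
  set w : ℕ → ℝ := fun i => (Real.log ((A + i : ℕ) : ℝ) ^ (k + 1))⁻¹ with hw
  have hlogpos : ∀ i : ℕ, 0 < Real.log ((A + i : ℕ) : ℝ) := fun i =>
    Real.log_pos (by exact_mod_cast (by omega : 1 < A + i))
  have hanti : Antitone w := by
    intro i j hij
    refine inv_anti₀ (pow_pos (hlogpos i) _) (pow_le_pow_left₀ (hlogpos i).le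
      (Real.log_le_log ?_ ?_) _)
    · exact_mod_cast (by omega : 0 < A + i)
    · exact_mod_cast (by omega : A + i ≤ A + j)
  have hsum : ∑ n ∈ Finset.Icc A Z, a n * (((Real.log n)⁻¹ : ℝ) : ℂ) =
      ∑ i ∈ Finset.range (Z + 1 - A), c (A + i) * (w i : ℂ) := by
    rw [hIco, Finset.sum_Ico_eq_sum_range]
    refine Finset.sum_congr rfl fun i _ => ?_
    have : ((Real.log ((A + i : ℕ) : ℝ) : ℝ) : ℂ) ≠ 0 := by exact_mod_cast (hlogpos i).ne'
    simp only [hc, hw]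
    rw [Complex.ofReal_inv, Complex.ofReal_inv, Complex.ofReal_pow]
    field_simp
    ring
  rw [hsum]
  have hAbel := norm_sum_mul_antitone_le (c := fun i => c (A + i)) (G := 2 * H) hanti
    (fun n => (inv_pos.2 (pow_pos (hlogpos n) _)).le) (Z + 1 - A) (by
      intro m hm
      have e : ∑ i ∈ Finset.range m, c (A + i) =
          ∑ n ∈ Finset.Icc 1 (A + m - 1), c n - ∑ n ∈ Finset.Icc 1 (A - 1), c n := by
        have h1 : ∀ j, 1 ≤ j → Finset.Icc 1 (j - 1) = Finset.Ico 1 j := by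
          intro j hj
          ext n; simp only [Finset.mem_Icc, Finset.mem_Ico]; omega
        rw [h1 _ (by omega), h1 _ (by omega), ← Finset.sum_Ico_consecutive c (show 1 ≤ A by omega)
          (show A ≤ A + m by omega), Finset.sum_Ico_eq_sum_range _ A,
          show A + m - A = m by omega]
        ring
      rw [e]
      refine (norm_sub_le _ _).trans ?_
      have := hpart (A + m - 1) (by omega) (by omega)
      have := hpart (A - 1) le_rfl (by omega)
      linarith)
  refine hAbel.trans ?_
  have hH0 : 0 ≤ H := by rw [hH]; positivity
  have hw0 : w 0 ≤ (L ^ (k + 1))⁻¹ := by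
    refine inv_anti₀ (by positivity) (pow_le_pow_left₀ (by linarith) ?_ _)
    exact Real.log_le_log hx0 (by simpa using hxA)
  calc 2 * H * w 0 ≤ 2 * H * (L ^ (k + 1))⁻¹ := by gcongr
    _ = _ := by rw [hH]; field_simp; ring

end Abel

section Kappa

theorem cube_mul_cosh_le_sinh_cube {z : ℝ} (hz : 0 ≤ z) : z ^ 3 * Real.cosh z ≤ Real.sinh z ^ 3 := by
  have hd : ∀ x : ℝ, HasDerivAt (fun x => Real.sinh x * Real.cosh x ^ (-(1 / 3) : ℝ) - x)
      (Real.cosh x * Real.cosh x ^ (-(1 / 3) : ℝ) +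
        Real.sinh x * (Real.sinh x * (-(1 / 3)) * Real.cosh x ^ (-(1 / 3) - 1 : ℝ)) - 1) x := by
    intro x
    exact ((Real.hasDerivAt_sinh x).mul ((Real.hasDerivAt_cosh x).rpow_const
      (Or.inl (Real.cosh_pos x).ne'))).sub (hasDerivAt_id x)
  have hmono : MonotoneOn (fun x => Real.sinh x * Real.cosh x ^ (-(1 / 3) : ℝ) - x) (Ici 0) := by
    refine monotoneOn_of_deriv_nonneg (convex_Ici 0)
      (fun x _ => (hd x).continuousAt.continuousWithinAt)
      (fun x _ => (hd x).differentiableAt.differentiableWithinAt) fun x _ => ?_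
    rw [(hd x).deriv]
    have hc : 0 < Real.cosh x := Real.cosh_pos x
    set v := Real.cosh x ^ (2 / 3 : ℝ) with hv
    have hv0 : 0 < v := Real.rpow_pos_of_pos hc _
    have e1 : Real.cosh x * Real.cosh x ^ (-(1 / 3) : ℝ) = v := by
      rw [hv, ← Real.rpow_one_add' hc.le (by norm_num)]; norm_num
    have e2 : Real.cosh x ^ (-(1 / 3) - 1 : ℝ) = (v ^ 2)⁻¹ := by
      rw [hv, ← Real.rpow_natCast, ← Real.rpow_mul hc.le, ← Real.rpow_neg hc.le]; norm_num
    have e3 : Real.cosh x ^ 2 = v ^ 3 := by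
      rw [hv, ← Real.rpow_natCast, ← Real.rpow_natCast, ← Real.rpow_mul hc.le]; norm_num
    have e4 : Real.sinh x ^ 2 = v ^ 3 - 1 := by rw [← e3, Real.sinh_sq]
    have e5 : v + Real.sinh x * (Real.sinh x * (-(1 / 3)) * (v ^ 2)⁻¹) - 1 =
        (2 * v + 1) * (v - 1) ^ 2 / (3 * v ^ 2) := by
      have : Real.sinh x * (Real.sinh x * (-(1 / 3)) * (v ^ 2)⁻¹) =
          -(1 / 3) * (v ^ 3 - 1) * (v ^ 2)⁻¹ := by rw [← e4]; ring
      rw [this]; field_simp; ring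
    rw [e1, e2, e5]
    positivity
  have h0 := hmono (mem_Ici.2 le_rfl) (mem_Ici.2 hz) hz
  simp only [Real.sinh_zero, zero_mul, sub_zero] at h0
  have hc : 0 < Real.cosh z := Real.cosh_pos z
  have h1 : z ≤ Real.sinh z * Real.cosh z ^ (-(1 / 3) : ℝ) := by linarith
  have h2 := pow_le_pow_left₀ hz h1 3
  rw [mul_pow, ← Real.rpow_natCast (Real.cosh z ^ (-(1 / 3) : ℝ)), ← Real.rpow_mul hc.le,
    show (-(1 / 3) * ((3 : ℕ) : ℝ) : ℝ) = -1 by norm_num, Real.rpow_neg_one] at h2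
  calc z ^ 3 * Real.cosh z ≤ Real.sinh z ^ 3 * (Real.cosh z)⁻¹ * Real.cosh z := by gcongr
    _ = _ := by field_simp

/-- The difference between `1 / y` and the Bose kernel. -/
noncomputable def kappa (y : ℝ) : ℝ := 1 / y - 1 / (Real.exp y - 1)

theorem exp_sub_one_pos {y : ℝ} (hy : 0 < y) : 0 < Real.exp y - 1 := by
  linarith [Real.add_one_lt_exp hy.ne']

theorem kappa_nonneg {y : ℝ} (hy : 0 < y) : 0 ≤ kappa y := by
  rw [kappa, sub_nonneg]
  exact one_div_le_one_div_of_le hy (by linarith [Real.add_one_le_exp y])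

theorem kappa_le_inv {y : ℝ} (hy : 0 < y) : kappa y ≤ 1 / y := by
  have := exp_sub_one_pos hy
  rw [kappa]
  have : 0 < 1 / (Real.exp y - 1) := by positivity
  linarith

theorem kappa_le_half {y : ℝ} (hy : 0 < y) : kappa y ≤ 1 / 2 := by
  have hd : ∀ x : ℝ, HasDerivAt (fun x => 2 + x - Real.exp x * (2 - x))
      (1 - (Real.exp x * (2 - x) + Real.exp x * (-1))) x := by
    intro x
    exact ((hasDerivAt_id x).const_add 2).sub
      ((Real.hasDerivAt_exp x).mul ((hasDerivAt_id x).const_sub 2))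
  have hmono : Monotone (fun x : ℝ => 2 + x - Real.exp x * (2 - x)) := by
    refine monotone_of_deriv_nonneg (fun x => (hd x).differentiableAt) fun x => ?_
    rw [(hd x).deriv]
    have h1 := Real.add_one_le_exp (-x)
    have h2 : Real.exp x * Real.exp (-x) = 1 := by rw [← Real.exp_add]; simp
    nlinarith [Real.exp_pos x]
  have h0 := hmono hy.le
  simp only [add_zero, Real.exp_zero, sub_zero, one_mul, sub_self] at h0
  have hE := exp_sub_one_pos hy
  rw [kappa, div_sub_div _ _ hy.ne' hE.ne', div_le_div_iff₀ (by positivity) (by norm_num)]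
  linarith

theorem half_sub_le_kappa {y : ℝ} (hy : 0 < y) : 1 / 2 - y / 4 ≤ kappa y := by
  have h1 := Real.quadratic_le_exp_of_nonneg hy.le
  have hE := exp_sub_one_pos hy
  have h2 : 1 / (Real.exp y - 1) ≤ 1 / (y + y ^ 2 / 2) :=
    one_div_le_one_div_of_le (by positivity) (by linarith)
  have h3 : 1 / 2 - y / 4 ≤ 1 / y - 1 / (y + y ^ 2 / 2) := by
    have : 1 / y - 1 / (y + y ^ 2 / 2) = 1 / (2 + y) := by field_simp; ring
    rw [this, le_div_iff₀ (by positivity)]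
    nlinarith [sq_nonneg y]
  rw [kappa]; linarith

theorem hasDerivAt_kappa {x : ℝ} (hx : 0 < x) :
    HasDerivAt kappa (-1 / x ^ 2 + Real.exp x / (Real.exp x - 1) ^ 2) x := by
  have hE := (exp_sub_one_pos hx).ne'
  have h1 := (hasDerivAt_inv hx.ne').sub (((Real.hasDerivAt_exp x).sub_const 1).inv hE)
  have h2 : kappa = (fun y : ℝ => y⁻¹) - (fun y => Real.exp y - 1)⁻¹ := by
    funext y; simp [kappa]
  rw [h2]
  refine h1.congr_deriv ?_
  ring

theorem antitoneOn_kappa : AntitoneOn kappa (Ioi 0) := by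
  refine antitoneOn_of_deriv_nonpos (convex_Ioi 0)
    (fun x hx => (hasDerivAt_kappa hx).continuousAt.continuousWithinAt) ?_ ?_
  · rw [interior_Ioi]; exact fun x hx => (hasDerivAt_kappa hx).differentiableAt.differentiableWithinAt
  · rw [interior_Ioi]
    intro x hx
    have hx : 0 < x := hx
    have hE := exp_sub_one_pos hx
    have h := Real.self_le_sinh_iff.2 (by positivity : 0 ≤ x / 2)
    have e0 : Real.exp x = Real.exp (x / 2) ^ 2 := by rw [← Real.exp_nat_mul]; congr 1; push_cast; ring
    have e1 : Real.exp (x / 2) * Real.exp (-(x / 2)) = 1 := by rw [← Real.exp_add]; simp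
    have h2 : Real.exp x / (Real.exp x - 1) ^ 2 ≤ 1 / x ^ 2 := by
      rw [div_le_div_iff₀ (by positivity) (by positivity)]
      rw [Real.sinh_eq] at h
      rw [e0]
      set u := Real.exp (x / 2)
      set v := Real.exp (-(x / 2))
      have a2 : u ^ 2 - 1 = u * (u - v) := by rw [← e1]; ring
      rw [a2, one_mul, mul_pow]
      gcongr
      linarith
    rw [(hasDerivAt_kappa hx).deriv, neg_div]
    linarith

theorem convexOn_kappa : ConvexOn ℝ (Ioi 0) kappa := by
  have hd : ∀ x ∈ Ioi (0 : ℝ), HasDerivAt kappa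
      (-1 / x ^ 2 + Real.exp x / (Real.exp x - 1) ^ 2) x := fun x hx => hasDerivAt_kappa hx
  have hd2 : ∀ x ∈ Ioi (0 : ℝ), HasDerivAt
      (fun x => -1 / x ^ 2 + Real.exp x / (Real.exp x - 1) ^ 2)
      (2 / x ^ 3 - Real.exp x * (Real.exp x + 1) / (Real.exp x - 1) ^ 3) x := by
    intro x hx
    have hx : 0 < x := hx
    have hE := (exp_sub_one_pos hx).ne'
    have h1 := ((hasDerivAt_const x (-1 : ℝ)).div (hasDerivAt_pow 2 x) (pow_ne_zero 2 hx.ne')).add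
      ((Real.hasDerivAt_exp x).div (((Real.hasDerivAt_exp x).sub_const 1).pow 2)
        (pow_ne_zero 2 hE))
    refine h1.congr_deriv ?_
    simp only [Pi.pow_apply]
    push_cast
    field_simp
    ring
  refine convexOn_of_hasDerivWithinAt2_nonneg (convex_Ioi 0)
    (fun x hx => (hd x hx).continuousAt.continuousWithinAt)
    (f' := fun x => -1 / x ^ 2 + Real.exp x / (Real.exp x - 1) ^ 2)
    (f'' := fun x => 2 / x ^ 3 - Real.exp x * (Real.exp x + 1) / (Real.exp x - 1) ^ 3)
    ?_ ?_ ?_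
  · rw [interior_Ioi]; exact fun x hx => (hd x hx).hasDerivWithinAt
  · rw [interior_Ioi]; exact fun x hx => (hd2 x hx).hasDerivWithinAt
  · rw [interior_Ioi]
    intro x hx
    have hx : 0 < x := hx
    have hE := exp_sub_one_pos hx
    rw [sub_nonneg, div_le_div_iff₀ (by positivity) (by positivity)]
    have h := cube_mul_cosh_le_sinh_cube (z := x / 2) (by positivity)
    have e0 : Real.exp x = Real.exp (x / 2) ^ 2 := by rw [← Real.exp_nat_mul]; congr 1; push_cast; ring
    have e1 : Real.exp (x / 2) * Real.exp (-(x / 2)) = 1 := by rw [← Real.exp_add]; simp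
    rw [Real.cosh_eq, Real.sinh_eq] at h
    rw [e0]
    set u := Real.exp (x / 2)
    set v := Real.exp (-(x / 2))
    have hu : 0 < u := Real.exp_pos _
    have a1 : u ^ 2 + 1 = u * (u + v) := by rw [← e1]; ring
    have a2 : u ^ 2 - 1 = u * (u - v) := by rw [← e1]; ring
    rw [a1, a2]
    have h' : x ^ 3 * (u + v) ≤ 2 * (u - v) ^ 3 := by nlinarith
    calc u ^ 2 * (u * (u + v)) * x ^ 3 = u ^ 3 * (x ^ 3 * (u + v)) := by ring
      _ ≤ u ^ 3 * (2 * (u - v) ^ 3) := by gcongr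
      _ = _ := by ring

end Kappa

section LOne

theorem kappa_second_diff {h : ℝ} (hh : 0 < h) (i : ℕ) :
    kappa ((i + 1 + 1) * h) - kappa ((i + 1 + 1 + 1) * h) ≤
      kappa ((i + 1) * h) - kappa ((i + 1 + 1) * h) := by
  have h1 := convexOn_kappa.2 (mem_Ioi.2 (by positivity : 0 < ((i : ℝ) + 1) * h))
    (mem_Ioi.2 (by positivity : 0 < ((i : ℝ) + 1 + 1 + 1) * h)) (by norm_num : (0 : ℝ) ≤ 1 / 2)
    (by norm_num : (0 : ℝ) ≤ 1 / 2) (by norm_num)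
  simp only [smul_eq_mul] at h1
  rw [show 1 / 2 * ((i + 1) * h) + 1 / 2 * ((i + 1 + 1 + 1) * h) = (i + 1 + 1) * h by ring] at h1
  linarith

variable {N : ℕ} [NeZero N]

theorem exists_norm_sum_char_kappa_le {χ : DirichletCharacter ℂ N} (hχ : χ ≠ 1) :
    ∃ m : ℂ, ∀ h : ℝ, 0 < h → ∀ A : ℕ,
      ‖∑ j ∈ Finset.range A, χ ((j + 1 : ℕ)) * (kappa ((j + 1) * h) : ℂ) - m / 2‖ ≤
        2 * N / ((A + 1) * h) + N * h / 4 + N ^ 2 * h := by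
  have hN : 0 < N := Nat.pos_of_ne_zero (NeZero.ne N)
  have hN0 : (0 : ℝ) < N := by exact_mod_cast hN
  set c : ℕ → ℂ := fun j => χ ((j + 1 : ℕ)) with hc
  have hcp : ∀ n, c (n + N) = c n := by intro n; simp [hc]
  have hz : ∑ n ∈ Finset.range N, c n = 0 := by
    have h1 : ∑ n ∈ Finset.range N, χ (n : ℕ) = 0 := by
      rw [sum_range_char, MulChar.sum_eq_zero_of_ne_one hχ]
    have h2 := Finset.sum_range_succ (fun n : ℕ => χ (n : ZMod N)) N
    rw [Finset.sum_range_succ', h1] at h2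
    simpa [hc] using h2
  have hc1 : ∀ n, ‖c n‖ ≤ 1 := fun n => χ.norm_le_one _
  have hS : ∀ M, ‖∑ n ∈ Finset.range M, c n‖ ≤ N := by
    intro M
    have := norm_sum_range_periodic_le hN hcp hz hc1 M
    rwa [one_mul] at this
  set S : ℕ → ℂ := fun i => ∑ j ∈ Finset.range (i + 1), c j with hSdef
  have hSp : ∀ n, S (n + N) = S n := by
    intro n
    have := sum_range_periodic hcp hz 1 (n + 1)
    simp only [hSdef]
    rw [← this]; congr 2; ring
  set m : ℂ := (∑ n ∈ Finset.range N, S n) / N with hm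
  have hNc : (N : ℂ) ≠ 0 := by exact_mod_cast hN.ne'
  have hm1 : ‖m‖ ≤ N := by
    rw [hm, norm_div, Complex.norm_natCast, div_le_iff₀ hN0]
    refine (norm_sum_le_of_le _ fun n _ => hS (n + 1)).trans ?_
    simp
  have hT : ∀ M, ‖∑ n ∈ Finset.range M, (S n - m)‖ ≤ 2 * N * N := by
    intro M
    refine norm_sum_range_periodic_le hN (fun n => by rw [hSp]) ?_ (fun n => ?_) M
    · rw [Finset.sum_sub_distrib, Finset.sum_const, Finset.card_range, hm, nsmul_eq_mul]
      field_simp; ring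
    · have := norm_sub_le (S n) m
      have := hS (n + 1)
      simp only [hSdef] at *
      linarith
  refine ⟨m, fun h hh A => ?_⟩
  set w : ℕ → ℝ := fun i => kappa ((i + 1) * h) with hw
  have hpos : ∀ i : ℕ, 0 < ((i : ℝ) + 1) * h := fun i => by positivity
  have hanti : Antitone fun i => w i - w (i + 1) := by
    refine antitone_nat_of_succ_le fun i => ?_
    have := kappa_second_diff hh i
    simp only [hw]; push_cast; exact this
  have hnn : ∀ i, 0 ≤ w i - w (i + 1) := by
    intro i
    rw [sub_nonneg]
    refine antitoneOn_kappa (mem_Ioi.2 (hpos i)) (mem_Ioi.2 (hpos (i + 1))) ?_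
    push_cast; nlinarith
  have habel := norm_sum_mul_antitone_le hanti hnn A (fun M _ => hT M)
  rw [zero_add] at habel
  have heq : ∑ j ∈ Finset.range A, χ ((j + 1 : ℕ)) * (kappa ((j + 1) * h) : ℂ) - m / 2 =
      w A * ∑ j ∈ Finset.range A, c j + m * (((w 0 - 1 / 2 : ℝ)) : ℂ) - m * w A +
        ∑ i ∈ Finset.range A, (S i - m) * ((w i - w (i + 1) : ℝ) : ℂ) := by
    have h1 := sum_range_mul_by_parts c (fun i => (w i : ℂ)) A
    have h2 : ∑ i ∈ Finset.range A, (S i - m) * ((w i - w (i + 1) : ℝ) : ℂ) =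
        ∑ i ∈ Finset.range A, ((w i : ℂ) - w (i + 1)) * S i - m * (w 0 - w A) := by
      rw [← Finset.sum_range_sub' (fun i => (w i : ℂ)), Finset.mul_sum, ← Finset.sum_sub_distrib]
      refine Finset.sum_congr rfl fun i _ => ?_
      push_cast; ring
    rw [h2]
    change ∑ j ∈ Finset.range A, c j * (w j : ℂ) - m / 2 = _
    rw [h1]
    push_cast; ring
  have hwA : 0 ≤ w A := kappa_nonneg (hpos A)
  have hwA' : w A ≤ 1 / ((A + 1) * h) := kappa_le_inv (hpos A)
  have hw0 : w 0 ≤ 1 / 2 := kappa_le_half (hpos 0)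
  have hw0' : 1 / 2 - h / 4 ≤ w 0 := by
    have := half_sub_le_kappa (hpos 0)
    simpa [hw] using this
  have hw1' : 1 / 2 - h / 2 ≤ w 1 := by
    have := half_sub_le_kappa (hpos 1)
    simp only [hw]
    refine le_trans (le_of_eq ?_) this
    push_cast; ring
  rw [heq]
  refine (norm_add_le_of_le (norm_sub_le_of_le (norm_add_le_of_le
    (r₁ := 1 / ((A + 1) * h) * N) (r₂ := N * (h / 4)) ?_ ?_) (r₂ := N * (1 / ((A + 1) * h))) ?_)
    habel).trans ?_
  · rw [norm_mul, Complex.norm_real, Real.norm_of_nonneg hwA]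
    gcongr
    exact hS A
  · rw [norm_mul, Complex.norm_real]
    gcongr
    rw [Real.norm_eq_abs, abs_le]; constructor <;> linarith
  · rw [norm_mul, Complex.norm_real, Real.norm_of_nonneg hwA]
    gcongr
  · have h3 : 2 * N * N * (w 0 - w 1) ≤ 2 * N * N * (h / 2) := by gcongr; linarith
    have h4 : 2 * N / ((A + 1) * h) = 1 / ((A + 1) * h) * N + N * (1 / ((A + 1) * h)) := by ring
    rw [h4]
    nlinarith

theorem norm_sum_char_div_sub_le {χ : DirichletCharacter ℂ N} (hχ : χ ≠ 1) {X : ℕ} (hX : 1 ≤ X) :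
    ‖∑ n ∈ Finset.Icc 1 X, χ n * (n : ℂ)⁻¹ - contL χ 1‖ ≤ 8 * N / X := by
  have hX1 : (1 : ℝ) ≤ X := by exact_mod_cast hX
  have h0 := charMean_eq_zero hχ
  have h1 := regPart_eq χ hX1 (s := 1) (by simp)
  rw [h0, zero_mul, sub_zero, Nat.floor_natCast] at h1
  simp only [Complex.cpow_neg_one, one_mul] at h1
  have h2 := norm_integral_charErr_le χ hX1 (s := 1) (by simp)
  have h3 := norm_charErr_le χ (u := (X : ℝ)) (by positivity)
  rw [contL, h0, zero_mul, zero_div, zero_add, h1]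
  rw [Complex.one_re, Real.rpow_neg_one, div_one] at h2
  have h4 : ∀ a b c : ℂ, a - (a - b + c) = b - c := by intros; ring
  rw [h4]
  refine (norm_sub_le_of_le ?_ h2).trans (b := 4 * N * (X : ℝ)⁻¹ + 4 * N * (X : ℝ)⁻¹) ?_
  · rw [norm_mul, norm_inv, Complex.norm_real, Real.norm_of_nonneg (by positivity)]
    gcongr
  · apply le_of_eq; ring

end LOne

section LOne

theorem sum_sum_divisors (X : ℕ) (F : ℕ → ℕ → ℂ) :
    ∑ n ∈ Finset.Icc 1 X, ∑ d ∈ n.divisors, F d n =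
      ∑ d ∈ Finset.Icc 1 X, ∑ b ∈ Finset.Icc 1 (X / d), F d (d * b) := by
  rw [Finset.sum_sigma', Finset.sum_sigma']
  refine Finset.sum_bij' (fun p _ => ⟨p.2, p.1 / p.2⟩) (fun q _ => ⟨q.1 * q.2, q.1⟩) ?_ ?_ ?_ ?_ ?_
  · rintro ⟨n, d⟩ h
    simp only [Finset.mem_sigma, Finset.mem_Icc, Nat.mem_divisors] at h ⊢
    obtain ⟨⟨h1, h2⟩, h3, h4⟩ := h
    have hd := Nat.pos_of_dvd_of_pos h3 h1
    exact ⟨⟨hd, (Nat.le_of_dvd h1 h3).trans h2⟩, Nat.div_pos (Nat.le_of_dvd h1 h3) hd,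
      Nat.div_le_div_right h2⟩
  · rintro ⟨d, b⟩ h
    simp only [Finset.mem_sigma, Finset.mem_Icc, Nat.mem_divisors] at h ⊢
    obtain ⟨⟨h1, h2⟩, h3, h4⟩ := h
    have h5 := (Nat.le_div_iff_mul_le h1).1 h4
    exact ⟨⟨Nat.mul_pos h1 h3, by rwa [mul_comm]⟩, dvd_mul_right _ _, (Nat.mul_pos h1 h3).ne'⟩
  · rintro ⟨n, d⟩ h
    simp only [Finset.mem_sigma, Finset.mem_Icc, Nat.mem_divisors] at h ⊢
    rw [Nat.mul_div_cancel' h.2.1]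
  · rintro ⟨d, b⟩ h
    simp only [Finset.mem_sigma, Finset.mem_Icc] at h ⊢
    rw [Nat.mul_div_cancel_left _ h.1.1]
  · rintro ⟨n, d⟩ h
    simp only [Finset.mem_sigma, Finset.mem_Icc, Nat.mem_divisors] at h ⊢
    rw [Nat.mul_div_cancel' h.2.1]

theorem sum_exp_neg_mul {y : ℝ} (hy : 0 < y) (m : ℕ) :
    ∑ b ∈ Finset.Icc 1 m, Real.exp (-(y * b)) =
      1 / (Real.exp y - 1) - Real.exp (-(y * (m + 1))) / (1 - Real.exp (-y)) := by
  have hE := exp_sub_one_pos hy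
  have h1 : Real.exp y * Real.exp (-y) = 1 := by rw [← Real.exp_add]; simp
  have h2 : 0 < 1 - Real.exp (-y) := by
    rw [sub_pos, Real.exp_lt_one_iff]; linarith
  have e1 : 1 / (Real.exp y - 1) = Real.exp (-y) / (1 - Real.exp (-y)) := by
    rw [div_eq_div_iff hE.ne' h2.ne']; linear_combination -h1
  rw [e1]
  induction m with
  | zero => simp
  | succ m ih =>
    rw [Finset.sum_Icc_succ_top (by omega), ih]
    have e2 : Real.exp (-(y * (((m + 1 : ℕ) : ℝ) + 1))) =
        Real.exp (-(y * ((m + 1 : ℕ) : ℝ))) * Real.exp (-y) := by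
      rw [← Real.exp_add]; congr 1; ring
    rw [e2]
    push_cast
    field_simp
    ring

/-- The smooth nonnegative weight `e ^ (-u) - e ^ (-2 * u)`. -/
noncomputable def expWeight (u : ℝ) : ℝ := Real.exp (-u) - Real.exp (-(2 * u))

theorem expWeight_nonneg {u : ℝ} (hu : 0 ≤ u) : 0 ≤ expWeight u := by
  rw [expWeight, sub_nonneg]; exact Real.exp_le_exp.2 (by linarith)

theorem abs_sum_expWeight_sub_le {y : ℝ} (hy : 0 < y) (m : ℕ) :
    |∑ b ∈ Finset.Icc 1 m, expWeight (y * b) -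
      (1 / (Real.exp y - 1) - 1 / (Real.exp (2 * y) - 1))| ≤
      Real.exp (-(y * (m + 1))) / (1 - Real.exp (-y)) := by
  have h1 := sum_exp_neg_mul hy m
  have h2 := sum_exp_neg_mul (y := 2 * y) (by positivity) m
  have h0 : ∑ b ∈ Finset.Icc 1 m, expWeight (y * b) =
      ∑ b ∈ Finset.Icc 1 m, Real.exp (-(y * b)) - ∑ b ∈ Finset.Icc 1 m, Real.exp (-(2 * y * b)) := by
    rw [← Finset.sum_sub_distrib]
    refine Finset.sum_congr rfl fun b _ => ?_
    rw [expWeight, mul_assoc]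
  have h3 : 0 < 1 - Real.exp (-y) := by
    rw [sub_pos, Real.exp_lt_one_iff]; linarith
  have h4 : 1 - Real.exp (-y) ≤ 1 - Real.exp (-(2 * y)) := by
    have : Real.exp (-(2 * y)) ≤ Real.exp (-y) := Real.exp_le_exp.2 (by linarith)
    linarith
  have h5 : Real.exp (-(2 * y * (m + 1))) / (1 - Real.exp (-(2 * y))) ≤
      Real.exp (-(y * (m + 1))) / (1 - Real.exp (-y)) := by
    gcongr
    have : 0 ≤ y * m := by positivity
    nlinarith
  have h6 : 0 ≤ Real.exp (-(2 * y * (m + 1))) / (1 - Real.exp (-(2 * y))) :=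
    div_nonneg (Real.exp_pos _).le (h3.le.trans h4)
  rw [h0, h1, h2, abs_le]
  constructor <;> linarith

variable {N : ℕ} [NeZero N]

theorem norm_sum_zetaMul_expWeight_le {χ : DirichletCharacter ℂ N} (hχ : χ ≠ 1) {h : ℝ} (hh : 0 < h)
    {X : ℕ} (hX : 1 ≤ X) :
    ‖∑ n ∈ Finset.Icc 1 X, χ.zetaMul n * (expWeight (n * h) : ℂ)‖ ≤
      ‖contL χ 1‖ / (2 * h) + 4 * N ^ 2 * h + (8 * N / h) / X +
        X * (Real.exp (-(h * X)) / (1 - Real.exp (-h))) := by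
  have hX0 : (0 : ℝ) < X := by exact_mod_cast hX
  have hN1 : (1 : ℝ) ≤ N := by exact_mod_cast Nat.pos_of_ne_zero (NeZero.ne N)
  have h1h : 0 < 1 - Real.exp (-h) := by
    rw [sub_pos, Real.exp_lt_one_iff]; linarith
  set G : ℝ → ℝ := fun y => 1 / (Real.exp y - 1) - 1 / (Real.exp (2 * y) - 1) with hG
  have hre : ∑ n ∈ Finset.Icc 1 X, χ.zetaMul n * (expWeight (n * h) : ℂ) =
      ∑ a ∈ Finset.Icc 1 X, χ a * ((∑ b ∈ Finset.Icc 1 (X / a), expWeight (a * h * b) : ℝ) : ℂ) := by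
    have e1 : ∑ n ∈ Finset.Icc 1 X, χ.zetaMul n * (expWeight (n * h) : ℂ) =
        ∑ n ∈ Finset.Icc 1 X, ∑ d ∈ n.divisors, χ d * (expWeight (n * h) : ℂ) := by
      refine Finset.sum_congr rfl fun n hn => ?_
      rw [← Finset.sum_mul, DirichletCharacter.zetaMul, ArithmeticFunction.coe_zeta_mul_apply]
      congr 1
      refine Finset.sum_congr rfl fun d hd => ?_
      have : d ≠ 0 := (Nat.pos_of_mem_divisors hd).ne'
      simp [toArithmeticFunction, this]
    rw [e1, sum_sum_divisors X fun d n => χ d * (expWeight (n * h) : ℂ)]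
    refine Finset.sum_congr rfl fun a _ => ?_
    rw [← Finset.mul_sum]
    push_cast
    congr 1
    refine Finset.sum_congr rfl fun b _ => ?_
    congr 2; ring
  have hdiff : ‖∑ n ∈ Finset.Icc 1 X, χ.zetaMul n * (expWeight (n * h) : ℂ) -
      ∑ a ∈ Finset.Icc 1 X, χ a * (G (a * h) : ℂ)‖ ≤
      X * (Real.exp (-(h * X)) / (1 - Real.exp (-h))) := by
    rw [hre, ← Finset.sum_sub_distrib]
    have : ∀ a ∈ Finset.Icc 1 X,
        ‖χ a * ((∑ b ∈ Finset.Icc 1 (X / a), expWeight (a * h * b) : ℝ) : ℂ) - χ a * (G (a * h) : ℂ)‖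
        ≤ Real.exp (-(h * X)) / (1 - Real.exp (-h)) := by
      intro a ha
      obtain ⟨ha1, ha2⟩ := Finset.mem_Icc.1 ha
      have ha0 : (1 : ℝ) ≤ a := by exact_mod_cast ha1
      rw [← mul_sub, ← Complex.ofReal_sub, norm_mul, Complex.norm_real, Real.norm_eq_abs]
      have h2 := abs_sum_expWeight_sub_le (y := a * h) (by positivity) (X / a)
      have h3 : Real.exp (-(a * h * ((X / a : ℕ) + 1))) / (1 - Real.exp (-(a * h))) ≤
          Real.exp (-(h * X)) / (1 - Real.exp (-h)) := by
        have h4 : (X : ℝ) ≤ a * ((X / a : ℕ) + 1) := by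
          have := Nat.lt_mul_div_succ X ha1
          exact_mod_cast this.le
        have h5 : h ≤ a * h := by nlinarith
        have h6 : h * X ≤ a * h * ((X / a : ℕ) + 1) := by nlinarith
        refine div_le_div₀ (Real.exp_pos _).le (Real.exp_le_exp.2 (neg_le_neg h6)) h1h ?_
        have := Real.exp_le_exp.2 (neg_le_neg h5)
        linarith
      calc ‖χ a‖ * _ ≤ 1 * _ := by gcongr; exact χ.norm_le_one _
        _ ≤ _ := by rw [one_mul]; exact h2.trans h3
    refine (norm_sum_le_of_le _ this).trans ?_
    simp
  obtain ⟨m, hm⟩ := exists_norm_sum_char_kappa_le hχ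
  have hshift : ∀ F : ℕ → ℂ, ∑ a ∈ Finset.Icc 1 X, F a = ∑ j ∈ Finset.range X, F (j + 1) := by
    intro F
    rw [Finset.range_eq_Ico, Finset.sum_Ico_add' F 0 X 1]
    rfl
  have hK1 := hm h hh X
  have hK2 := hm (2 * h) (by positivity) X
  set K1 := ∑ j ∈ Finset.range X, χ ((j + 1 : ℕ)) * (kappa ((j + 1) * h) : ℂ)
  set K2 := ∑ j ∈ Finset.range X, χ ((j + 1 : ℕ)) * (kappa ((j + 1) * (2 * h)) : ℂ)
  have hmain : ∑ a ∈ Finset.Icc 1 X, χ a * (G (a * h) : ℂ) =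
      (1 / (2 * h) : ℝ) * ∑ n ∈ Finset.Icc 1 X, χ n * (n : ℂ)⁻¹ - (K1 - K2) := by
    rw [hshift, hshift, Finset.mul_sum, ← Finset.sum_sub_distrib, ← Finset.sum_sub_distrib]
    refine Finset.sum_congr rfl fun j _ => ?_
    have hj : (0 : ℝ) < j + 1 := by positivity
    have : G ((j + 1 : ℕ) * h) = 1 / (2 * h) * ((j + 1 : ℕ) : ℝ)⁻¹ -
        (kappa ((j + 1) * h) - kappa ((j + 1) * (2 * h))) := by
      simp only [hG, kappa]
      push_cast
      rw [show 2 * (((j : ℝ) + 1) * h) = (j + 1) * (2 * h) by ring]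
      have : 1 / (2 * h) * ((j : ℝ) + 1)⁻¹ = 1 / ((j + 1) * h) - 1 / ((j + 1) * (2 * h)) := by
        field_simp; norm_num
      rw [this]; ring
    rw [this]
    push_cast; ring
  have hV := norm_sum_char_div_sub_le hχ hX
  set V := ∑ n ∈ Finset.Icc 1 X, χ n * (n : ℂ)⁻¹
  have hV2 : ‖V‖ ≤ ‖contL χ 1‖ + 8 * N / X := by
    have := norm_add_le (V - contL χ 1) (contL χ 1)
    rw [sub_add_cancel] at this; linarith
  have hK : ‖K1 - K2‖ ≤ 4 * N / h / X + 4 * N ^ 2 * h := by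
    have e : K1 - K2 = (K1 - m / 2) - (K2 - m / 2) := by ring
    rw [e]
    refine (norm_sub_le_of_le hK1 hK2).trans ?_
    have b1 : 2 * N / ((X + 1) * h) ≤ 2 * N / h / X := by
      rw [div_div]; exact div_le_div_of_nonneg_left (by positivity) (by positivity) (by nlinarith)
    have b2 : 2 * N / ((X + 1) * (2 * h)) ≤ 2 * N / h / X := by
      rw [div_div]; exact div_le_div_of_nonneg_left (by positivity) (by positivity) (by nlinarith)
    have b3 : (N : ℝ) * h ≤ N ^ 2 * h := by gcongr; nlinarith
    have b4 : 4 * N / h / X = 2 * N / h / X + 2 * N / h / X := by ring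
    rw [b4]
    nlinarith
  have hfin : ‖∑ a ∈ Finset.Icc 1 X, χ a * (G (a * h) : ℂ)‖ ≤
      1 / (2 * h) * (‖contL χ 1‖ + 8 * N / X) + (4 * N / h / X + 4 * N ^ 2 * h) := by
    rw [hmain]
    refine norm_sub_le_of_le ?_ hK
    rw [norm_mul, Complex.norm_real, Real.norm_of_nonneg (by positivity)]
    gcongr
  set W := ∑ n ∈ Finset.Icc 1 X, χ.zetaMul n * (expWeight (n * h) : ℂ)
  set W' := ∑ a ∈ Finset.Icc 1 X, χ a * (G (a * h) : ℂ)
  have h9 : ‖W‖ ≤ ‖W - W'‖ + ‖W'‖ := by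
    have := norm_add_le (W - W') W'
    rwa [sub_add_cancel] at this
  refine h9.trans ((add_le_add hdiff hfin).trans (le_of_eq ?_))
  field_simp
  ring

end LOne

section LOneLower

variable {N : ℕ} [NeZero N]

omit [NeZero N] in
theorem zetaMul_prime_pow (χ : DirichletCharacter ℂ N) {p : ℕ} (hp : p.Prime) (j : ℕ) :
    χ.zetaMul (p ^ j) = ∑ i ∈ Finset.range (j + 1), χ p ^ i := by
  rw [DirichletCharacter.zetaMul, ArithmeticFunction.coe_zeta_mul_apply,
    Nat.sum_divisors_prime_pow hp]
  refine Finset.sum_congr rfl fun i _ => ?_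
  simp [toArithmeticFunction, hp.ne_zero]

omit [NeZero N] in
open scoped ComplexOrder in
theorem one_le_zetaMul_prime_pow {χ : DirichletCharacter ℂ N} (hχ : χ ^ 2 = 1) {p : ℕ}
    (hp : p.Prime) (k : ℕ) : 1 ≤ χ.zetaMul (p ^ (2 * k)) := by
  rw [zetaMul_prime_pow χ hp]
  rcases MulChar.isQuadratic_iff_sq_eq_one.mpr hχ p with h | h | h
  · rw [h, Finset.sum_range_succ']
    simp
  · rw [h]
    simp only [one_pow, Finset.sum_const, Finset.card_range, nsmul_eq_mul, mul_one]
    exact_mod_cast Nat.le_add_left 1 (2 * k)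
  · rw [h, neg_one_geom_sum, if_neg]
    rw [Nat.even_add_one, not_not]
    exact even_two_mul k

omit [NeZero N] in
open scoped ComplexOrder in
theorem one_le_zetaMul_sq {χ : DirichletCharacter ℂ N} (hχ : χ ^ 2 = 1) {m : ℕ} (hm : m ≠ 0) :
    1 ≤ χ.zetaMul (m ^ 2) := by
  rw [χ.isMultiplicative_zetaMul.multiplicative_factorization _ (pow_ne_zero 2 hm)]
  refine Finset.prod_induction _ (fun z : ℂ => 1 ≤ z) (fun a b ha hb => one_le_mul_of_one_le_of_one_le ha hb)
    le_rfl fun p hp => ?_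
  rw [Nat.factorization_pow]
  exact one_le_zetaMul_prime_pow hχ (Nat.prime_of_mem_primeFactors hp) _

theorem le_expWeight {u : ℝ} (h1 : 1 / 4 ≤ u) (h2 : u ≤ 1) : 1 / 10 ≤ expWeight u := by
  have e1 : Real.exp (-(2 * u)) = Real.exp (-u) * Real.exp (-u) := by
    rw [← Real.exp_add]; congr 1; ring
  rw [expWeight, e1]
  have h3 : 5 / 4 ≤ Real.exp u := by linarith [Real.add_one_le_exp u]
  have h4 : Real.exp u ≤ 3 := by
    have := Real.exp_le_exp.2 h2
    linarith [Real.exp_one_lt_d9]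
  have h5 : Real.exp u * Real.exp (-u) = 1 := by rw [← Real.exp_add]; simp
  set t := Real.exp (-u)
  have ht : 0 < t := Real.exp_pos _
  have a1 : t ≤ 4 / 5 := by nlinarith
  have a2 : 1 / 3 ≤ t := by nlinarith
  nlinarith [mul_nonneg (sub_nonneg.2 a1) (sub_nonneg.2 a2)]

omit [NeZero N] in
open scoped ComplexOrder in
theorem le_norm_sum_zetaMul_expWeight {χ : DirichletCharacter ℂ N} (hχ : χ ^ 2 = 1) {K X : ℕ}
    (hK : 1 ≤ K) (hX : K ^ 2 ≤ X) :
    (K : ℝ) / 20 ≤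
      ‖∑ n ∈ Finset.Icc 1 X, χ.zetaMul n * (expWeight (n * (1 / (K : ℝ) ^ 2)) : ℂ)‖ := by
  have hK0 : (0 : ℝ) < K := by exact_mod_cast hK
  refine le_trans ?_ (Complex.re_le_norm _)
  rw [Complex.re_sum]
  have hnn : ∀ n : ℕ, 0 ≤ (χ.zetaMul n * (expWeight (n * (1 / (K : ℝ) ^ 2)) : ℂ)).re := by
    intro n
    rw [Complex.re_mul_ofReal]
    exact mul_nonneg (Complex.le_def.1 (DirichletCharacter.zetaMul_nonneg hχ n)).1
      (expWeight_nonneg (by positivity))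
  have hsub : (Finset.Icc ((K + 1) / 2) K).image (fun m => m ^ 2) ⊆ Finset.Icc 1 X := by
    intro n hn
    obtain ⟨m, hm, rfl⟩ := Finset.mem_image.1 hn
    rw [Finset.mem_Icc] at hm ⊢
    exact ⟨Nat.one_le_pow _ _ (by omega), (Nat.pow_le_pow_left hm.2 2).trans hX⟩
  refine le_trans ?_ (Finset.sum_le_sum_of_subset_of_nonneg hsub fun n _ _ => hnn n)
  rw [Finset.sum_image fun a _ b _ h => Nat.pow_left_injective (n := 2) (by norm_num) h]
  have hterm : ∀ m ∈ Finset.Icc ((K + 1) / 2) K, (1 / 10 : ℝ) ≤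
      (χ.zetaMul (m ^ 2) * (expWeight ((m ^ 2 : ℕ) * (1 / (K : ℝ) ^ 2)) : ℂ)).re := by
    intro m hm
    rw [Finset.mem_Icc] at hm
    have hm1 : (K : ℝ) ≤ 2 * m := by exact_mod_cast (by omega : K ≤ 2 * m)
    have hm2 : (m : ℝ) ≤ K := by exact_mod_cast hm.2
    rw [Complex.re_mul_ofReal]
    have z1 : 1 ≤ (χ.zetaMul (m ^ 2)).re := (Complex.le_def.1 (one_le_zetaMul_sq hχ (by omega))).1
    have z2 : 1 / 10 ≤ expWeight ((m ^ 2 : ℕ) * (1 / (K : ℝ) ^ 2)) := by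
      push_cast
      rw [mul_one_div]
      apply le_expWeight
      · rw [div_le_div_iff₀ (by norm_num) (by positivity)]; nlinarith
      · rw [div_le_one (by positivity)]; gcongr
    nlinarith
  refine le_trans ?_ (Finset.sum_le_sum hterm)
  rw [Finset.sum_const, Nat.card_Icc, nsmul_eq_mul]
  have : (K : ℝ) ≤ 2 * ((K + 1 - (K + 1) / 2 : ℕ) : ℝ) := by exact_mod_cast (by omega)
  linarith

theorem div_le_norm_contL_one {χ : DirichletCharacter ℂ N} (hχ2 : χ ^ 2 = 1) (hχ : χ ≠ 1) {K : ℕ}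
    (hK : 1 ≤ K) : (K : ℝ) / 20 ≤ ‖contL χ 1‖ * K ^ 2 / 2 + 4 * N ^ 2 / K ^ 2 := by
  have hK0 : (0 : ℝ) < K := by exact_mod_cast hK
  set h : ℝ := 1 / (K : ℝ) ^ 2 with hh
  have hh0 : 0 < h := by positivity
  have hlim : Tendsto (fun X : ℕ => ‖contL χ 1‖ / (2 * h) + 4 * N ^ 2 * h + (8 * N / h) / X +
        X * (Real.exp (-(h * X)) / (1 - Real.exp (-h)))) atTop
      (𝓝 (‖contL χ 1‖ / (2 * h) + 4 * N ^ 2 * h + 0 + 0)) := by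
    refine (tendsto_const_nhds.add (tendsto_const_div_atTop_nhds_zero_nat _)).add ?_
    have h1 : Tendsto (fun X : ℕ => h * (X : ℝ)) atTop atTop :=
      tendsto_natCast_atTop_atTop.const_mul_atTop hh0
    have h2 := ((Real.tendsto_pow_mul_exp_neg_atTop_nhds_zero 1).comp h1).const_mul
      (1 / (h * (1 - Real.exp (-h))))
    rw [mul_zero] at h2
    refine h2.congr fun X => ?_
    have : 1 - Real.exp (-h) ≠ 0 := by
      rw [sub_ne_zero]; exact (Real.exp_lt_one_iff.2 (by linarith)).ne'
    simp only [Function.comp, pow_one]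
    field_simp
  have hle := ge_of_tendsto hlim (b := (K : ℝ) / 20) (by
    filter_upwards [eventually_ge_atTop (K ^ 2)] with X hX
    have h1 : 1 ≤ X := (Nat.one_le_pow _ _ hK).trans hX
    exact (le_norm_sum_zetaMul_expWeight hχ2 hK hX).trans (norm_sum_zetaMul_expWeight_le hχ hh0 h1))
  refine hle.trans (le_of_eq ?_)
  rw [hh]
  field_simp
  ring

theorem le_norm_contL_one {χ : DirichletCharacter ℂ N} (hχ2 : χ ^ 2 = 1) (hχ : χ ≠ 1) :
    1 / (140 * (N : ℝ) ^ (2 / 3 : ℝ)) ≤ ‖contL χ 1‖ := by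
  have hN1 : (1 : ℝ) ≤ N := by exact_mod_cast Nat.pos_of_ne_zero (NeZero.ne N)
  set M : ℝ := (N : ℝ) ^ (2 / 3 : ℝ) with hM
  have hM1 : 1 ≤ M := Real.one_le_rpow hN1 (by norm_num)
  have hM3 : M ^ 3 = N ^ 2 := by
    rw [hM, ← Real.rpow_natCast, ← Real.rpow_mul (by positivity), ← Real.rpow_natCast]
    norm_num
  set K : ℕ := ⌈6 * M⌉₊ with hK
  have hK1 : 6 * M ≤ K := Nat.le_ceil _
  have hK2 : (K : ℝ) < 6 * M + 1 := Nat.ceil_lt_add_one (by positivity)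
  have hK0 : (0 : ℝ) < K := by linarith
  have hmain := div_le_norm_contL_one hχ2 hχ (K := K) (by exact_mod_cast hK0)
  have h3 : 160 * (N : ℝ) ^ 2 ≤ K ^ 3 := by
    rw [← hM3]
    have : (6 * M) ^ 3 ≤ (K : ℝ) ^ 3 := by gcongr
    have hp : 0 ≤ M ^ 3 := by positivity
    nlinarith
  have h4 : 4 * (N : ℝ) ^ 2 / K ^ 2 ≤ K / 40 := by
    rw [div_le_div_iff₀ (by positivity) (by norm_num)]
    nlinarith
  have h5 : (K : ℝ) / 40 ≤ ‖contL χ 1‖ * K ^ 2 / 2 := by linarith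
  have h6 : 1 ≤ ‖contL χ 1‖ * (20 * K) := by
    have : (K : ℝ) * 1 ≤ K * (‖contL χ 1‖ * (20 * K)) := by nlinarith
    exact le_of_mul_le_mul_left this hK0
  rw [div_le_iff₀ (by positivity)]
  exact h6.trans (mul_le_mul_of_nonneg_left (by linarith) (norm_nonneg _))

end LOneLower

section PrimeSums

theorem sqrt_mul_log_pow_le {x : ℝ} (hx : 1 ≤ x) : √x * Real.log x ^ 4 ≤ 201 * x := by
  have hx0 : 0 < x := by linarith
  have hL : 0 ≤ Real.log x := Real.log_nonneg hx
  have h1 := Real.pow_div_factorial_le_exp _ hL 8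
  rw [Real.exp_log hx0, div_le_iff₀ (by positivity)] at h1
  have h2 : ((Nat.factorial 8 : ℕ) : ℝ) = 40320 := by norm_num [Nat.factorial]
  rw [h2] at h1
  have h3 : √x * √x = x := Real.mul_self_sqrt hx0.le
  have hs : 0 < √x := Real.sqrt_pos.2 hx0
  have h4 : Real.log x ^ 4 ≤ 201 * √x := by
    refine abs_le_of_sq_le_sq' ?_ (by positivity) |>.2
    calc (Real.log x ^ 4) ^ 2 = Real.log x ^ 8 := by ring
      _ ≤ x * 40320 := h1
      _ ≤ (201 * √x) ^ 2 := by nlinarith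
  calc √x * Real.log x ^ 4 ≤ √x * (201 * √x) := by gcongr
    _ = 201 * x := by rw [← h3]; ring_nf; rw [Real.sq_sqrt (by positivity)]

/-- Passing between sums over primes and sums weighted by `Λ n / log n`. -/
theorem exists_norm_sum_prime_sub_le : ∃ C > 0, ∀ f : ℕ → ℂ, (∀ n, ‖f n‖ ≤ 1) → ∀ x : ℝ, 4 ≤ x →
    ‖∑ p ∈ (Finset.Icc ⌈x⌉₊ ⌊2 * x⌋₊).filter Nat.Prime, f p -
      ∑ n ∈ Finset.Icc ⌈x⌉₊ ⌊2 * x⌋₊,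
        f n * (ArithmeticFunction.vonMangoldt n : ℂ) * (((Real.log n)⁻¹ : ℝ) : ℂ)‖ ≤
      C * x / Real.log x ^ 4 := by
  obtain ⟨C, hC⟩ := Chebyshev.psi_sub_theta_le_mul_sqrt
  refine ⟨402 * (|C| + 1), by positivity, fun f hf x hx => ?_⟩
  have he := Real.exp_one_lt_d9
  have hx0 : 0 < x := by linarith
  have hL1 : 1 ≤ Real.log x := by rw [Real.le_log_iff_exp_le hx0]; linarith
  rw [Finset.sum_filter, ← Finset.sum_sub_distrib]
  have h1 : ∀ n ∈ Finset.Icc ⌈x⌉₊ ⌊2 * x⌋₊, ‖(if n.Prime then f n else 0) -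
      f n * (ArithmeticFunction.vonMangoldt n : ℂ) * (((Real.log n)⁻¹ : ℝ) : ℂ)‖ ≤
      if n.Prime then 0 else ArithmeticFunction.vonMangoldt n := by
    intro n hn
    have hxn : x ≤ n := (Nat.le_ceil x).trans (by exact_mod_cast (Finset.mem_Icc.1 hn).1)
    have hln : 1 ≤ Real.log n := hL1.trans (Real.log_le_log hx0 hxn)
    split_ifs with hp
    · rw [ArithmeticFunction.vonMangoldt_apply_prime hp, mul_assoc, ← Complex.ofReal_mul,
        mul_inv_cancel₀ (by linarith)]
      simp
    · have hΛ : 0 ≤ ArithmeticFunction.vonMangoldt n := ArithmeticFunction.vonMangoldt_nonneg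
      rw [zero_sub, norm_neg, norm_mul, norm_mul, Complex.norm_real, Complex.norm_real,
        Real.norm_of_nonneg hΛ, Real.norm_of_nonneg (by positivity)]
      calc ‖f n‖ * ArithmeticFunction.vonMangoldt n * (Real.log n)⁻¹
          ≤ 1 * ArithmeticFunction.vonMangoldt n * 1 := by
            gcongr
            · exact hf n
            · exact inv_le_one_of_one_le₀ hln
        _ = _ := by ring
  refine (norm_sum_le_of_le _ h1).trans ?_
  have h2 : ∑ n ∈ Finset.Icc ⌈x⌉₊ ⌊2 * x⌋₊, (if n.Prime then 0 else ArithmeticFunction.vonMangoldt n)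
      ≤ Chebyshev.psi (2 * x) - Chebyshev.theta (2 * x) := by
    rw [Chebyshev.psi_sub_theta_eq_sum_not_prime, Finset.sum_filter]
    have : ∀ n : ℕ, (if ¬ n.Prime then ArithmeticFunction.vonMangoldt n else 0) =
      (if n.Prime then 0 else ArithmeticFunction.vonMangoldt n) := fun n => by split_ifs <;> rfl
    simp only [this]
    refine Finset.sum_le_sum_of_subset_of_nonneg ?_ fun n _ _ => ?_
    · intro n hn
      rw [Finset.mem_Icc] at hn
      rw [Finset.mem_Ioc]
      exact ⟨(Nat.ceil_pos.2 hx0).trans_le hn.1, hn.2⟩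
    · split_ifs
      exacts [le_rfl, ArithmeticFunction.vonMangoldt_nonneg]
  refine (h2.trans (hC _)).trans ?_
  have h3 : √(2 * x) ≤ 2 * √x := by
    rw [Real.sqrt_le_left (by positivity), mul_pow, Real.sq_sqrt hx0.le]; linarith
  have h4 := sqrt_mul_log_pow_le (x := x) (by linarith)
  rw [le_div_iff₀ (by positivity)]
  calc C * √(2 * x) * Real.log x ^ 4 ≤ (|C| + 1) * (2 * √x) * Real.log x ^ 4 := by
        gcongr
        linarith [le_abs_self C]
    _ = (|C| + 1) * 2 * (√x * Real.log x ^ 4) := by ring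
    _ ≤ (|C| + 1) * 2 * (201 * x) := by gcongr
    _ = _ := by ring

end PrimeSums

section PrimeCharSums

/-- The primes in `[x, 2x]`. -/
noncomputable def dyadicPrimes (x : ℝ) : Finset ℕ := (Finset.Icc ⌈x⌉₊ ⌊2 * x⌋₊).filter Nat.Prime

theorem one_le_log_of_four_le {x : ℝ} (hx : 4 ≤ x) : 1 ≤ Real.log x := by
  rw [Real.le_log_iff_exp_le (by linarith)]; linarith [Real.exp_one_lt_d9]

theorem norm_char_mul_vonMangoldt_le {N : ℕ} (χ : DirichletCharacter ℂ N) {n : ℕ} (hn : 1 ≤ n) :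
    ‖χ n * (ArithmeticFunction.vonMangoldt n : ℂ)‖ ≤ 1 + Real.log n := by
  have h0 : 0 ≤ ArithmeticFunction.vonMangoldt n := ArithmeticFunction.vonMangoldt_nonneg
  have hl : 0 ≤ Real.log n := Real.log_nonneg (by exact_mod_cast hn)
  rw [norm_mul, Complex.norm_real, Real.norm_of_nonneg h0]
  calc ‖χ n‖ * ArithmeticFunction.vonMangoldt n ≤ 1 * Real.log n := by
        gcongr
        · exact χ.norm_le_one _
        · exact ArithmeticFunction.vonMangoldt_le_log
    _ ≤ _ := by linarith

theorem exists_norm_sum_prime_char_le (k : ℕ) : ∃ C > 0, ∀ (N : ℕ) [NeZero N]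
    (χ : DirichletCharacter ℂ N) (ℓ : ℝ), χ ≠ 1 → 0 < ℓ → ℓ ≤ 1 → (χ ^ 2 = 1 → ℓ ≤ ‖contL χ 1‖) →
    ∀ x : ℝ, 4 ≤ x → ‖∑ p ∈ dyadicPrimes x, χ p‖ ≤
      C * x * (N / ℓ ^ (k + 1) * Real.log x ^ 2 / Real.log x ^ (k + 1) + 1 / Real.log x ^ 4) := by
  obtain ⟨C₁, hC₁, h₁⟩ := exists_iteratedDeriv_LSeries_twist_le (η := 1 / 4) (by norm_num) k
  obtain ⟨C₂, hC₂, h₂⟩ := norm_sum_div_log_le k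
  obtain ⟨C₃, hC₃, h₃⟩ := exists_norm_sum_prime_sub_le
  refine ⟨C₂ * C₁ + C₂ + C₃, by positivity, fun N _ χ ℓ hχ hℓ hℓ1 hL x hx => ?_⟩
  have hN1 : (1 : ℝ) ≤ N := by exact_mod_cast Nat.pos_of_ne_zero (NeZero.ne N)
  have hl := one_le_log_of_four_le hx
  have a1 := h₃ (fun n => χ n) (fun n => χ.norm_le_one _) x hx
  have a2 := h₂ (fun n => χ n * (ArithmeticFunction.vonMangoldt n : ℂ)) (C₁ * (N / ℓ ^ (k + 1)))
    (by positivity) (fun n hn => norm_char_mul_vonMangoldt_le χ hn) (fun s hs hs2 => by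
      refine (h₁ N χ ℓ hχ hℓ hℓ1 hL s hs hs2).trans ?_
      rw [Real.mul_rpow (by positivity) (by positivity)]
      have : (N : ℝ) ^ (1 / 4 : ℝ) ≤ N := by
        conv_rhs => rw [← Real.rpow_one (N : ℝ)]
        exact Real.rpow_le_rpow_of_exponent_le hN1 (by norm_num)
      calc C₁ * ((N : ℝ) ^ (1 / 4 : ℝ) * (1 + |s.im|) ^ (1 / 4 : ℝ)) / ℓ ^ (k + 1)
          ≤ C₁ * (N * (1 + |s.im|) ^ (1 / 4 : ℝ)) / ℓ ^ (k + 1) := by gcongr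
        _ = _ := by ring) x hx
  have a3 := norm_le_insert' (∑ p ∈ dyadicPrimes x, χ p) (∑ n ∈ Finset.Icc ⌈x⌉₊ ⌊2 * x⌋₊,
        χ n * (ArithmeticFunction.vonMangoldt n : ℂ) * (((Real.log n)⁻¹ : ℝ) : ℂ))
  refine a3.trans ((add_le_add a2 a1).trans ?_)
  set E := N / ℓ ^ (k + 1) * Real.log x ^ 2 / Real.log x ^ (k + 1) with hE
  have hE0 : 0 ≤ E := by positivity
  set F := 1 / Real.log x ^ 4 with hF
  have hF0 : 0 ≤ F := by positivity
  have e1 : C₁ * (N / ℓ ^ (k + 1)) * Real.log x ^ 2 / Real.log x ^ (k + 1) = C₁ * E := by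
    rw [hE]; ring
  have e2 : C₃ * x / Real.log x ^ 4 = C₃ * x * F := by rw [hF]; ring
  rw [e1, e2]
  have hx0 : 0 ≤ x := by linarith
  have b1 : 0 ≤ C₂ * x * E := by positivity
  have b2 : 0 ≤ C₃ * x * E := by positivity
  have b3 : 0 ≤ C₂ * C₁ * x * F := by positivity
  nlinarith

theorem exists_norm_sum_prime_complex_char_le : ∃ C > 0, ∀ (N : ℕ) [NeZero N]
    (χ : DirichletCharacter ℂ N), χ ^ 2 ≠ 1 → ∀ x : ℝ, 4 ≤ x → (N : ℝ) ≤ Real.log x ^ 3 →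
      ‖∑ p ∈ dyadicPrimes x, χ p‖ ≤ C * x / Real.log x ^ 4 := by
  obtain ⟨C, hC, h⟩ := exists_norm_sum_prime_char_le 8
  refine ⟨C * 2, by positivity, fun N _ χ hχ x hx hN => ?_⟩
  have hl := one_le_log_of_four_le hx
  have hx0 : 0 < x := by linarith
  refine (h N χ 1 (fun h => hχ (by rw [h, one_pow])) one_pos le_rfl (fun h => (hχ h).elim) x hx).trans ?_
  have : (N : ℝ) / 1 ^ (8 + 1) * Real.log x ^ 2 / Real.log x ^ (8 + 1) ≤ 1 / Real.log x ^ 4 := by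
    rw [one_pow, div_one, div_le_div_iff₀ (by positivity) (by positivity)]
    calc (N : ℝ) * Real.log x ^ 2 * Real.log x ^ 4 ≤ Real.log x ^ 3 * Real.log x ^ 2 * Real.log x ^ 4 := by
          gcongr
      _ = _ := by ring
  calc C * x * (_ + _) ≤ C * x * (1 / Real.log x ^ 4 + 1 / Real.log x ^ 4) := by gcongr
    _ = _ := by ring

theorem exists_norm_sum_prime_real_char_le : ∃ C > 0, ∀ (N : ℕ) [NeZero N]
    (χ : DirichletCharacter ℂ N), χ ^ 2 = 1 → χ ≠ 1 → ∀ x : ℝ, 4 ≤ x → (N : ℝ) ^ 4 ≤ Real.log x ^ 5 →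
      ‖∑ p ∈ dyadicPrimes x, χ p‖ ≤ C * x / Real.log x ^ 4 := by
  obtain ⟨C, hC, h⟩ := exists_norm_sum_prime_char_le 65
  refine ⟨C * (140 ^ 66 + 1), by positivity, fun N _ χ hχ2 hχ x hx hN => ?_⟩
  have hl := one_le_log_of_four_le hx
  have hx0 : 0 < x := by linarith
  have hN1 : (1 : ℝ) ≤ N := by exact_mod_cast Nat.pos_of_ne_zero (NeZero.ne N)
  set M : ℝ := (N : ℝ) ^ (2 / 3 : ℝ) with hM
  have hM1 : 1 ≤ M := Real.one_le_rpow hN1 (by norm_num)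
  have hM3 : M ^ 3 = N ^ 2 := by
    rw [hM, ← Real.rpow_natCast, ← Real.rpow_mul (by positivity), ← Real.rpow_natCast]
    norm_num
  refine (h N χ (1 / (140 * M)) hχ (by positivity) ?_ (fun _ => le_norm_contL_one hχ2 hχ) x hx).trans ?_
  · rw [div_le_one (by positivity)]; linarith
  have hM66 : M ^ 66 = (N : ℝ) ^ 44 := by
    calc M ^ 66 = (M ^ 3) ^ 22 := by ring
      _ = _ := by rw [hM3]; ring
  have e1 : (N : ℝ) / (1 / (140 * M)) ^ (65 + 1) = 140 ^ 66 * N ^ 45 := by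
    rw [one_div, inv_pow, div_inv_eq_mul, mul_pow, show 65 + 1 = 66 from rfl, hM66]; ring
  have h60 : (N : ℝ) ^ 45 ≤ Real.log x ^ 60 := by
    calc (N : ℝ) ^ 45 ≤ N ^ 48 := pow_le_pow_right₀ hN1 (by norm_num)
      _ = (N ^ 4) ^ 12 := by ring
      _ ≤ (Real.log x ^ 5) ^ 12 := by gcongr
      _ = _ := by ring
  have : (N : ℝ) / (1 / (140 * M)) ^ (65 + 1) * Real.log x ^ 2 / Real.log x ^ (65 + 1) ≤
      140 ^ 66 * (1 / Real.log x ^ 4) := by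
    rw [e1, mul_one_div, div_le_div_iff₀ (by positivity) (by positivity)]
    calc 140 ^ 66 * (N : ℝ) ^ 45 * Real.log x ^ 2 * Real.log x ^ 4
        ≤ 140 ^ 66 * Real.log x ^ 60 * Real.log x ^ 2 * Real.log x ^ 4 := by
          gcongr
      _ = _ := by ring
  calc C * x * (_ + _) ≤ C * x * (140 ^ 66 * (1 / Real.log x ^ 4) + 1 / Real.log x ^ 4) := by gcongr
    _ = _ := by ring

theorem abs_sum_inv_log_sub_le {x : ℝ} (hx : 4 ≤ x) :
    |∑ n ∈ Finset.Icc ⌈x⌉₊ ⌊2 * x⌋₊, (Real.log n)⁻¹ - x / Real.log x| ≤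
      3 * x / Real.log x ^ 2 := by
  have hl := one_le_log_of_four_le hx
  have hx0 : 0 < x := by linarith
  set L := Real.log x with hL
  have hlx : L ≤ x := (Real.log_le_sub_one_of_pos hx0).trans (by linarith)
  have hc1 : x ≤ ⌈x⌉₊ := Nat.le_ceil x
  have hc2 : (⌈x⌉₊ : ℝ) < x + 1 := Nat.ceil_lt_add_one hx0.le
  have hf1 : (⌊2 * x⌋₊ : ℝ) ≤ 2 * x := Nat.floor_le (by positivity)
  have hf2 : 2 * x < ⌊2 * x⌋₊ + 1 := Nat.lt_floor_add_one _
  have hcf : ⌈x⌉₊ ≤ ⌊2 * x⌋₊ + 1 := by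
    have : (⌈x⌉₊ : ℝ) ≤ ⌊2 * x⌋₊ + 1 := by linarith
    exact_mod_cast this
  have hcard : ((Finset.Icc ⌈x⌉₊ ⌊2 * x⌋₊).card : ℝ) = ⌊2 * x⌋₊ + 1 - ⌈x⌉₊ := by
    rw [Nat.card_Icc, Nat.cast_sub hcf]; push_cast; ring
  have hterm : ∀ n ∈ Finset.Icc ⌈x⌉₊ ⌊2 * x⌋₊, (Real.log n)⁻¹ ≤ L⁻¹ ∧
      L⁻¹ - (L ^ 2)⁻¹ ≤ (Real.log n)⁻¹ := by
    intro n hn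
    rw [Finset.mem_Icc] at hn
    have hxn : x ≤ n := hc1.trans (by exact_mod_cast hn.1)
    have hn2 : (n : ℝ) ≤ 2 * x := (Nat.le_floor_iff (by positivity)).1 hn.2
    have h1 : L ≤ Real.log n := Real.log_le_log hx0 hxn
    have h2 : Real.log n ≤ L + 1 := by
      have := Real.log_le_log (by linarith) hn2
      rw [Real.log_mul (by norm_num) hx0.ne'] at this
      linarith [Real.log_two_lt_d9]
    refine ⟨inv_anti₀ (by linarith) h1, ?_⟩
    calc L⁻¹ - (L ^ 2)⁻¹ ≤ (L + 1)⁻¹ := by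
          rw [← sub_nonneg]
          have : (L + 1)⁻¹ - (L⁻¹ - (L ^ 2)⁻¹) = 1 / (L ^ 2 * (L + 1)) := by field_simp; ring
          rw [this]; positivity
      _ ≤ _ := inv_anti₀ (by linarith) h2
  have hup := Finset.sum_le_sum fun n hn => (hterm n hn).1
  have hlo := Finset.sum_le_sum fun n hn => (hterm n hn).2
  rw [Finset.sum_const, nsmul_eq_mul, hcard] at hup hlo
  set S := ∑ n ∈ Finset.Icc ⌈x⌉₊ ⌊2 * x⌋₊, (Real.log n)⁻¹
  set c : ℝ := ⌊2 * x⌋₊ + 1 - ⌈x⌉₊ with hcdef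
  have hL2 : L⁻¹ ≤ x / L ^ 2 := by
    rw [inv_eq_one_div, div_le_div_iff₀ (by positivity) (by positivity)]; nlinarith
  have hli : 0 < L⁻¹ := by positivity
  have hu1 : (L ^ 2)⁻¹ ≤ L⁻¹ := inv_anti₀ (by positivity) (by nlinarith)
  have e1 : x / L = x * L⁻¹ := rfl
  have e2 : 3 * x / L ^ 2 = 3 * (x / L ^ 2) := by ring
  have e3 : x / L ^ 2 = x * (L ^ 2)⁻¹ := rfl
  have hu0 : 0 < (L ^ 2)⁻¹ := by positivity
  rw [abs_le, e1, e2]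
  constructor
  · have : (x - 1) * (L⁻¹ - (L ^ 2)⁻¹) ≤ c * (L⁻¹ - (L ^ 2)⁻¹) :=
      mul_le_mul_of_nonneg_right (by linarith) (by linarith)
    nlinarith
  · have : c * L⁻¹ ≤ (x + 1) * L⁻¹ := mul_le_mul_of_nonneg_right (by linarith) hli.le
    nlinarith

theorem exists_abs_card_dyadicPrimes_sub_le : ∃ C > 0, ∀ x : ℝ, 4 ≤ x →
    |((dyadicPrimes x).card : ℝ) - x / Real.log x| ≤ C * x / Real.log x ^ 2 := by
  obtain ⟨C₁, hC₁, h₁⟩ := exists_iteratedDeriv_LSeries_vonMangoldt_le (η := 1 / 4) (by norm_num) 5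
  obtain ⟨C₂, hC₂, h₂⟩ := norm_sum_div_log_le 5
  obtain ⟨C₃, hC₃, h₃⟩ := exists_norm_sum_prime_sub_le
  refine ⟨C₂ * (C₁ + 1) + C₃ + 3, by positivity, fun x hx => ?_⟩
  have hl := one_le_log_of_four_le hx
  have hx0 : 0 < x := by linarith
  have a1 := h₃ (fun _ => 1) (fun n => by simp) x hx
  have a2 := h₂ (fun n => (ArithmeticFunction.vonMangoldt n : ℂ) - 1) C₁ hC₁.le (fun n hn => by
      refine (norm_sub_le _ _).trans ?_
      rw [norm_one, Complex.norm_real, Real.norm_of_nonneg ArithmeticFunction.vonMangoldt_nonneg, add_comm]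
      gcongr
      exact ArithmeticFunction.vonMangoldt_le_log) h₁ x hx
  have a3 := abs_sum_inv_log_sub_le hx
  set L := Real.log x with hL
  have e : (((dyadicPrimes x).card : ℝ) - x / L : ℝ) =
      (((∑ p ∈ (Finset.Icc ⌈x⌉₊ ⌊2 * x⌋₊).filter Nat.Prime, (1 : ℂ)) - ∑ n ∈ Finset.Icc ⌈x⌉₊ ⌊2 * x⌋₊,
        1 * (ArithmeticFunction.vonMangoldt n : ℂ) * (((Real.log n)⁻¹ : ℝ) : ℂ)) +
      ∑ n ∈ Finset.Icc ⌈x⌉₊ ⌊2 * x⌋₊, ((ArithmeticFunction.vonMangoldt n : ℂ) - 1) *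
        (((Real.log n)⁻¹ : ℝ) : ℂ)) +
      ((∑ n ∈ Finset.Icc ⌈x⌉₊ ⌊2 * x⌋₊, (Real.log n)⁻¹ - x / L : ℝ) : ℂ) := by
    simp only [sub_mul, Finset.sum_sub_distrib, dyadicPrimes]
    push_cast
    simp
  rw [← Real.norm_eq_abs, ← Complex.norm_real] at a3 ⊢
  rw [e]
  refine (norm_add₃_le.trans (add_le_add (add_le_add a1 a2) a3)).trans ?_
  have h42 : 1 / L ^ 4 ≤ 1 / L ^ 2 :=
    one_div_le_one_div_of_le (by positivity) (pow_le_pow_right₀ hl (by norm_num))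
  have e1 : C₁ * L ^ 2 / L ^ (5 + 1) = C₁ * (1 / L ^ 4) := by field_simp
  rw [e1]
  calc C₃ * x / L ^ 4 + C₂ * x * (C₁ * (1 / L ^ 4) + 1 / L ^ 4) + 3 * x / L ^ 2
      = (C₃ * x + C₂ * x * (C₁ + 1)) * (1 / L ^ 4) + 3 * x / L ^ 2 := by ring
    _ ≤ (C₃ * x + C₂ * x * (C₁ + 1)) * (1 / L ^ 2) + 3 * x / L ^ 2 := by gcongr
    _ = _ := by ring

end PrimeCharSums

section Progressions

/-- The number of primes `p` in `[x, 2x]` with `p ≡ 1 (mod d)`. -/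
noncomputable def apCount (x : ℝ) (d : ℕ) : ℕ := ((dyadicPrimes x).filter fun p => d ∣ p - 1).card

theorem mem_dyadicPrimes {x : ℝ} (hx : 0 ≤ x) {p : ℕ} :
    p ∈ dyadicPrimes x ↔ p.Prime ∧ x ≤ p ∧ (p : ℝ) ≤ 2 * x := by
  rw [dyadicPrimes, Finset.mem_filter, Finset.mem_Icc, Nat.ceil_le, Nat.le_floor_iff (by positivity)]
  tauto

theorem natCast_zmod_eq_one_iff {p d : ℕ} (hp : 1 ≤ p) : (p : ZMod d) = 1 ↔ d ∣ p - 1 := by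
  rw [← Nat.modEq_iff_dvd' hp, ← ZMod.natCast_eq_natCast_iff, Nat.cast_one, eq_comm]

variable {d : ℕ} [NeZero d]

theorem totient_mul_apCount_eq {x : ℝ} (hx : 0 ≤ x) :
    (d.totient : ℂ) * apCount x d = ∑ χ : DirichletCharacter ℂ d, ∑ p ∈ dyadicPrimes x, χ p := by
  rw [Finset.sum_comm]
  have : ∀ p ∈ dyadicPrimes x, ∑ χ : DirichletCharacter ℂ d, χ p =
      if d ∣ p - 1 then (d.totient : ℂ) else 0 := by
    intro p hp
    rw [DirichletCharacter.sum_characters_eq]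
    simp only [natCast_zmod_eq_one_iff ((mem_dyadicPrimes hx).1 hp).1.one_le]
  rw [Finset.sum_congr rfl this, ← Finset.sum_filter, Finset.sum_const, apCount, nsmul_eq_mul, mul_comm]

theorem sum_trivial_char {x : ℝ} (hx : 0 ≤ x) (hd : (d : ℝ) < x) :
    ∑ p ∈ dyadicPrimes x, (1 : DirichletCharacter ℂ d) p = (dyadicPrimes x).card := by
  have : ∀ p ∈ dyadicPrimes x, (1 : DirichletCharacter ℂ d) p = 1 := by
    intro p hp
    obtain ⟨h1, h2, -⟩ := (mem_dyadicPrimes hx).1 hp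
    apply MulChar.one_apply
    rw [ZMod.isUnit_iff_coprime, h1.coprime_iff_not_dvd]
    intro h
    have h3 : (p : ℝ) ≤ d := by exact_mod_cast Nat.le_of_dvd (Nat.pos_of_ne_zero (NeZero.ne d)) h
    linarith
  rw [Finset.sum_congr rfl this]
  simp

open Classical in
theorem abs_totient_mul_apCount_sub_le {x : ℝ} (hx : 0 ≤ x) (hd : (d : ℝ) < x) :
    |(d.totient : ℝ) * apCount x d - (dyadicPrimes x).card| ≤
      ∑ χ ∈ (Finset.univ : Finset (DirichletCharacter ℂ d)).erase 1, ‖∑ p ∈ dyadicPrimes x, χ p‖ := by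
  have h := totient_mul_apCount_eq (d := d) hx
  rw [← Finset.add_sum_erase _ _ (Finset.mem_univ (1 : DirichletCharacter ℂ d)),
    sum_trivial_char hx hd] at h
  rw [← Real.norm_eq_abs, ← Complex.norm_real]
  push_cast
  rw [h, add_sub_cancel_left]
  exact norm_sum_le _ _

theorem card_units_sq_eq_one_le (hd : Squarefree d) :
    Nat.card {u : (ZMod d)ˣ // u ^ 2 = 1} ≤ 2 ^ d.primeFactors.card := by
  classical
  rw [← Finset.card_powerset, ← Nat.card_eq_finsetCard]
  have hdvd : ∀ p ∈ d.primeFactors, p ∣ d := fun p hp => Nat.dvd_of_mem_primeFactors hp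
  set r : (p : ℕ) → p ∈ d.primeFactors → ZMod d →+* ZMod p := fun p hp => ZMod.castHom (hdvd p hp) _
  let F : {u : (ZMod d)ˣ // u ^ 2 = 1} → d.primeFactors.powerset := fun u =>
    ⟨d.primeFactors.filter fun p => ((u.1 : ZMod d).cast : ZMod p) = 1,
      Finset.mem_powerset.2 (Finset.filter_subset _ _)⟩
  refine Nat.card_le_card_of_injective F ?_
  rintro ⟨u, hu⟩ ⟨v, hv⟩ huv
  have huv2 : ∀ p ∈ d.primeFactors, ((u : ZMod d).cast : ZMod p) = 1 ↔ ((v : ZMod d).cast : ZMod p) = 1 := by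
    intro p hp
    have := Finset.ext_iff.1 (congrArg Subtype.val huv) p
    simpa [F, hp] using this
  apply Subtype.ext
  apply Units.ext
  change (u : ZMod d) = v
  have hsq : ∀ w : (ZMod d)ˣ, w ^ 2 = 1 → ∀ p (hp : p ∈ d.primeFactors),
      r p hp w = 1 ∨ r p hp w = -1 := by
    intro w hw p hp
    have := Fact.mk (Nat.prime_of_mem_primeFactors hp)
    rw [← sq_eq_one_iff, ← map_pow, ← Units.val_pow_eq_pow_val, hw, Units.val_one, map_one]
  have heq : ∀ p (hp : p ∈ d.primeFactors), r p hp u = r p hp v := by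
    intro p hp
    have h0 := huv2 p hp
    change r p hp u = 1 ↔ r p hp v = 1 at h0
    rcases hsq u hu p hp with h | h <;> rcases hsq v hv p hp with h' | h'
    · rw [h, h']
    · rw [h, h0.1 h]
    · rw [h', h0.2 h']
    · rw [h, h']
  obtain ⟨a, ha⟩ := ZMod.natCast_zmod_surjective (u : ZMod d)
  obtain ⟨b, hb⟩ := ZMod.natCast_zmod_surjective (v : ZMod d)
  rw [← ha, ← hb] at heq ⊢
  rw [← Int.cast_natCast, ← Int.cast_natCast (R := ZMod d) b, ZMod.intCast_eq_intCast_iff_dvd_sub]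
  have hp : ∀ p ∈ d.primeFactors, (p : ℤ) ∣ (b : ℤ) - a := by
    intro p hp
    have := heq p hp
    rw [map_natCast, map_natCast, ← Int.cast_natCast, ← Int.cast_natCast (R := ZMod p) b,
      ZMod.intCast_eq_intCast_iff_dvd_sub] at this
    exact this
  rw [← Nat.prod_primeFactors_of_squarefree hd]
  push_cast
  refine Finset.prod_dvd_of_coprime ?_ hp
  intro p hp q hq hpq
  exact Nat.isCoprime_iff_coprime.2 ((Nat.coprime_primes (Nat.prime_of_mem_primeFactors hp)
    (Nat.prime_of_mem_primeFactors hq)).2 hpq)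

open Classical in
theorem card_char_sq_eq_one_le (hd : Squarefree d) :
    ((Finset.univ : Finset (DirichletCharacter ℂ d)).filter fun χ => χ ^ 2 = 1).card ≤
      2 ^ d.primeFactors.card := by
  refine le_trans (le_of_eq ?_) (card_units_sq_eq_one_le hd)
  obtain ⟨e⟩ := DirichletCharacter.mulEquiv_units ℂ d
  rw [← Fintype.card_subtype, ← Nat.card_eq_fintype_card]
  refine Nat.card_congr (e.toEquiv.subtypeEquiv fun χ => ?_)
  change χ ^ 2 = 1 ↔ e χ ^ 2 = 1
  rw [← map_pow, map_eq_one_iff e e.injective]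

omit [NeZero d] in
theorem norm_sum_prime_char_le_card (χ : DirichletCharacter ℂ d) (x : ℝ) :
    ‖∑ p ∈ dyadicPrimes x, χ p‖ ≤ (dyadicPrimes x).card := by
  refine (norm_sum_le_of_le _ fun p _ => χ.norm_le_one _).trans ?_
  simp

omit [NeZero d] in
open Classical in
theorem exists_sum_norm_sum_prime_char_le : ∃ C > 0, ∀ (d : ℕ) [NeZero d], Squarefree d →
    ∀ x : ℝ, 4 ≤ x → (d : ℝ) ≤ Real.log x ^ 3 →
      ∑ χ ∈ (Finset.univ : Finset (DirichletCharacter ℂ d)).erase 1, ‖∑ p ∈ dyadicPrimes x, χ p‖ ≤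
        d.totient * (C * x / Real.log x ^ 4) +
          if (d : ℝ) ^ 4 ≤ Real.log x ^ 5 then 0 else (2 : ℝ) ^ d.primeFactors.card * (dyadicPrimes x).card := by
  obtain ⟨C₁, hC₁, h₁⟩ := exists_norm_sum_prime_complex_char_le
  obtain ⟨C₂, hC₂, h₂⟩ := exists_norm_sum_prime_real_char_le
  refine ⟨C₁ + C₂, by positivity, fun d _ hd x hx hdx => ?_⟩
  have hl := one_le_log_of_four_le hx
  set R : ℝ := if (d : ℝ) ^ 4 ≤ Real.log x ^ 5 then 0 else ((dyadicPrimes x).card : ℝ) with hR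
  have hR0 : 0 ≤ R := by rw [hR]; split_ifs <;> positivity
  have hE : 0 ≤ (C₁ + C₂) * x / Real.log x ^ 4 := by positivity
  have hterm : ∀ χ ∈ (Finset.univ : Finset (DirichletCharacter ℂ d)).erase 1,
      ‖∑ p ∈ dyadicPrimes x, χ p‖ ≤
        (C₁ + C₂) * x / Real.log x ^ 4 + if χ ^ 2 = 1 then R else 0 := by
    intro χ hχ
    have hχ1 : χ ≠ 1 := (Finset.mem_erase.1 hχ).1
    by_cases hχ2 : χ ^ 2 = 1
    · rw [if_pos hχ2]
      by_cases hb : (d : ℝ) ^ 4 ≤ Real.log x ^ 5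
      · rw [hR, if_pos hb, add_zero]
        refine (h₂ d χ hχ2 hχ1 x hx hb).trans ?_
        gcongr
        linarith
      · rw [hR, if_neg hb]
        exact (norm_sum_prime_char_le_card χ x).trans (le_add_of_nonneg_left hE)
    · rw [if_neg hχ2, add_zero]
      refine (h₁ d χ hχ2 x hx hdx).trans ?_
      gcongr
      linarith
  have hsub : (Finset.univ : Finset (DirichletCharacter ℂ d)).erase 1 ⊆ Finset.univ :=
    Finset.erase_subset _ _
  refine (Finset.sum_le_sum hterm).trans ((Finset.sum_le_sum_of_subset_of_nonneg hsub fun χ _ _ => ?_).trans ?_)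
  · split_ifs <;> positivity
  rw [Finset.sum_add_distrib, ← Finset.sum_filter, Finset.sum_const, Finset.sum_const, nsmul_eq_mul,
    nsmul_eq_mul, Finset.card_univ, ← Nat.card_eq_fintype_card,
    DirichletCharacter.card_eq_totient_of_hasEnoughRootsOfUnity ℂ d]
  gcongr
  have hc : (((Finset.univ : Finset (DirichletCharacter ℂ d)).filter fun χ => χ ^ 2 = 1).card : ℝ) ≤
      2 ^ d.primeFactors.card := by exact_mod_cast card_char_sq_eq_one_le hd
  rw [hR]
  split_ifs
  · simp
  · exact mul_le_mul_of_nonneg_right hc (Nat.cast_nonneg _)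

end Progressions

section Multiplicative

/-- The multiplicative function supported on squarefree integers with prescribed values at the
primes. -/
noncomputable def sqfreeProd (c : ℕ → ℝ) : ArithmeticFunction ℝ :=
  ⟨fun d => if Squarefree d then ∏ p ∈ d.primeFactors, c p else 0, by simp⟩

theorem sqfreeProd_apply (c : ℕ → ℝ) (d : ℕ) :
    sqfreeProd c d = if Squarefree d then ∏ p ∈ d.primeFactors, c p else 0 := rfl

theorem sqfreeProd_prime (c : ℕ → ℝ) {p : ℕ} (hp : p.Prime) : sqfreeProd c p = c p := by
  rw [sqfreeProd_apply, if_pos hp.prime.squarefree, hp.primeFactors, Finset.prod_singleton]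

theorem isMultiplicative_sqfreeProd (c : ℕ → ℝ) : (sqfreeProd c).IsMultiplicative := by
  rw [ArithmeticFunction.IsMultiplicative.iff_ne_zero]
  refine ⟨by simp [sqfreeProd_apply], fun {m n} hm hn hmn => ?_⟩
  simp only [sqfreeProd_apply, Nat.squarefree_mul hmn, hmn.primeFactors_mul]
  rw [Finset.prod_union hmn.disjoint_primeFactors]
  by_cases h1 : Squarefree m <;> by_cases h2 : Squarefree n <;> simp [h1, h2]

theorem prod_one_add_eq_sum_divisors (c : ℕ → ℝ) {n : ℕ} (hn : n ≠ 0) :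
    ∏ p ∈ n.primeFactors, (1 + c p) = ∑ d ∈ n.divisors, sqfreeProd c d := by
  set r := ∏ p ∈ n.primeFactors, p with hr
  have hrp : r.primeFactors = n.primeFactors :=
    Nat.primeFactors_prod fun p hp => Nat.prime_of_mem_primeFactors hp
  have hrs : Squarefree r := by
    refine Finset.squarefree_prod_of_pairwise_isCoprime (fun p hp q hq hpq => ?_)
      fun p hp => (Nat.prime_of_mem_primeFactors hp).squarefree
    simp only [← Nat.coprime_iff_isRelPrime]
    exact (Nat.coprime_primes (Nat.prime_of_mem_primeFactors hp)
      (Nat.prime_of_mem_primeFactors hq)).2 hpq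
  have hrn : r ∣ n := Nat.prod_primeFactors_dvd n
  have h := (isMultiplicative_sqfreeProd c).prodPrimeFactors_one_add_of_squarefree hrs
  rw [hrp] at h
  have h' : ∏ p ∈ n.primeFactors, (1 + c p) = ∏ p ∈ n.primeFactors, (1 + sqfreeProd c p) :=
    Finset.prod_congr rfl fun p hp => by
      rw [sqfreeProd_prime c (Nat.prime_of_mem_primeFactors hp)]
  rw [h', h]
  refine Finset.sum_subset (Nat.divisors_subset_of_dvd hn hrn) fun d hd hdr => ?_
  rw [sqfreeProd_apply, if_neg]
  intro hs
  apply hdr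
  rw [Nat.mem_divisors] at hd ⊢
  refine ⟨?_, hrs.ne_zero⟩
  rw [← Nat.prod_primeFactors_of_squarefree hs]
  exact Finset.prod_dvd_prod_of_subset _ _ _ (Nat.primeFactors_mono hd.1 hn)

theorem abs_sqfreeProd_le {c : ℕ → ℝ} (hc : ∀ p : ℕ, p.Prime → |c p| ≤ 2 / p) (d : ℕ) :
    |sqfreeProd c d| ≤ 2 ^ d.primeFactors.card / d := by
  rw [sqfreeProd_apply]
  split_ifs with h
  · rw [Finset.abs_prod]
    refine (Finset.prod_le_prod (fun p _ => abs_nonneg _) fun p hp =>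
      hc p (Nat.prime_of_mem_primeFactors hp)).trans (le_of_eq ?_)
    rw [Finset.prod_div_distrib, Finset.prod_const]
    congr 1
    conv_rhs => rw [← Nat.prod_primeFactors_of_squarefree h]
    push_cast; rfl
  · rw [abs_zero]; positivity

theorem inv_totient_le {d : ℕ} (hd : d ≠ 0) :
    ((d.totient : ℝ))⁻¹ ≤ 2 ^ d.primeFactors.card / d := by
  have hd0 : (0 : ℝ) < d := by exact_mod_cast Nat.pos_of_ne_zero hd
  have ht0 : (0 : ℝ) < d.totient := by exact_mod_cast Nat.totient_pos.2 (Nat.pos_of_ne_zero hd)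
  have h1 : (d.totient : ℝ) = d * ∏ p ∈ d.primeFactors, (1 - (p : ℝ)⁻¹) := by
    have := congrArg (Rat.cast : ℚ → ℝ) (Nat.totient_eq_mul_prod_factors d)
    push_cast at this
    exact this
  have h2 : (1 / 2 : ℝ) ^ d.primeFactors.card ≤ ∏ p ∈ d.primeFactors, (1 - (p : ℝ)⁻¹) := by
    rw [← Finset.prod_const]
    refine Finset.prod_le_prod (fun _ _ => by norm_num) fun p hp => ?_
    have : (2 : ℝ) ≤ p := by exact_mod_cast (Nat.prime_of_mem_primeFactors hp).two_le
    have := inv_anti₀ (by norm_num) this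
    linarith
  rw [inv_le_comm₀ ht0 (by positivity), inv_div, h1, div_eq_mul_inv, ← inv_pow]
  gcongr
  simpa using h2

theorem exists_pow_card_primeFactors_le : ∃ C > 0, ∀ d : ℕ, d ≠ 0 →
    (8 : ℝ) ^ d.primeFactors.card ≤ C * (d : ℝ) ^ (1 / 10 : ℝ) := by
  have ht : Tendsto (fun n : ℕ => (n : ℝ) ^ (1 / 10 : ℝ)) atTop atTop :=
    (tendsto_rpow_atTop (by norm_num)).comp tendsto_natCast_atTop_atTop
  obtain ⟨M, hM⟩ := eventually_atTop.1 (ht.eventually_ge_atTop 8)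
  refine ⟨8 ^ M, by positivity, fun d hd => ?_⟩
  have h1 : d.primeFactors.card = (d.primeFactors.filter (· < M)).card +
      (d.primeFactors.filter (¬ · < M)).card := by
    rw [Finset.card_filter_add_card_filter_not]
  rw [h1, pow_add]
  have h2 : (d.primeFactors.filter (· < M)).card ≤ M := by
    calc _ ≤ (Finset.range M).card := Finset.card_le_card fun p hp => by
          simpa using (Finset.mem_filter.1 hp).2
      _ = M := Finset.card_range M
  gcongr
  · norm_num
  rw [← Finset.prod_const]
  calc ∏ _p ∈ d.primeFactors.filter (¬ · < M), (8 : ℝ)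
      ≤ ∏ p ∈ d.primeFactors.filter (¬ · < M), (p : ℝ) ^ (1 / 10 : ℝ) := by
        refine Finset.prod_le_prod (fun _ _ => by norm_num) fun p hp => hM p ?_
        exact not_lt.1 (Finset.mem_filter.1 hp).2
    _ = ((∏ p ∈ d.primeFactors.filter (¬ · < M), p : ℕ) : ℝ) ^ (1 / 10 : ℝ) := by
        rw [Real.finsetProd_rpow _ _ fun p _ => Nat.cast_nonneg p]
        push_cast; rfl
    _ ≤ (d : ℝ) ^ (1 / 10 : ℝ) := by
        gcongr
        refine Nat.le_of_dvd (Nat.pos_of_ne_zero hd) (dvd_trans ?_ (Nat.prod_primeFactors_dvd d))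
        exact Finset.prod_dvd_prod_of_subset _ _ _ (Finset.filter_subset _ _)

end Multiplicative

section MeanValue

theorem exists_pow_card_primeFactors_div_le : ∃ C > 0, ∀ d : ℕ, d ≠ 0 →
    ((2 : ℝ) ^ d.primeFactors.card) ^ 3 / d ^ 2 ≤
      C * (d : ℝ) ^ (-(11 / 10) : ℝ) / ((d : ℝ) ^ (1 / 5 : ℝ)) ^ 4 ∧
    ((2 : ℝ) ^ d.primeFactors.card) ^ 3 / d ≤ C * (d : ℝ) ^ (-(11 / 10) : ℝ) * (d : ℝ) ^ (1 / 5 : ℝ) := by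
  obtain ⟨C, hC, h⟩ := exists_pow_card_primeFactors_le
  refine ⟨C, hC, fun d hd => ?_⟩
  have hd0 : (0 : ℝ) < d := by exact_mod_cast Nat.pos_of_ne_zero hd
  have h8 : ((2 : ℝ) ^ d.primeFactors.card) ^ 3 = 8 ^ d.primeFactors.card := by
    rw [← pow_mul, mul_comm, pow_mul]; norm_num
  have h1 := h d hd
  rw [h8]
  have e5 : ((d : ℝ) ^ (1 / 5 : ℝ)) ^ 4 = (d : ℝ) ^ (4 / 5 : ℝ) := by
    rw [← Real.rpow_natCast, ← Real.rpow_mul hd0.le]; norm_num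
  have e2 : (d : ℝ) ^ 2 = (d : ℝ) ^ (2 : ℝ) := by rw [← Real.rpow_natCast]; norm_num
  constructor
  · calc (8 : ℝ) ^ d.primeFactors.card / d ^ 2 ≤ C * (d : ℝ) ^ (1 / 10 : ℝ) / d ^ 2 := by gcongr
      _ = _ := by
        rw [e5, e2, mul_div_assoc, mul_div_assoc, ← Real.rpow_sub hd0, ← Real.rpow_sub hd0]
        norm_num
  · calc (8 : ℝ) ^ d.primeFactors.card / d ≤ C * (d : ℝ) ^ (1 / 10 : ℝ) / d := by gcongr
      _ = _ := by
        rw [mul_assoc, ← Real.rpow_add hd0, mul_div_assoc]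
        nth_rewrite 2 [← Real.rpow_one (d : ℝ)]
        rw [← Real.rpow_sub hd0]
        norm_num

theorem apCount_le {x : ℝ} (hx : 0 ≤ x) {d : ℕ} : (apCount x d : ℝ) ≤ 2 * x / d := by
  have h : apCount x d ≤ ⌊2 * x⌋₊ / d := by
    rw [← Nat.Ioc_filter_dvd_card_eq_div, apCount]
    refine Finset.card_le_card_of_injOn (fun p => p - 1) (fun p hp => ?_) (fun p hp q hq hpq => ?_)
    · rw [Finset.mem_coe, Finset.mem_filter] at hp ⊢
      obtain ⟨h1, h2, h3⟩ := (mem_dyadicPrimes hx).1 hp.1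
      have := h1.two_le
      have h4 : p ≤ ⌊2 * x⌋₊ := Nat.le_floor h3
      dsimp only
      exact ⟨Finset.mem_Ioc.2 ⟨by omega, by omega⟩, hp.2⟩
    · rw [Finset.mem_coe, Finset.mem_filter] at hp hq
      have h1 := ((mem_dyadicPrimes hx).1 hp.1).1.two_le
      have h2 := ((mem_dyadicPrimes hx).1 hq.1).1.two_le
      simp only at hpq
      omega
  calc (apCount x d : ℝ) ≤ (⌊2 * x⌋₊ / d : ℕ) := by exact_mod_cast h
    _ ≤ (⌊2 * x⌋₊ : ℝ) / d := Nat.cast_div_le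
    _ ≤ _ := by gcongr; exact Nat.floor_le (by positivity)

set_option maxHeartbeats 1000000 in
theorem exists_abs_sqfreeProd_mul_apCount_sub_le {c : ℕ → ℝ} (hc : ∀ p : ℕ, p.Prime → |c p| ≤ 2 / p) :
    ∃ K > 0, ∀ x : ℝ, 4 ≤ x → Real.log x ^ 3 < x → ∀ d : ℕ, d ≠ 0 →
      |sqfreeProd c d * apCount x d - sqfreeProd c d / d.totient * (x / Real.log x)| ≤
        K * (x / Real.log x ^ 2) * (d : ℝ) ^ (-(11 / 10) : ℝ) := by
  classical
  obtain ⟨C, hC, hCd⟩ := exists_pow_card_primeFactors_div_le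
  obtain ⟨C₁, hC₁, h₁⟩ := exists_abs_card_dyadicPrimes_sub_le
  obtain ⟨C₂, hC₂, h₂⟩ := exists_sum_norm_sum_prime_char_le
  refine ⟨C * (4 + C₂ + 2 * C₁), by positivity, fun x hx hLx d hd => ?_⟩
  have hl := one_le_log_of_four_le hx
  have hx0 : 0 < x := by linarith
  have hd0 : (0 : ℝ) < d := by exact_mod_cast Nat.pos_of_ne_zero hd
  have hd1 : (1 : ℝ) ≤ d := by exact_mod_cast Nat.pos_of_ne_zero hd
  have hφ : (0 : ℝ) < d.totient := by exact_mod_cast Nat.totient_pos.2 (Nat.pos_of_ne_zero hd)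
  have hP := h₁ x hx
  obtain ⟨hA, hB⟩ := hCd d hd
  have hg := abs_sqfreeProd_le hc d
  have hi := inv_totient_le hd
  set g := sqfreeProd c d with hgdef
  set L := Real.log x with hL
  set W : ℝ := 2 ^ d.primeFactors.card with hW
  have hW1 : 1 ≤ W := one_le_pow₀ (by norm_num)
  set e : ℝ := (d : ℝ) ^ (-(11 / 10) : ℝ) with he
  have he0 : 0 < e := Real.rpow_pos_of_pos hd0 _
  set a : ℝ := (d : ℝ) ^ (1 / 5 : ℝ) with ha
  have ha1 : 1 ≤ a := Real.one_le_rpow hd1 (by norm_num)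
  have ha5 : a ^ 5 = d := by
    rw [ha, ← Real.rpow_natCast, ← Real.rpow_mul hd0.le]; norm_num
  set P : ℝ := ((dyadicPrimes x).card : ℝ) with hPdef
  have hP0 : 0 ≤ P := Nat.cast_nonneg _
  set y : ℝ := x / L ^ 2 with hy
  have hy0 : 0 < y := by positivity
  have hyL : x / L = y * L := by rw [hy]; field_simp
  have hyL2 : x = y * L ^ 2 := by rw [hy]; field_simp
  have hW2 : W ^ 2 ≤ W ^ 3 := pow_le_pow_right₀ hW1 (by norm_num)
  have hW3 : W ≤ W ^ 3 := le_self_pow₀ hW1 (by norm_num)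
  have hgφ : |g / d.totient| ≤ W ^ 2 / d ^ 2 := by
    rw [abs_div, abs_of_pos hφ, div_eq_mul_inv]
    calc |g| * (d.totient : ℝ)⁻¹ ≤ (W / d) * (W / d) := by gcongr
      _ = _ := by ring
  by_cases hs : Squarefree d
  swap
  · have : g = 0 := by rw [hgdef, sqfreeProd_apply, if_neg hs]
    rw [this, zero_mul, zero_div, zero_mul, sub_zero, abs_zero]
    positivity
  rcases lt_or_ge (L ^ 3) (d : ℝ) with hbig | hsmall
  · have hT : (apCount x d : ℝ) ≤ 2 * x / d := apCount_le hx0.le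
    have ha4 : L ^ 2 ≤ a ^ 4 := by
      by_contra hcon
      push Not at hcon
      have h1 : (a ^ 4) ^ 5 < (L ^ 2) ^ 5 := pow_lt_pow_left₀ hcon (by positivity) (by norm_num)
      have h2 : (L ^ 3) ^ 4 < (a ^ 5) ^ 4 := by
        rw [ha5]; exact pow_lt_pow_left₀ hbig (by positivity) (by norm_num)
      have h3 : L ^ 10 ≤ L ^ 12 := pow_le_pow_right₀ hl (by norm_num)
      nlinarith
    have hAL : W ^ 3 / d ^ 2 * x ≤ C * e * y := by
      calc W ^ 3 / d ^ 2 * x ≤ C * e / a ^ 4 * x := by gcongr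
        _ ≤ C * e / L ^ 2 * x := by gcongr
        _ = _ := by rw [hy]; ring
    have b1 : |g * apCount x d| ≤ 2 * (W ^ 3 / d ^ 2 * x) := by
      rw [abs_mul, Nat.abs_cast]
      calc |g| * apCount x d ≤ (W ^ 3 / d) * (2 * x / d) := by
            gcongr
            exact hg.trans (by gcongr)
        _ = _ := by ring
    have b2 : |g / d.totient * (x / L)| ≤ W ^ 3 / d ^ 2 * x := by
      rw [abs_mul, abs_of_pos (by positivity : 0 < x / L)]
      have : x / L ≤ x := div_le_self hx0.le hl
      gcongr
      exact hgφ.trans (by gcongr)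
    calc |g * apCount x d - g / d.totient * (x / L)|
        ≤ |g * apCount x d| + |g / d.totient * (x / L)| := abs_sub _ _
      _ ≤ 3 * (C * e * y) := by linarith
      _ ≤ C * (4 + C₂ + 2 * C₁) * y * e := by
        have : 0 < C * e * y := by positivity
        have h1 : 0 < C * e * y * C₁ := by positivity
        have h2 : 0 < C * e * y * C₂ := by positivity
        nlinarith
  · have : NeZero d := ⟨hd⟩
    have hT := (abs_totient_mul_apCount_sub_le (d := d) hx0.le (hsmall.trans_lt hLx)).trans
      (h₂ d hs x hx hsmall)
    have e1 : g * apCount x d - g / d.totient * (x / L) =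
        g / d.totient * ((d.totient * apCount x d - P) + (P - x / L)) := by
      field_simp; ring
    have haL : a ≤ L ^ 2 := by
      by_contra hcon
      push Not at hcon
      have h1 : (L ^ 2) ^ 5 < a ^ 5 := pow_lt_pow_left₀ hcon (by positivity) (by norm_num)
      have h3 : L ^ 3 ≤ L ^ 10 := pow_le_pow_right₀ hl (by norm_num)
      rw [ha5] at h1
      nlinarith
    set R : ℝ := if (d : ℝ) ^ 4 ≤ L ^ 5 then 0 else W * P with hR
    have b0 : |(d.totient * apCount x d - P) + (P - x / L)| ≤
        d.totient * (C₂ * x / L ^ 4) + R + C₁ * y := by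
      refine (abs_add_le _ _).trans (add_le_add hT (hP.trans (le_of_eq ?_)))
      rw [hy]; ring
    have b1 : |g / d.totient| * (d.totient * (C₂ * x / L ^ 4)) ≤ C₂ * (C * e * y) := by
      rw [abs_div, abs_of_pos hφ]
      calc |g| / d.totient * (d.totient * (C₂ * x / L ^ 4)) = |g| * (C₂ * x / L ^ 4) := by
            field_simp
        _ ≤ (W ^ 3 / d) * (C₂ * x / L ^ 4) := by
            gcongr
            exact hg.trans (by gcongr)
        _ ≤ (C * e * L ^ 2) * (C₂ * x / L ^ 4) := by
            gcongr
            exact hB.trans (by gcongr)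
        _ = _ := by rw [hy]; field_simp
    have b3 : |g / d.totient| * (C₁ * y) ≤ C₁ * (C * e * y) := by
      calc |g / d.totient| * (C₁ * y) ≤ (W ^ 3 / d ^ 2) * (C₁ * y) := by
            gcongr
            exact hgφ.trans (by gcongr)
        _ ≤ (C * e) * (C₁ * y) := by
            gcongr
            exact hA.trans (div_le_self (by positivity) (one_le_pow₀ ha1))
        _ = _ := by ring
    have hPle : P ≤ (1 + C₁) * (y * L) := by
      have h1 := (abs_le.1 hP).2
      have h2 : C₁ * x / L ^ 2 = C₁ * y := by rw [hy]; ring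
      rw [h2, hyL] at h1
      nlinarith [mul_nonneg (mul_nonneg hC₁.le hy0.le) (sub_nonneg.2 hl)]
    have b2 : |g / d.totient| * R ≤ (1 + C₁) * (C * e * y) := by
      rw [hR]
      split_ifs with hcase
      · rw [mul_zero]; positivity
      · have haL4 : L ≤ a ^ 4 := by
          by_contra hcon
          push Not at hcon
          have h1 : (a ^ 4) ^ 5 < L ^ 5 := pow_lt_pow_left₀ hcon (by positivity) (by norm_num)
          rw [← ha5] at hcase
          push Not at hcase
          nlinarith
        have q1 : |g / d.totient| * (W * P) ≤ W ^ 2 / d ^ 2 * (W * ((1 + C₁) * (y * L))) :=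
          mul_le_mul hgφ (mul_le_mul_of_nonneg_left hPle (by linarith))
            (mul_nonneg (by linarith) hP0) (by positivity)
        have q2 : W ^ 3 / d ^ 2 ≤ C * e / L :=
          hA.trans (div_le_div_of_nonneg_left (by positivity) (by positivity) haL4)
        have q3 : 0 ≤ (1 + C₁) * (y * L) := hP0.trans hPle
        have hL0 : L ≠ 0 := by linarith
        calc |g / d.totient| * (W * P) ≤ W ^ 2 / d ^ 2 * (W * ((1 + C₁) * (y * L))) := q1
          _ = W ^ 3 / d ^ 2 * ((1 + C₁) * (y * L)) := by ring
          _ ≤ (C * e / L) * ((1 + C₁) * (y * L)) := mul_le_mul_of_nonneg_right q2 q3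
          _ = _ := by field_simp
    rw [e1, abs_mul]
    calc |g / d.totient| * _ ≤ |g / d.totient| * (d.totient * (C₂ * x / L ^ 4) + R + C₁ * y) := by gcongr
      _ ≤ C₂ * (C * e * y) + (1 + C₁) * (C * e * y) + C₁ * (C * e * y) := by
        rw [mul_add, mul_add]; linarith
      _ ≤ C * (4 + C₂ + 2 * C₁) * y * e := by
        have : 0 < C * e * y := by positivity
        nlinarith

theorem sum_dyadicPrimes_prod_one_add (c : ℕ → ℝ) {x : ℝ} (hx : 0 ≤ x) :
    HasSum (fun d => sqfreeProd c d * apCount x d)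
      (∑ p ∈ dyadicPrimes x, ∏ q ∈ (p - 1).primeFactors, (1 + c q)) := by
  have h1 : ∑ p ∈ dyadicPrimes x, ∏ q ∈ (p - 1).primeFactors, (1 + c q) =
      ∑ d ∈ Finset.range (⌊2 * x⌋₊ + 1), sqfreeProd c d * apCount x d := by
    have : ∀ p ∈ dyadicPrimes x, ∏ q ∈ (p - 1).primeFactors, (1 + c q) =
        ∑ d ∈ Finset.range (⌊2 * x⌋₊ + 1), if d ∣ p - 1 then sqfreeProd c d else 0 := by
      intro p hp
      obtain ⟨h1, h2, h3⟩ := (mem_dyadicPrimes hx).1 hp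
      have h4 : p ≤ ⌊2 * x⌋₊ := Nat.le_floor h3
      have h5 := h1.two_le
      rw [prod_one_add_eq_sum_divisors c (by omega), ← Finset.sum_filter]
      congr 1
      ext d
      simp only [Nat.mem_divisors, Finset.mem_filter, Finset.mem_range]
      constructor
      · rintro ⟨h6, h7⟩
        have := Nat.le_of_dvd (by omega) h6
        exact ⟨by omega, h6⟩
      · rintro ⟨-, h6⟩
        exact ⟨h6, by omega⟩
    rw [Finset.sum_congr rfl this, Finset.sum_comm]
    refine Finset.sum_congr rfl fun d _ => ?_
    rw [← Finset.sum_filter, Finset.sum_const, apCount, nsmul_eq_mul, mul_comm]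
  rw [h1]
  refine hasSum_sum_of_ne_finset_zero fun d hd => ?_
  have : apCount x d = 0 := by
    rw [apCount, Finset.card_eq_zero, Finset.filter_eq_empty_iff]
    intro p hp hdp
    obtain ⟨h1, h2, h3⟩ := (mem_dyadicPrimes hx).1 hp
    have h4 : p ≤ ⌊2 * x⌋₊ := Nat.le_floor h3
    have h5 := h1.two_le
    have := Nat.le_of_dvd (by omega) hdp
    rw [Finset.mem_range] at hd
    omega
  rw [this, Nat.cast_zero, mul_zero]

end MeanValue

section EulerProduct

theorem summable_natCast_rpow_eleven_tenths : Summable fun d : ℕ => (d : ℝ) ^ (-(11 / 10) : ℝ) :=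
  Real.summable_nat_rpow.2 (by norm_num)

theorem summable_norm_sqfreeProd_div_totient {c : ℕ → ℝ}
    (hc : ∀ p : ℕ, p.Prime → |c p| ≤ 2 / p) :
    Summable fun d : ℕ => ‖sqfreeProd c d / d.totient‖ := by
  obtain ⟨C, hC, h⟩ := exists_pow_card_primeFactors_div_le
  refine Summable.of_nonneg_of_le (fun _ => norm_nonneg _) (fun d => ?_)
    (summable_natCast_rpow_eleven_tenths.mul_left C)
  rcases eq_or_ne d 0 with rfl | hd
  · simp
  have hd1 : (1 : ℝ) ≤ d := by exact_mod_cast Nat.pos_of_ne_zero hd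
  have hi := inv_totient_le hd
  have hg := abs_sqfreeProd_le hc d
  have hA := (h d hd).1
  set W : ℝ := 2 ^ d.primeFactors.card with hW
  have hW1 : 1 ≤ W := one_le_pow₀ (by norm_num)
  have ha1 : 1 ≤ (d : ℝ) ^ (1 / 5 : ℝ) := Real.one_le_rpow hd1 (by norm_num)
  rw [Real.norm_eq_abs, abs_div, Nat.abs_cast, div_eq_mul_inv]
  calc |sqfreeProd c d| * (d.totient : ℝ)⁻¹ ≤ (W / d) * (W / d) := by gcongr
    _ = W ^ 2 / d ^ 2 := by ring
    _ ≤ W ^ 3 / d ^ 2 := by gcongr; norm_num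
    _ ≤ _ := hA.trans (div_le_self (by positivity) (one_le_pow₀ ha1))

theorem tsum_sqfreeProd_div_totient {c : ℕ → ℝ} (hc : ∀ p : ℕ, p.Prime → |c p| ≤ 2 / p) :
    ∑' d : ℕ, sqfreeProd c d / d.totient =
      ∏' p : Nat.Primes, (1 + c p / ((p : ℕ) - 1 : ℝ)) := by
  have hm := isMultiplicative_sqfreeProd c
  have h := EulerProduct.eulerProduct_hasProd (f := fun d : ℕ => sqfreeProd c d / d.totient)
    (by simp [hm.map_one]) (fun {m n} hmn => by
      rw [hm.map_mul_of_coprime hmn, Nat.totient_mul hmn]; push_cast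
      rw [mul_div_mul_comm])
    (summable_norm_sqfreeProd_div_totient hc) (by simp)
  rw [← h.tprod_eq]
  refine tprod_congr fun p => ?_
  have hp := p.2
  rw [tsum_eq_sum (s := Finset.range 2)]
  · rw [Finset.sum_range_succ, Finset.sum_range_one, pow_zero, pow_one, hm.map_one,
      sqfreeProd_prime c hp, Nat.totient_prime hp, Nat.cast_sub hp.one_le]
    simp
  · intro e he
    have he2 : 2 ≤ e := by
      rw [Finset.mem_range] at he
      omega
    rw [sqfreeProd_apply, if_neg, zero_div]
    rw [Nat.squarefree_pow_iff hp.ne_one (by omega)]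
    omega

theorem exists_abs_sum_dyadicPrimes_prod_sub_le {c : ℕ → ℝ}
    (hc : ∀ p : ℕ, p.Prime → |c p| ≤ 2 / p) :
    ∃ K > 0, ∀ x : ℝ, 4 ≤ x → Real.log x ^ 3 < x →
      |∑ p ∈ dyadicPrimes x, ∏ q ∈ (p - 1).primeFactors, (1 + c q) -
        (∏' p : Nat.Primes, (1 + c p / ((p : ℕ) - 1 : ℝ))) * (x / Real.log x)| ≤
        K * (x / Real.log x ^ 2) := by
  obtain ⟨K, hK, h⟩ := exists_abs_sqfreeProd_mul_apCount_sub_le hc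
  have hS := summable_natCast_rpow_eleven_tenths
  refine ⟨K * (1 + ∑' d : ℕ, (d : ℝ) ^ (-(11 / 10) : ℝ)), ?_, fun x hx hlx => ?_⟩
  · have : 0 ≤ ∑' d : ℕ, (d : ℝ) ^ (-(11 / 10) : ℝ) := tsum_nonneg fun d => by positivity
    positivity
  have hx0 : 0 < x := by linarith
  have hl := one_le_log_of_four_le hx
  rw [← tsum_sqfreeProd_div_totient hc]
  have h1 := (sum_dyadicPrimes_prod_one_add c hx0.le).sub
    ((summable_norm_sqfreeProd_div_totient hc).of_norm.hasSum.mul_right (x / Real.log x))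
  rw [← h1.tsum_eq, ← Real.norm_eq_abs]
  refine (tsum_of_norm_bounded (hS.hasSum.mul_left (K * (x / Real.log x ^ 2))) fun d => ?_).trans ?_
  · rcases eq_or_ne d 0 with rfl | hd
    · simp
    · exact h x hx hlx d hd
  · have : 0 ≤ K * (x / Real.log x ^ 2) := by positivity
    linarith

theorem totient_div_eq_prod {n : ℕ} (hn : n ≠ 0) :
    (n.totient : ℝ) / n = ∏ p ∈ n.primeFactors, (1 + -1 / (p : ℝ)) := by
  have h0 : (n : ℝ) ≠ 0 := by exact_mod_cast hn
  have := congrArg (Rat.cast : ℚ → ℝ) (Nat.totient_eq_mul_prod_factors n)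
  push_cast at this
  rw [this, mul_div_cancel_left₀ _ h0]
  exact Finset.prod_congr rfl fun p _ => by ring

theorem totient_totient_prime_sq {p : ℕ} (hp : p.Prime) :
    (p ^ 2).totient.totient = (p - 1).totient * (p - 1) := by
  have hco : p.Coprime (p - 1) :=
    (Nat.coprime_self_sub_right hp.one_le).2 (Nat.coprime_one_right p)
  rw [Nat.totient_prime_pow hp (by norm_num)]
  simp only [Nat.add_one_sub_one, pow_one]
  rw [Nat.totient_mul hco, Nat.totient_prime hp, mul_comm]

theorem tprod_primes_one_add_pos {f : ℕ → ℝ} (h0 : ∀ p : ℕ, p.Prime → 0 < 1 + f p)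
    (h1 : ∀ p : ℕ, p.Prime → |f p| ≤ 4 / (p : ℝ) ^ 2) :
    0 < ∏' p : Nat.Primes, (1 + f p) := by
  have hs : Summable fun p : Nat.Primes => f p := by
    have h2 : Summable fun n : ℕ => 4 / (n : ℝ) ^ 2 := by
      simpa [div_eq_mul_inv] using (Real.summable_nat_pow_inv.2 one_lt_two).mul_left 4
    exact Summable.of_norm_bounded (h2.comp_injective Nat.Primes.coe_nat_injective)
      fun p => h1 p p.2
  rw [← Real.rexp_tsum_eq_tprod (f := fun p : Nat.Primes => 1 + f p) (fun p => h0 p p.2)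
    (Real.summable_log_one_add_of_summable (f := fun p : Nat.Primes => f p) hs)]
  exact Real.exp_pos _

end EulerProduct

section MainTerm

theorem artinA1_eq : artinA1 = ∏' p : Nat.Primes, (1 + -1 / ((p : ℕ) : ℝ) / ((p : ℕ) - 1 : ℝ)) := by
  rw [artinA1]
  refine tprod_congr fun p => ?_
  rw [div_div]; ring

theorem artinA2_eq : artinA2 =
    ∏' p : Nat.Primes,
      (1 + (-2 / ((p : ℕ) : ℝ) + 1 / ((p : ℕ) : ℝ) ^ 2) / ((p : ℕ) - 1 : ℝ)) := by
  rw [artinA2]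
  refine tprod_congr fun p => ?_
  have h : (2 : ℝ) ≤ (p : ℕ) := by exact_mod_cast p.2.two_le
  have h1 : ((p : ℕ) : ℝ) - 1 ≠ 0 := by linarith
  have h0 : ((p : ℕ) : ℝ) ≠ 0 := by linarith
  field_simp; ring

theorem artinA1_pos : 0 < artinA1 := by
  rw [artinA1_eq]
  refine tprod_primes_one_add_pos (f := fun p => -1 / (p : ℝ) / ((p : ℝ) - 1))
    (fun p hp => ?_) (fun p hp => ?_)
  all_goals
    have h : (2 : ℝ) ≤ p := by exact_mod_cast hp.two_le
    have h1 : 0 < (p : ℝ) - 1 := by linarith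
    have h0 : 0 < (p : ℝ) := by linarith
  · have : 1 + -1 / (p : ℝ) / ((p : ℝ) - 1) = (p * (p - 1) - 1) / (p * (p - 1)) := by
      field_simp; ring
    rw [this]
    exact div_pos (by nlinarith) (by positivity)
  · rw [div_div, abs_div, abs_neg, abs_one, abs_of_pos (by positivity),
      div_le_div_iff₀ (by positivity) (by positivity)]
    nlinarith

theorem artinA2_pos : 0 < artinA2 := by
  rw [artinA2_eq]
  refine tprod_primes_one_add_pos
    (f := fun p => (-2 / (p : ℝ) + 1 / (p : ℝ) ^ 2) / ((p : ℝ) - 1))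
    (fun p hp => ?_) (fun p hp => ?_)
  all_goals
    have h : (2 : ℝ) ≤ p := by exact_mod_cast hp.two_le
    have h1 : 0 < (p : ℝ) - 1 := by linarith
    have h0 : 0 < (p : ℝ) := by linarith
  · have : 1 + (-2 / (p : ℝ) + 1 / (p : ℝ) ^ 2) / ((p : ℝ) - 1) =
        (p ^ 2 * (p - 1) - (2 * p - 1)) / (p ^ 2 * (p - 1)) := by
      field_simp; ring
    rw [this]
    exact div_pos (by nlinarith [mul_nonneg h0.le (sub_nonneg.2 h)]) (by positivity)
  · have : (-2 / (p : ℝ) + 1 / (p : ℝ) ^ 2) / ((p : ℝ) - 1) =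
        -((2 * p - 1) / (p ^ 2 * (p - 1))) := by
      field_simp; ring
    rw [this, abs_neg, abs_of_pos (div_pos (by linarith) (by positivity)),
      div_le_div_iff₀ (by positivity) (by positivity)]
    nlinarith [sq_nonneg (p : ℝ), mul_nonneg (sq_nonneg (p : ℝ)) (sub_nonneg.2 h)]

theorem abs_summand_sub_le {p : ℕ} (hp : p.Prime) :
    |((p - 1).totient : ℝ) / ((p : ℝ) - 1) *
          (1 + ((p ^ 2).totient.totient : ℝ) / ((p : ℝ) ^ 2)) -
        (∏ q ∈ (p - 1).primeFactors, (1 + -1 / (q : ℝ)) +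
          ∏ q ∈ (p - 1).primeFactors, (1 + (-2 / (q : ℝ) + 1 / (q : ℝ) ^ 2)))| ≤ 2 / (p : ℝ) := by
  have h : (2 : ℝ) ≤ p := by exact_mod_cast hp.two_le
  have h1 : 0 < (p : ℝ) - 1 := by linarith
  have h0 : 0 < (p : ℝ) := by linarith
  have hn : p - 1 ≠ 0 := by have := hp.two_le; omega
  have hcast : ((p - 1 : ℕ) : ℝ) = (p : ℝ) - 1 := by rw [Nat.cast_sub hp.one_le, Nat.cast_one]
  have e1 := totient_div_eq_prod hn
  have e2 : ∏ q ∈ (p - 1).primeFactors, (1 + (-2 / (q : ℝ) + 1 / (q : ℝ) ^ 2)) =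
      (∏ q ∈ (p - 1).primeFactors, (1 + -1 / (q : ℝ))) ^ 2 := by
    rw [← Finset.prod_pow]
    exact Finset.prod_congr rfl fun q _ => by ring
  have hle : ((p - 1).totient : ℝ) / ((p - 1 : ℕ) : ℝ) ≤ 1 :=
    div_le_one_of_le₀ (by exact_mod_cast Nat.totient_le _) (Nat.cast_nonneg _)
  have hge : 0 ≤ ((p - 1).totient : ℝ) / ((p - 1 : ℕ) : ℝ) := by positivity
  rw [e2, ← e1, totient_totient_prime_sq hp]
  push_cast
  rw [hcast] at hle hge ⊢
  set f : ℝ := ((p - 1).totient : ℝ) / ((p : ℝ) - 1) with hf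
  have hft : ((p - 1).totient : ℝ) = f * (p - 1) := by rw [hf]; field_simp
  rw [hft]
  have e3 : f * (1 + f * (p - 1) * (p - 1) / (p : ℝ) ^ 2) - (f + f ^ 2) =
      -(f ^ 2 * ((2 * p - 1) / (p : ℝ) ^ 2)) := by
    field_simp; ring
  have h2 : 0 ≤ (2 * p - 1) / (p : ℝ) ^ 2 := div_nonneg (by linarith) (by positivity)
  rw [e3, abs_neg, abs_of_nonneg (mul_nonneg (sq_nonneg f) h2)]
  calc f ^ 2 * ((2 * p - 1) / (p : ℝ) ^ 2) ≤ 1 * ((2 * p - 1) / (p : ℝ) ^ 2) := by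
        gcongr
        exact pow_le_one₀ hge hle
    _ ≤ 2 / (p : ℝ) := by
        rw [one_mul, div_le_div_iff₀ (by positivity) h0]
        nlinarith

theorem exists_abs_sum_sub_le : ∃ K > 0, ∀ x : ℝ, 4 ≤ x → Real.log x ^ 3 < x →
    |(∑ p ∈ dyadicPrimes x, ((p - 1).totient : ℝ) / ((p : ℝ) - 1) *
          (1 + ((p ^ 2).totient.totient : ℝ) / ((p : ℝ) ^ 2))) -
        (artinA1 + artinA2) * (x / Real.log x)| ≤ K * (x / Real.log x ^ 2) := by
  obtain ⟨K₁, hK₁, h₁⟩ := exists_abs_sum_dyadicPrimes_prod_sub_le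
    (c := fun p => -1 / (p : ℝ)) fun p hp => by
      have h0 : (0 : ℝ) < p := by exact_mod_cast hp.pos
      rw [abs_div, abs_neg, abs_one, abs_of_pos h0]
      gcongr; norm_num
  obtain ⟨K₂, hK₂, h₂⟩ := exists_abs_sum_dyadicPrimes_prod_sub_le
    (c := fun p => -2 / (p : ℝ) + 1 / (p : ℝ) ^ 2) fun p hp => by
      have h : (2 : ℝ) ≤ p := by exact_mod_cast hp.two_le
      have h0 : (0 : ℝ) < p := by linarith
      have e : -2 / (p : ℝ) + 1 / (p : ℝ) ^ 2 = -((2 * p - 1) / (p : ℝ) ^ 2) := by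
        field_simp; ring
      rw [e, abs_neg, abs_of_nonneg (div_nonneg (by linarith) (by positivity)),
        div_le_div_iff₀ (by positivity) h0]
      nlinarith
  obtain ⟨C, hC, h₃⟩ := exists_abs_card_dyadicPrimes_sub_le
  refine ⟨K₁ + K₂ + 2 * (1 + C), by positivity, fun x hx hlx => ?_⟩
  have hx0 : 0 < x := by linarith
  have hl := one_le_log_of_four_le hx
  have k₁ := h₁ x hx hlx
  have k₂ := h₂ x hx hlx
  have k₃ := h₃ x hx
  rw [← artinA1_eq] at k₁
  rw [← artinA2_eq] at k₂
  have hlx2 : Real.log x ^ 2 ≤ x := (pow_le_pow_right₀ hl (by norm_num)).trans hlx.le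
  have hy1 : 1 ≤ x / Real.log x ^ 2 := (one_le_div (by positivity)).2 hlx2
  have hcard : ((dyadicPrimes x).card : ℝ) ≤ (1 + C) * x := by
    have h1 := (abs_le.1 k₃).2
    have h2 : x / Real.log x ≤ x := div_le_self hx0.le hl
    have h3 : C * x / Real.log x ^ 2 ≤ C * x := div_le_self (by positivity) (one_le_pow₀ hl)
    linarith
  have k₄ : |(∑ p ∈ dyadicPrimes x, ((p - 1).totient : ℝ) / ((p : ℝ) - 1) *
          (1 + ((p ^ 2).totient.totient : ℝ) / ((p : ℝ) ^ 2))) -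
        (∑ p ∈ dyadicPrimes x, ∏ q ∈ (p - 1).primeFactors, (1 + -1 / (q : ℝ)) +
          ∑ p ∈ dyadicPrimes x, ∏ q ∈ (p - 1).primeFactors,
            (1 + (-2 / (q : ℝ) + 1 / (q : ℝ) ^ 2)))| ≤ 2 * (1 + C) := by
    rw [← Finset.sum_add_distrib, ← Finset.sum_sub_distrib]
    refine (Finset.abs_sum_le_sum_abs _ _).trans ?_
    have hb : ∀ p ∈ dyadicPrimes x, (2 : ℝ) / p ≤ 2 / x := fun p hp => by
      have := ((mem_dyadicPrimes hx0.le).1 hp).2.1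
      gcongr
    refine (Finset.sum_le_sum fun p hp => (abs_summand_sub_le
      ((mem_dyadicPrimes hx0.le).1 hp).1).trans (hb p hp)).trans ?_
    rw [Finset.sum_const, nsmul_eq_mul]
    calc ((dyadicPrimes x).card : ℝ) * (2 / x) ≤ (1 + C) * x * (2 / x) := by gcongr
      _ = _ := by field_simp
  have hC1 : 2 * (1 + C) ≤ 2 * (1 + C) * (x / Real.log x ^ 2) :=
    le_mul_of_one_le_right (by positivity) hy1
  rw [abs_le] at k₁ k₂ k₄ ⊢
  constructor <;> linarith [k₁.1, k₁.2, k₂.1, k₂.2, k₄.1, k₄.2]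

theorem eventually_log_pow_three_lt : ∀ᶠ x : ℝ in atTop, Real.log x ^ 3 < x := by
  filter_upwards [(Real.isLittleO_pow_log_id_atTop (n := 3)).bound (by norm_num : (0 : ℝ) < 1 / 2),
    eventually_gt_atTop 1] with x hx h1
  rw [id, Real.norm_eq_abs, Real.norm_eq_abs, abs_of_pos (by linarith : 0 < x)] at hx
  linarith [le_abs_self (Real.log x ^ 3)]

end MainTerm

end ArtinMean

/-- One has
`Σ_{x ≤ p ≤ 2x} (φ(p−1)/(p−1)) · (1 + φ(φ(p²))/p²)
  = (a₁ + a₂) · (x/log x) · (1 + O(1/log x))` as `x → ∞`. -/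
theorem main_term_asymptotics :
    ∃ C : ℝ, 0 < C ∧ ∃ x₀ : ℝ, ∀ x : ℝ, x₀ ≤ x →
      |(∑ p ∈ (Finset.Icc ⌈x⌉₊ ⌊2 * x⌋₊).filter Nat.Prime,
          ((Nat.totient (p - 1) : ℝ) / ((p : ℝ) - 1)) *
            (1 + (Nat.totient (Nat.totient (p ^ 2)) : ℝ) / ((p : ℝ) ^ 2)))
        - (artinA1 + artinA2) * (x / Real.log x)|
      ≤ (artinA1 + artinA2) * (x / Real.log x) * (C / Real.log x) := by
  obtain ⟨K, hK, h⟩ := ArtinMean.exists_abs_sum_sub_le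
  obtain ⟨x₁, hx₁⟩ := Filter.eventually_atTop.1 ArtinMean.eventually_log_pow_three_lt
  have hA : 0 < artinA1 + artinA2 := add_pos ArtinMean.artinA1_pos ArtinMean.artinA2_pos
  refine ⟨K / (artinA1 + artinA2), by positivity, max 4 x₁, fun x hx => ?_⟩
  have hx4 : 4 ≤ x := (le_max_left _ _).trans hx
  have hl := ArtinMean.one_le_log_of_four_le hx4
  refine (h x hx4 (hx₁ x ((le_max_right _ _).trans hx))).trans (le_of_eq ?_)
  have hl0 : Real.log x ≠ 0 := by linarith
  field_simp
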